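/- arXiv:1503.06563 — 2 statements merged into one kernel-verified Lean document; each statement's English description precedes it below -/
import Mathlib

section
/- For any n ≥ 2, let X = (X_1,…,X_n) be a centered Gaussian vector with E[X_i²] = 1 for all i and E[X_i X_j] ≤ ε for all i ≠ j, for some ε > 0. Then there exists a universal constant c > 0 such that for all t ≥ 0, P(|M_n − E[M_n]| ≥ t) ≤ 6 e^{−c t/√(K_n)}, where M_n = max_{1≤i≤n} X_i and K_n = max(ε, 1/log n). -/
open MeasureTheory ProbabilityTheory Real


/-- centered Gaussian law with unit variances -/
structure SGV {n : ℕ} (μ : Measure (Fin n → ℝ)) : Prop where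
  gauss : IsGaussian μ
  mean : ∀ L : StrongDual ℝ (Fin n → ℝ), ∫ x, L x ∂μ = 0
  var : ∀ i, ∫ x, x i ^ 2 ∂μ = 1

/-- bounded C1 function with bounded partial derivatives -/
structure GoodF {n : ℕ} (f : (Fin n → ℝ) → ℝ) (D : Fin n → (Fin n → ℝ) → ℝ) (B : ℝ) : Prop where
  deriv : ∀ x, HasFDerivAt f (∑ i, D i x • (ContinuousLinearMap.proj i : (Fin n → ℝ) →L[ℝ] ℝ)) x
  cont : ∀ i, Continuous (D i)
  bound : ∀ x, |f x| ≤ B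
  dbound : ∀ i x, |D i x| ≤ B

lemma stein_one {h h' : ℝ → ℝ} {B : ℝ} (hd : ∀ x, HasDerivAt h (h' x) x)
    (hc : Continuous h') (hb : ∀ x, |h x| ≤ B) (hb' : ∀ x, |h' x| ≤ B) :
    ∫ x, x * h x ∂(gaussianReal 0 1) = ∫ x, h' x ∂(gaussianReal 0 1) := by
  have hhc : Continuous h := continuous_iff_continuousAt.2 fun x => (hd x).continuousAt
  rw [integral_gaussianReal_eq_integral_smul one_ne_zero,
    integral_gaussianReal_eq_integral_smul one_ne_zero]
  have hpd : ∀ x, HasDerivAt (gaussianPDFReal 0 1) (-x * gaussianPDFReal 0 1 x) x := by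
    intro x
    have : gaussianPDFReal 0 1 = fun x => (√(2 * π))⁻¹ * rexp (-(x^2)/2) := by
      ext x; simp [gaussianPDFReal]
    rw [this]
    have h1 : HasDerivAt (fun x : ℝ => -(x^2)/2) (-x) x := by
      have := ((hasDerivAt_pow 2 x).neg.div_const 2)
      exact this.congr_deriv (by simp <;> ring)
    have := (h1.exp).const_mul (√(2 * π))⁻¹
    exact this.congr_deriv (by ring)
  have hpi := integrable_gaussianPDFReal 0 1
  have hxp : Integrable (fun x : ℝ => x * gaussianPDFReal 0 1 x) := by
    have : Integrable (fun x : ℝ => x) (gaussianReal 0 1) := by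
      exact (memLp_id_gaussianReal (μ := 0) (v := 1) 1).integrable (by simp)
    rw [gaussianReal_of_var_ne_zero _ one_ne_zero,
      integrable_withDensity_iff_integrable_smul' (measurable_gaussianPDF _ _)
      (ae_of_all _ fun _ ↦ gaussianPDF_lt_top)] at this
    refine this.congr (ae_of_all _ fun x => ?_)
    simp [toReal_gaussianPDF, mul_comm]
  have key := integral_mul_deriv_eq_deriv_mul_of_integrable (u := h) (u' := h')
    (v := gaussianPDFReal 0 1) (v' := fun x => -x * gaussianPDFReal 0 1 x)
    (fun x _ => hd x) (fun x _ => hpd x) ?_ ?_ ?_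
  · simp only [smul_eq_mul]
    have e1 : ∀ x, gaussianPDFReal 0 1 x * (x * h x) = -(h x * (-x * gaussianPDFReal 0 1 x)) := by
      intro x; ring
    simp_rw [e1, integral_neg, key, neg_neg]
    congr 1; ext x; ring
  · have : (h * fun x => -x * gaussianPDFReal 0 1 x) = fun x => h x * (-(x * gaussianPDFReal 0 1 x)) := by
      ext x; simp
    rw [this]
    exact hxp.neg.bdd_mul hhc.aestronglyMeasurable (ae_of_all _ hb)
  · exact hpi.bdd_mul hc.aestronglyMeasurable (ae_of_all _ hb')
  · exact hpi.bdd_mul hhc.aestronglyMeasurable (ae_of_all _ hb)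

namespace SGV
variable {n : ℕ} {μ : Measure (Fin n → ℝ)}

lemma eval_mean (h : SGV μ) (i : Fin n) : ∫ x, x i ∂μ = 0 := by
  simpa using h.mean (ContinuousLinearMap.proj i)

lemma memLp (h : SGV μ) (i : Fin n) : MemLp (fun x : Fin n → ℝ => x i) 2 μ := by
  have := h.gauss
  simpa using! IsGaussian.memLp_dual μ (ContinuousLinearMap.proj (R := ℝ) (φ := fun _ => ℝ) i) 2 (by simp)

lemma integrable_eval (h : SGV μ) (i : Fin n) : Integrable (fun x : Fin n → ℝ => x i) μ := by
  have := h.gauss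
  exact (h.memLp i).integrable (by norm_num)

lemma map_eval (h : SGV μ) (i : Fin n) : μ.map (fun x => x i) = gaussianReal 0 1 := by
  have := h.gauss
  have h1 := IsGaussian.map_eq_gaussianReal (μ := μ) (ContinuousLinearMap.proj (R := ℝ) (φ := fun _ => ℝ) i)
  have h2 : Var[(ContinuousLinearMap.proj (R := ℝ) (φ := fun _ : Fin n => ℝ) i); μ] = 1 := by
    have : ⇑(ContinuousLinearMap.proj (R := ℝ) (φ := fun _ : Fin n => ℝ) i) = fun x => x i := by ext; simp
    rw [this, variance_eq_sub (h.memLp i), h.eval_mean]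
    simpa using h.var i
  rw [h2, h.mean] at h1
  simpa using! h1

lemma stein (h : SGV μ) (k : Fin n) {f : (Fin n → ℝ) → ℝ} {D : Fin n → (Fin n → ℝ) → ℝ} {B : ℝ}
    (hf : GoodF f D B) :
    ∫ x, x k * f x ∂μ = ∑ l, (∫ x, x k * x l ∂μ) * ∫ x, D l x ∂μ := by
  have := h.gauss
  have hfc : Continuous f := continuous_iff_continuousAt.2 fun x => (hf.deriv x).continuousAt
  set g : Fin n → ℝ := fun l => ∫ x, x k * x l ∂μ with hg
  let T : (Fin n → ℝ) →L[ℝ] ℝ × (Fin n → ℝ) :=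
    (ContinuousLinearMap.proj k).prod
      (ContinuousLinearMap.id ℝ _ - (ContinuousLinearMap.proj k : (Fin n → ℝ) →L[ℝ] ℝ).smulRight g)
  have hT : ∀ x, T x = (x k, x - x k • g) := fun x => by simp [T]
  have hG : HasGaussianLaw (fun x : Fin n → ℝ => (x k, fun j => x j - x k * g j)) μ := by
    exact (IsGaussian.hasGaussianLaw_id (μ := μ)).map T
  have hG' : HasGaussianLaw (fun x : Fin n → ℝ => ((fun _ : Unit => x k), fun j => x j - x k * g j)) μ := by
    let S : (ℝ × (Fin n → ℝ)) →L[ℝ] (Unit → ℝ) × (Fin n → ℝ) :=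
      (ContinuousLinearMap.pi fun _ => ContinuousLinearMap.fst ℝ ℝ (Fin n → ℝ)).prod
        (ContinuousLinearMap.snd ℝ ℝ (Fin n → ℝ))
    exact hG.map S
  have hind0 := hG'.indepFun_of_covariance_eval (X := fun _ (x : Fin n → ℝ) => x k) (Y := fun j (x : Fin n → ℝ) => x j - x k * g j) (by
    intro _ j
    rw [covariance_fun_sub_right (h.memLp k) (h.memLp j) ((h.memLp k).mul_const _),
      covariance_mul_const_right, covariance_eq_sub (h.memLp k) (h.memLp j),
      covariance_eq_sub (h.memLp k) (h.memLp k), h.eval_mean, h.eval_mean]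
    have := h.var k
    simp [hg, pow_two] at this ⊢
    rw [this]; ring)
  have hind : IndepFun (fun x : Fin n → ℝ => x k) (fun x j => x j - x k * g j) μ :=
    hind0.comp (φ := fun u : Unit → ℝ => u ()) (ψ := id) (by fun_prop) measurable_id
  have hmap := (indepFun_iff_map_prod_eq_prod_map_map (measurable_pi_apply k).aemeasurable (by fun_prop)).1 hind
  rw [h.map_eval] at hmap
  set ν := μ.map (fun (x : Fin n → ℝ) j => x j - x k * g j) with hν
  have : IsProbabilityMeasure ν := Measure.isProbabilityMeasure_map (by fun_prop)
  -- transfer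
  have tr : ∀ F : ℝ → (Fin n → ℝ) → ℝ, Continuous (fun p : ℝ × (Fin n → ℝ) => F p.1 p.2) →
      Integrable (fun p : ℝ × (Fin n → ℝ) => F p.1 p.2) ((gaussianReal 0 1).prod ν) →
      ∫ x, F (x k) (fun j => x j - x k * g j) ∂μ = ∫ w, ∫ t, F t w ∂(gaussianReal 0 1) ∂ν := by
    intro F hF hi
    rw [← integral_prod_symm (f := fun p : ℝ × (Fin n → ℝ) => F p.1 p.2) hi, ← hmap, integral_map (by fun_prop) hF.aestronglyMeasurable]
  have hline : ∀ x : Fin n → ℝ, (fun j => x j - x k * g j) + x k • g = x := by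
    intro x; ext j; simp
  have e1 := tr (fun t w => t * f (w + t • g)) (by fun_prop) (by
    have : Integrable (fun p : ℝ × (Fin n → ℝ) => p.1) ((gaussianReal 0 1).prod ν) := by
      have : Integrable (fun x : ℝ => x) (gaussianReal 0 1) := by
        exact (memLp_id_gaussianReal (μ := 0) (v := 1) 1).integrable (by simp)
      exact this.comp_fst ν
    exact this.mul_bdd (c := B) (Continuous.aestronglyMeasurable (by fun_prop)) (ae_of_all _ fun p => hf.bound _))
  have hDc := hf.cont
  have e2 := tr (fun t w => ∑ l, D l (w + t • g) * g l) (by fun_prop) (by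
    refine integrable_finsetSum _ fun l _ => Integrable.mul_const ?_ _
    exact Integrable.of_bound (C := B) (Continuous.aestronglyMeasurable (by fun_prop)) (ae_of_all _ fun p => hf.dbound _ _))
  simp only [hline] at e1 e2
  have hDi : ∀ l, Integrable (D l) μ := fun l =>
    Integrable.of_bound (C := B) (hDc l).aestronglyMeasurable (ae_of_all _ fun p => hf.dbound _ _)
  have e3 : ∑ l, g l * ∫ x, D l x ∂μ = ∫ x, ∑ l, D l x * g l ∂μ := by
    rw [integral_finsetSum _ fun l _ => (hDi l).mul_const _]
    refine Finset.sum_congr rfl fun l _ => ?_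
    rw [integral_mul_const, mul_comm]
  rw [e1, e3, e2]
  congr 1; ext w
  refine stein_one (B := max B (∑ l, B * |g l|)) ?_ (by fun_prop) ?_ ?_
  · intro t
    have hl : HasDerivAt (fun t : ℝ => w + t • g) g t := by
      simpa using ((hasDerivAt_id t).smul_const g).const_add w
    have := (hf.deriv (w + t • g)).comp_hasDerivAt t hl
    exact this.congr_deriv (by simp <;> ring)
  · intro t; exact (hf.bound _).trans (le_max_left _ _)
  · intro t
    refine (Finset.abs_sum_le_sum_abs _ _).trans ((Finset.sum_le_sum fun l _ => ?_).trans (le_max_right _ _))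
    rw [abs_mul]; gcongr; exact hf.dbound _ _
end SGV


lemma GoodF.continuous {n : ℕ} {f : (Fin n → ℝ) → ℝ} {D : Fin n → (Fin n → ℝ) → ℝ} {B : ℝ}
    (hf : GoodF f D B) : Continuous f :=
  continuous_iff_continuousAt.2 fun x => (hf.deriv x).continuousAt

lemma GoodF.affine {n : ℕ} {f : (Fin n → ℝ) → ℝ} {D : Fin n → (Fin n → ℝ) → ℝ} {B : ℝ}
    (hf : GoodF f D B) (w : Fin n → ℝ) {c : ℝ} (hc : |c| ≤ 1) :
    GoodF (fun y => f (w + c • y)) (fun l y => c * D l (w + c • y)) B where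
  deriv x := by
    have hl : HasFDerivAt (fun y : Fin n → ℝ => w + c • y)
        (c • ContinuousLinearMap.id ℝ (Fin n → ℝ)) x := by
      exact ((hasFDerivAt_id (𝕜 := ℝ) x).const_smul c).const_add w
    have := (hf.deriv (w + c • x)).comp x hl
    refine this.congr_fderiv ?_
    ext v
    simp [Finset.mul_sum, mul_assoc, mul_left_comm]
  cont i := by have := hf.cont i; fun_prop
  bound x := hf.bound _
  dbound i x := by
    rw [abs_mul]
    calc |c| * |D i (w + c • x)| ≤ 1 * B := by
          gcongr
          exact hf.dbound _ _
      _ = B := one_mul _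

namespace SGV
variable {n : ℕ} {μ : Measure (Fin n → ℝ)}

lemma rot (h : SGV μ) (s : ℝ) {H : (Fin n → ℝ) × (Fin n → ℝ) → ℝ} (hH : Measurable H) :
    ∫ p, H (cos s • p.1 + sin s • p.2, -sin s • p.1 + cos s • p.2) ∂(μ.prod μ)
      = ∫ p, H p ∂(μ.prod μ) := by
  have := h.gauss
  have e := IsGaussian.map_rotation_eq_self_of_forall_strongDual_eq_zero h.mean s
  conv_rhs => rw [← e]
  rw [integral_map (by fun_prop) hH.aestronglyMeasurable]
  rfl

lemma rot' (h : SGV μ) (s : ℝ) {G : (Fin n → ℝ) × (Fin n → ℝ) → ℝ} (hG : Measurable G) :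
    ∫ p, G (p.1, cos s • p.1 + sin s • p.2) ∂(μ.prod μ)
      = ∫ p, G (cos s • p.1 + (-sin s) • p.2, p.1) ∂(μ.prod μ) := by
  rw [← h.rot s (H := fun p => G (cos s • p.1 + (-sin s) • p.2, p.1)) (by fun_prop)]
  congr 1; ext p; congr 2
  ext i
  have := cos_sq_add_sin_sq s
  simp
  linear_combination (-p.1 i) * this

variable {f : (Fin n → ℝ) → ℝ} {D : Fin n → (Fin n → ℝ) → ℝ} {B : ℝ}

lemma hasDerivAt_interp (h : SGV μ) (hf : GoodF f D B) (s : ℝ) :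
    HasDerivAt (fun s => ∫ p, f p.1 * f (cos s • p.1 + sin s • p.2) ∂(μ.prod μ))
      (-sin s * ∑ k, ∑ l, (∫ x, x k * x l ∂μ) *
        ∫ p, D l p.1 * D k (cos s • p.1 + sin s • p.2) ∂(μ.prod μ)) s := by
  have := h.gauss
  have hB : 0 ≤ B := (abs_nonneg _).trans (hf.bound 0)
  have hfc := hf.continuous
  have hDc := hf.cont
  have hie1 : ∀ k, Integrable (fun p : (Fin n → ℝ) × (Fin n → ℝ) => p.1 k) (μ.prod μ) :=
    fun k => (h.integrable_eval k).comp_fst μ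
  have hie2 : ∀ k, Integrable (fun p : (Fin n → ℝ) × (Fin n → ℝ) => p.2 k) (μ.prod μ) :=
    fun k => (h.integrable_eval k).comp_snd μ
  have key := hasDerivAt_integral_of_dominated_loc_of_deriv_le (μ := μ.prod μ) (x₀ := s)
    (s := Set.univ)
    (F := fun s p => f p.1 * f (cos s • p.1 + sin s • p.2))
    (F' := fun s p => f p.1 * ∑ k, D k (cos s • p.1 + sin s • p.2) * (-sin s * p.1 k + cos s * p.2 k))
    (bound := fun p => B * ∑ k, B * (|p.1 k| + |p.2 k|))
    Filter.univ_mem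
    (Filter.Eventually.of_forall fun s => (Continuous.aestronglyMeasurable (by fun_prop)))
    (Integrable.of_bound (C := B * B) (Continuous.aestronglyMeasurable (by fun_prop))
      (ae_of_all _ fun p => by
        rw [norm_mul]; exact mul_le_mul (hf.bound _) (hf.bound _) (norm_nonneg _) hB))
    (Continuous.aestronglyMeasurable (by fun_prop))
    (ae_of_all _ fun p s _ => by
      rw [norm_mul]
      refine mul_le_mul (hf.bound _) ?_ (norm_nonneg _) hB
      refine (norm_sum_le _ _).trans (Finset.sum_le_sum fun k _ => ?_)
      rw [norm_mul]
      refine mul_le_mul (hf.dbound _ _) ?_ (norm_nonneg _) hB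
      refine (norm_add_le _ _).trans ?_
      rw [norm_mul, norm_mul, norm_neg]
      simp only [Real.norm_eq_abs]
      refine add_le_add ?_ ?_
      · exact mul_le_of_le_one_left (abs_nonneg _) (abs_sin_le_one s)
      · exact mul_le_of_le_one_left (abs_nonneg _) (abs_cos_le_one s))
    (by
      refine Integrable.const_mul (integrable_finsetSum _ fun k _ => Integrable.const_mul ?_ _) _
      exact (hie1 k).abs.add (hie2 k).abs)
    (ae_of_all _ fun p s _ => by
      have hl : HasDerivAt (fun s : ℝ => cos s • p.1 + sin s • p.2) (-sin s • p.1 + cos s • p.2) s :=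
        ((hasDerivAt_cos s).smul_const p.1).add ((hasDerivAt_sin s).smul_const p.2)
      have := ((hf.deriv _).comp_hasDerivAt s hl).const_mul (f p.1)
      exact this.congr_deriv (by simp))
  refine key.2.congr_deriv ?_
  clear key
  have r1 := h.rot s (H := fun p => f (cos s • p.1 + (-sin s) • p.2) * ∑ k, D k p.1 * p.2 k)
    (Continuous.measurable (by fun_prop))
  have e0 : ∀ p : (Fin n → ℝ) × (Fin n → ℝ), cos s • (cos s • p.1 + sin s • p.2)
      + (-sin s) • (-sin s • p.1 + cos s • p.2) = p.1 := by
    intro p; ext i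
    have := cos_sq_add_sin_sq s
    simp
    linear_combination (p.1 i) * this
  simp only [e0] at r1
  have e1 : ∫ p, f p.1 * ∑ k, D k (cos s • p.1 + sin s • p.2) * (-sin s * p.1 k + cos s * p.2 k) ∂(μ.prod μ)
      = ∫ p, f (cos s • p.1 + (-sin s) • p.2) * ∑ k, D k p.1 * p.2 k ∂(μ.prod μ) := by
    rw [← r1]; rfl
  rw [e1]
  have hint : ∀ k, Integrable (fun p : (Fin n → ℝ) × (Fin n → ℝ) =>
      D k p.1 * (p.2 k * f (cos s • p.1 + (-sin s) • p.2))) (μ.prod μ) := by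
    intro k
    refine Integrable.bdd_mul (c := B) ?_ (Continuous.aestronglyMeasurable (by fun_prop))
      (ae_of_all _ fun p => hf.dbound _ _)
    exact (hie2 k).mul_bdd (c := B) (Continuous.aestronglyMeasurable (by fun_prop))
      (ae_of_all _ fun p => hf.bound _)
  have hintD : ∀ k l, Integrable (fun p : (Fin n → ℝ) × (Fin n → ℝ) =>
      D k p.1 * D l (cos s • p.1 + (-sin s) • p.2)) (μ.prod μ) := by
    intro k l
    refine Integrable.of_bound (C := B * B) (Continuous.aestronglyMeasurable (by fun_prop))
      (ae_of_all _ fun p => by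
        rw [norm_mul]; exact mul_le_mul (hf.dbound _ _) (hf.dbound _ _) (norm_nonneg _) hB)
  have e2 : ∀ p : (Fin n → ℝ) × (Fin n → ℝ), f (cos s • p.1 + (-sin s) • p.2) * ∑ k, D k p.1 * p.2 k
      = ∑ k, D k p.1 * (p.2 k * f (cos s • p.1 + (-sin s) • p.2)) := by
    intro p; rw [Finset.mul_sum]; exact Finset.sum_congr rfl fun k _ => by ring
  simp_rw [e2]
  rw [integral_finsetSum _ fun k _ => hint k, Finset.mul_sum]
  refine Finset.sum_congr rfl fun k _ => ?_
  rw [integral_prod _ (hint k)]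
  simp_rw [integral_const_mul]
  have st : ∀ x, ∫ y, y k * f (cos s • x + (-sin s) • y) ∂μ =
      ∑ l, (∫ x, x k * x l ∂μ) * ∫ y, -sin s * D l (cos s • x + (-sin s) • y) ∂μ := fun x =>
    h.stein k (hf.affine (cos s • x) (c := -sin s) (by rw [abs_neg]; exact abs_sin_le_one s))
  simp_rw [st, integral_const_mul, Finset.mul_sum]
  have hint2 : ∀ l, Integrable (fun x => D k x * ∫ y, D l (cos s • x + (-sin s) • y) ∂μ) μ := by
    intro l
    have := (hintD k l).integral_prod_left
    simpa only [integral_const_mul] using this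
  have e3 : ∀ l (x : Fin n → ℝ), D k x * ((∫ x, x k * x l ∂μ) * (-sin s * ∫ y, D l (cos s • x + (-sin s) • y) ∂μ))
      = (-sin s * ∫ x, x k * x l ∂μ) * (D k x * ∫ y, D l (cos s • x + (-sin s) • y) ∂μ) := by
    intro l x; ring
  simp_rw [e3]
  rw [integral_finsetSum _ fun l _ => (hint2 l).const_mul _]
  refine Finset.sum_congr rfl fun l _ => ?_
  rw [integral_const_mul, mul_assoc]
  congr 2
  have r2 := h.rot' s (G := fun p => D l p.1 * D k p.2) (Continuous.measurable (by fun_prop))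
  rw [r2]
  have e4 : ∀ p : (Fin n → ℝ) × (Fin n → ℝ), D l (cos s • p.1 + (-sin s) • p.2) * D k p.1
      = D k p.1 * D l (cos s • p.1 + (-sin s) • p.2) := fun p => mul_comm _ _
  simp_rw [e4]
  rw [integral_prod _ (hintD k l)]
  simp_rw [integral_const_mul]

end SGV


namespace SGV
variable {n : ℕ} {μ : Measure (Fin n → ℝ)}

lemma mgf_eval (h : SGV μ) (i : Fin n) (t : ℝ) : ∫ x, exp (t * x i) ∂μ = exp (t^2/2) := by
  have h1 := mgf_gaussianReal (p := μ) (X := fun x => x i) (h.map_eval i) t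
  simpa [mgf] using h1

lemma integrable_exp_eval (h : SGV μ) (i : Fin n) (t : ℝ) :
    Integrable (fun x : Fin n → ℝ => exp (t * x i)) μ := by
  have h1 := integrable_exp_mul_gaussianReal (μ := 0) (v := 1) t
  rw [← h.map_eval i] at h1
  exact (integrable_map_measure (f := fun x : Fin n → ℝ => x i) (g := fun y : ℝ => exp (t * y))
    (by fun_prop) (measurable_pi_apply i).aemeasurable).1 h1

lemma schur_aux (h : SGV μ) (k : Fin n) {g : (Fin n → ℝ) → ℝ} (hg : Measurable g) {C v : ℝ}
    (hC : ∀ x, |g x| ≤ C) (hv : 0 ≤ v) (hsupp : ∀ x, x k < v → g x = 0) {c σ : ℝ}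
    (hc0 : 0 ≤ c) (hc1 : c ≤ 1) (hσ : σ^2 = 1 - c^2) :
    Integrable (fun p => g p.1 ^ 2 * exp (v/2 * ((c • p.1 + σ • p.2) k - p.1 k))) (μ.prod μ) ∧
    ∫ p, g p.1 ^ 2 * exp (v/2 * ((c • p.1 + σ • p.2) k - p.1 k)) ∂(μ.prod μ)
      ≤ exp (-(1-c) * (v^2/4)) * ∫ x, g x ^ 2 ∂μ := by
  have := h.gauss
  have e : ∀ p : (Fin n → ℝ) × (Fin n → ℝ), g p.1 ^ 2 * exp (v/2 * ((c • p.1 + σ • p.2) k - p.1 k))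
      = (g p.1 ^ 2 * exp (-(v/2 * (1-c) * p.1 k))) * exp (v/2 * σ * p.2 k) := by
    intro p
    rw [mul_assoc, ← exp_add]; congr 2; simp; ring
  have hb : ∀ x, g x ^ 2 * exp (-(v/2 * (1-c) * x k)) ≤ exp (-(v/2 * (1-c) * v)) * g x ^ 2 := by
    intro x
    by_cases hx : x k < v
    · simp [hsupp x hx]
    · rw [mul_comm]; gcongr 2
      · have : 0 ≤ v/2 * (1-c) := by have := sub_nonneg.2 hc1; positivity
        nlinarith
  have hgi : Integrable (fun x => g x ^ 2) μ := by
    refine Integrable.of_bound (C := C^2) (by fun_prop) (ae_of_all _ fun x => ?_)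
    rw [norm_pow]; exact pow_le_pow_left₀ (norm_nonneg _) (hC x) 2
  have hgi2 : Integrable (fun x => g x ^ 2 * exp (-(v/2 * (1-c) * x k))) μ := by
    refine (hgi.const_mul (exp (-(v/2 * (1-c) * v)))).mono' (by fun_prop) (ae_of_all _ fun x => ?_)
    rw [norm_of_nonneg (by positivity)]; exact hb x
  simp_rw [e]
  refine ⟨hgi2.mul_prod (h.integrable_exp_eval k _), ?_⟩
  rw [integral_prod_mul (fun x => g x ^ 2 * exp (-(v/2 * (1-c) * x k))) (fun y : Fin n → ℝ => exp (v/2 * σ * y k)),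
    h.mgf_eval]
  have h1 : ∫ x, g x ^ 2 * exp (-(v/2 * (1-c) * x k)) ∂μ ≤ exp (-(v/2 * (1-c) * v)) * ∫ x, g x ^ 2 ∂μ := by
    rw [← integral_const_mul]
    exact integral_mono hgi2 (hgi.const_mul _) hb
  have h0 : 0 ≤ ∫ x, g x ^ 2 ∂μ := integral_nonneg fun x => sq_nonneg _
  calc _ ≤ (exp (-(v/2 * (1-c) * v)) * ∫ x, g x ^ 2 ∂μ) * exp ((v/2*σ)^2/2) := by gcongr
    _ = exp (-(v/2 * (1-c) * v) + (v/2*σ)^2/2) * ∫ x, g x ^ 2 ∂μ := by rw [exp_add]; ring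
    _ ≤ _ := by
      gcongr
      rw [mul_pow, hσ]
      nlinarith [mul_nonneg (sq_nonneg v) (sq_nonneg (1-c))]

lemma schur (h : SGV μ) (k : Fin n) {g : (Fin n → ℝ) → ℝ} (hg : Measurable g) {C v : ℝ}
    (hC : ∀ x, |g x| ≤ C) (hv : 0 ≤ v) (hsupp : ∀ x, x k < v → g x = 0) {s : ℝ}
    (hc0 : 0 ≤ cos s) :
    ∫ p, g p.1 * g (cos s • p.1 + sin s • p.2) ∂(μ.prod μ)
      ≤ exp (-(1-cos s) * (v^2/4)) * ∫ x, g x ^ 2 ∂μ := by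
  have := h.gauss
  have hC0 : 0 ≤ C := (abs_nonneg _).trans (hC 0)
  obtain ⟨i1, a1⟩ := h.schur_aux k hg hC hv hsupp hc0 (cos_le_one s) (σ := sin s) (by
    rw [sin_sq])
  obtain ⟨i2, a2⟩ := h.schur_aux k hg hC hv hsupp hc0 (cos_le_one s) (σ := -sin s) (by
    rw [neg_sq, sin_sq])
  have r := h.rot' s (G := fun p => g p.2 ^ 2 * exp (v/2 * (p.1 k - p.2 k))) (by fun_prop)
  simp only at r
  have i3 : Integrable (fun p : (Fin n → ℝ) × (Fin n → ℝ) => g (cos s • p.1 + sin s • p.2) ^ 2 *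
      exp (v/2 * (p.1 k - (cos s • p.1 + sin s • p.2) k))) (μ.prod μ) := by
    have e := IsGaussian.map_rotation_eq_self_of_forall_strongDual_eq_zero h.mean s
    rw [← e] at i2
    rw [integrable_map_measure (by fun_prop) (by fun_prop)] at i2
    refine i2.congr (ae_of_all _ fun p => ?_)
    have e0 : cos s • (cos s • p.1 + sin s • p.2)
        + (-sin s) • (-sin s • p.1 + cos s • p.2) = p.1 := by
      ext i
      have := cos_sq_add_sin_sq s
      simp
      linear_combination (p.1 i) * this
    show g (cos s • p.1 + sin s • p.2) ^ 2 * exp (v/2 * ((cos s • (cos s • p.1 + sin s • p.2)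
        + (-sin s) • (-sin s • p.1 + cos s • p.2)) k - (cos s • p.1 + sin s • p.2) k)) = _
    rw [e0]
  have hle : ∀ p : (Fin n → ℝ) × (Fin n → ℝ), g p.1 * g (cos s • p.1 + sin s • p.2) ≤
      (1/2) * (g p.1 ^ 2 * exp (v/2 * ((cos s • p.1 + sin s • p.2) k - p.1 k)) +
      g (cos s • p.1 + sin s • p.2) ^ 2 *
      exp (v/2 * (p.1 k - (cos s • p.1 + sin s • p.2) k))) := by
    intro p
    set y := cos s • p.1 + sin s • p.2
    have e1 : exp (v/2 * (y k - p.1 k)) = exp (v/4 * (y k - p.1 k)) ^ 2 := by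
      rw [← exp_nat_mul]; congr 1; push_cast; ring
    have e2 : exp (v/2 * (p.1 k - y k)) = exp (v/4 * (p.1 k - y k)) ^ 2 := by
      rw [← exp_nat_mul]; congr 1; push_cast; ring
    have e3 : exp (v/4 * (y k - p.1 k)) * exp (v/4 * (p.1 k - y k)) = 1 := by
      rw [← exp_add, ← exp_zero]; congr 1; ring
    rw [e1, e2]
    have := sq_nonneg (g p.1 * exp (v/4 * (y k - p.1 k)) - g y * exp (v/4 * (p.1 k - y k)))
    have e4 : g p.1 * g y = g p.1 * g y * (exp (v/4 * (y k - p.1 k)) * exp (v/4 * (p.1 k - y k))) := by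
      rw [e3, mul_one]
    rw [e4]
    linarith
  have i0 : Integrable (fun p : (Fin n → ℝ) × (Fin n → ℝ) => g p.1 * g (cos s • p.1 + sin s • p.2)) (μ.prod μ) := by
    refine Integrable.of_bound (C := C*C) (by fun_prop) (ae_of_all _ fun p => ?_)
    rw [norm_mul]; exact mul_le_mul (hC _) (hC _) (norm_nonneg _) hC0
  have := integral_mono i0 ((i1.add i3).const_mul (1/2)) hle
  refine this.trans ?_
  rw [integral_const_mul, integral_add' i1 i3, r]
  linarith
end SGV


/-- test function with logarithmic gradient `τ p` -/
structure TestF {n : ℕ} (f : (Fin n → ℝ) → ℝ) (p : Fin n → (Fin n → ℝ) → ℝ) (τ B : ℝ) : Prop where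
  good : GoodF f (fun i x => τ * (f x * p i x)) B
  pcont : ∀ i, Continuous (p i)
  fnn : ∀ x, 0 ≤ f x
  pnn : ∀ i x, 0 ≤ p i x
  psum : ∀ x, ∑ i, p i x ≤ 1

namespace SGV
variable {n : ℕ} {μ : Measure (Fin n → ℝ)}

lemma integral_rot (h : SGV μ) (s : ℝ) {g : (Fin n → ℝ) → ℝ} (hg : Measurable g) :
    ∫ p, g (cos s • p.1 + sin s • p.2) ∂(μ.prod μ) = ∫ x, g x ∂μ := by
  have := h.gauss
  have r := h.rot' s (G := fun p => g p.2) (by fun_prop)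
  simp only at r
  rw [r]
  have := integral_prod_mul (μ := μ) (ν := μ) g (fun _ => (1:ℝ))
  simpa using this

lemma corr_le_one (h : SGV μ) (k l : Fin n) : ∫ x, x k * x l ∂μ ≤ 1 := by
  have i1 := (h.memLp k).integrable_mul (h.memLp l)
  have i2 := (h.memLp k).integrable_sq
  have i3 := (h.memLp l).integrable_sq
  have : ∫ x, x k * x l ∂μ ≤ ∫ x, (1/2) * (x k ^ 2 + x l ^ 2) ∂μ := by
    refine integral_mono i1 ((i2.add i3).const_mul _) fun x => ?_
    simp only [Pi.add_apply, Pi.mul_apply]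
    nlinarith [sq_nonneg (x k - x l)]
  rw [integral_const_mul, integral_add i2 i3, h.var, h.var] at this
  linarith

variable {f : (Fin n → ℝ) → ℝ} {p : Fin n → (Fin n → ℝ) → ℝ} {τ B : ℝ}

lemma var_of_bound (h : SGV μ) (hf : TestF f p τ B) {k1 k2 w : ℝ} (hk1 : 0 ≤ k1) (hk2 : 0 ≤ k2)
    (hw : 0 < w)
    (hT : ∀ s, 0 ≤ cos s → ∑ k, ∑ l, (∫ x, x k * x l ∂μ) *
      ∫ z, (f z.1 * p l z.1) * (f (cos s • z.1 + sin s • z.2) * p k (cos s • z.1 + sin s • z.2)) ∂(μ.prod μ)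
      ≤ (k1 + k2 * exp (-(1 - cos s) * w)) * ∫ x, f x ^ 2 ∂μ) :
    ∫ x, f x ^ 2 ∂μ - (∫ x, f x ∂μ)^2 ≤ τ^2 * (k1 + k2 / w) * ∫ x, f x ^ 2 ∂μ := by
  have := h.gauss
  set A := ∫ x, f x ^ 2 ∂μ with hA
  have hA0 : 0 ≤ A := integral_nonneg fun x => sq_nonneg _
  let ψ : ℝ → ℝ := fun s => ∫ z, f z.1 * f (cos s • z.1 + sin s • z.2) ∂(μ.prod μ)
  let b : ℝ → ℝ := fun s => τ^2 * A * (k1 * cos s + k2 / w * exp (-(1 - cos s) * w))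
  have hψ := fun s => h.hasDerivAt_interp hf.good s
  have hb : ∀ s, HasDerivAt b (-sin s * (τ^2 * A * (k1 + k2 * exp (-(1 - cos s) * w)))) s := by
    intro s
    have h1 : HasDerivAt (fun s => -(1 - cos s) * w) (-sin s * w) s := by
      have := (((hasDerivAt_cos s).const_sub 1).neg.mul_const w)
      exact this.congr_deriv (by ring)
    have := (((hasDerivAt_cos s).const_mul k1).add (h1.exp.const_mul (k2/w))).const_mul (τ^2 * A)
    refine this.congr_deriv ?_
    field_simp
    ring
  have hmono : MonotoneOn (fun s => ψ s - b s) (Set.Icc 0 (π/2)) := by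
    refine monotoneOn_of_deriv_nonneg (convex_Icc _ _)
      (fun s _ => ((hψ s).sub (hb s)).continuousAt.continuousWithinAt)
      (fun s _ => ((hψ s).sub (hb s)).differentiableAt.differentiableWithinAt) fun s hs => ?_
    rw [interior_Icc] at hs
    have hd := ((hψ s).sub (hb s)).deriv
    have hd' : deriv (fun s => ψ s - b s) s = _ := hd
    rw [hd']
    have hsin : 0 ≤ sin s := sin_nonneg_of_nonneg_of_le_pi hs.1.le (by linarith [hs.2, pi_pos])
    have hcos : 0 ≤ cos s := cos_nonneg_of_mem_Icc ⟨by linarith [hs.1, pi_pos], hs.2.le⟩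
    have hT' := mul_le_mul_of_nonneg_left (hT s hcos) (sq_nonneg τ)
    have e : ∑ k, ∑ l, (∫ x, x k * x l ∂μ) * ∫ z, (τ * (f z.1 * p l z.1)) *
        (τ * (f (cos s • z.1 + sin s • z.2) * p k (cos s • z.1 + sin s • z.2))) ∂(μ.prod μ)
        = τ^2 * ∑ k, ∑ l, (∫ x, x k * x l ∂μ) *
      ∫ z, (f z.1 * p l z.1) * (f (cos s • z.1 + sin s • z.2) * p k (cos s • z.1 + sin s • z.2)) ∂(μ.prod μ) := by
      rw [Finset.mul_sum]
      refine Finset.sum_congr rfl fun k _ => ?_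
      rw [Finset.mul_sum]
      refine Finset.sum_congr rfl fun l _ => ?_
      rw [← mul_assoc, mul_comm (τ^2), mul_assoc]
      congr 1
      rw [← integral_const_mul]
      refine integral_congr_ae (ae_of_all _ fun z => ?_)
      simp only
      ring
    rw [e]
    have := mul_le_mul_of_nonneg_left hT' hsin
    nlinarith
  have hpi : (0:ℝ) ≤ π/2 := by positivity
  have key := hmono (Set.left_mem_Icc.2 hpi) (Set.right_mem_Icc.2 hpi) hpi
  have e0 : ψ 0 = A := by
    simp only [ψ, cos_zero, sin_zero, one_smul, zero_smul, add_zero]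
    have := integral_prod_mul (μ := μ) (ν := μ) (fun x => f x ^ 2) (fun _ => (1:ℝ))
    simp only [mul_one, integral_const, probReal_univ, smul_eq_mul] at this
    rw [hA, ← this]
    congr 1; ext z; ring
  have e1 : ψ (π/2) = (∫ x, f x ∂μ)^2 := by
    simp only [ψ, cos_pi_div_two, sin_pi_div_two, one_smul, zero_smul, zero_add]
    rw [integral_prod_mul, sq]
  simp only [e0, e1] at key
  have hb0 : b 0 = τ^2 * (k1 + k2/w) * A := by simp [b]; ring
  have hb1 : 0 ≤ b (π/2) := by simp only [b, cos_pi_div_two]; positivity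
  linarith

lemma pp_integrable (h : SGV μ) (hf : TestF f p τ B) (s : ℝ) (k l : Fin n) :
    Integrable (fun z : (Fin n → ℝ) × (Fin n → ℝ) => (f z.1 * p l z.1) *
      (f (cos s • z.1 + sin s • z.2) * p k (cos s • z.1 + sin s • z.2))) (μ.prod μ) := by
  have := h.gauss
  have h1 := hf.good.continuous
  have h2 := hf.pcont
  have hB : 0 ≤ B := (abs_nonneg _).trans (hf.good.bound 0)
  have hp1 : ∀ i x, p i x ≤ 1 := fun i x =>
    (Finset.single_le_sum (fun j _ => hf.pnn j x) (Finset.mem_univ i)).trans (hf.psum x)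
  have hb : ∀ i x, ‖f x * p i x‖ ≤ B := by
    intro i x
    rw [norm_mul, norm_of_nonneg (hf.pnn i x)]
    exact (mul_le_of_le_one_right (norm_nonneg _) (hp1 i x)).trans (hf.good.bound x)
  refine Integrable.of_bound (C := B * B) (Continuous.aestronglyMeasurable (by fun_prop))
    (ae_of_all _ fun z => ?_)
  rw [norm_mul]; exact mul_le_mul (hb _ _) (hb _ _) (norm_nonneg _) hB

lemma ff_integrable (h : SGV μ) (hf : TestF f p τ B) (s : ℝ) :
    Integrable (fun z : (Fin n → ℝ) × (Fin n → ℝ) => f z.1 *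
      f (cos s • z.1 + sin s • z.2)) (μ.prod μ) := by
  have := h.gauss
  have h1 := hf.good.continuous
  have hB : 0 ≤ B := (abs_nonneg _).trans (hf.good.bound 0)
  refine Integrable.of_bound (C := B * B) (Continuous.aestronglyMeasurable (by fun_prop))
    (ae_of_all _ fun z => ?_)
  rw [norm_mul]; exact mul_le_mul (hf.good.bound _) (hf.good.bound _) (norm_nonneg _) hB

lemma ff_le (h : SGV μ) (hf : TestF f p τ B) (s : ℝ) :
    ∫ z, f z.1 * f (cos s • z.1 + sin s • z.2) ∂(μ.prod μ) ≤ ∫ x, f x ^ 2 ∂μ := by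
  have := h.gauss
  have h1 := hf.good.continuous
  have hB : 0 ≤ B := (abs_nonneg _).trans (hf.good.bound 0)
  have i1 : Integrable (fun z : (Fin n → ℝ) × (Fin n → ℝ) => f z.1 ^ 2) (μ.prod μ) := by
    refine Integrable.of_bound (C := B ^ 2) (Continuous.aestronglyMeasurable (by fun_prop))
      (ae_of_all _ fun z => ?_)
    rw [norm_pow]; exact pow_le_pow_left₀ (norm_nonneg _) (hf.good.bound _) 2
  have i2 : Integrable (fun z : (Fin n → ℝ) × (Fin n → ℝ) => f (cos s • z.1 + sin s • z.2) ^ 2) (μ.prod μ) := by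
    refine Integrable.of_bound (C := B ^ 2) (Continuous.aestronglyMeasurable (by fun_prop))
      (ae_of_all _ fun z => ?_)
    rw [norm_pow]; exact pow_le_pow_left₀ (norm_nonneg _) (hf.good.bound _) 2
  have : ∫ z, f z.1 * f (cos s • z.1 + sin s • z.2) ∂(μ.prod μ)
      ≤ ∫ z, (1/2) * (f z.1 ^ 2 + f (cos s • z.1 + sin s • z.2) ^ 2) ∂(μ.prod μ) := by
    refine integral_mono (h.ff_integrable hf s) ((i1.add i2).const_mul _) fun z => ?_
    show _ ≤ (1/2) * (f z.1 ^ 2 + f (cos s • z.1 + sin s • z.2) ^ 2)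
    nlinarith [sq_nonneg (f z.1 - f (cos s • z.1 + sin s • z.2))]
  have e0 : ∫ z, f z.1 ^ 2 ∂(μ.prod μ) = ∫ x, f x ^ 2 ∂μ := by
    have := integral_prod_mul (μ := μ) (ν := μ) (fun x => f x ^ 2) (fun _ => (1:ℝ))
    simpa only [mul_one, integral_const, probReal_univ, smul_eq_mul] using this
  rw [integral_const_mul, integral_add i1 i2, e0,
    h.integral_rot s (g := fun x => f x ^ 2) (by fun_prop)] at this
  linarith

lemma sum_pp_le (h : SGV μ) (hf : TestF f p τ B) (s : ℝ) :
    ∑ k, ∑ l, ∫ z, (f z.1 * p l z.1) * (f (cos s • z.1 + sin s • z.2) * p k (cos s • z.1 + sin s • z.2)) ∂(μ.prod μ)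
      ≤ ∫ x, f x ^ 2 ∂μ := by
  refine le_trans ?_ (h.ff_le hf s)
  rw [show (∑ k, ∑ l, ∫ z, (f z.1 * p l z.1) * (f (cos s • z.1 + sin s • z.2) * p k (cos s • z.1 + sin s • z.2)) ∂(μ.prod μ))
    = ∫ z, ∑ k, ∑ l, (f z.1 * p l z.1) * (f (cos s • z.1 + sin s • z.2) * p k (cos s • z.1 + sin s • z.2)) ∂(μ.prod μ) by
    rw [integral_finsetSum _ fun k _ => integrable_finsetSum _ fun l _ => h.pp_integrable hf s k l]
    exact Finset.sum_congr rfl fun k _ => (integral_finsetSum _ fun l _ => h.pp_integrable hf s k l).symm]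
  refine integral_mono (integrable_finsetSum _ fun k _ => integrable_finsetSum _ fun l _ => h.pp_integrable hf s k l)
    (h.ff_integrable hf s) fun z => ?_
  simp only
  generalize cos s • z.1 + sin s • z.2 = y
  have : ∑ k, ∑ l, (f z.1 * p l z.1) * (f y * p k y) = (f z.1 * f y) * ((∑ l, p l z.1) * ∑ k, p k y) := by
    rw [Finset.sum_mul_sum, Finset.mul_sum, Finset.sum_comm]
    refine Finset.sum_congr rfl fun k _ => ?_
    rw [Finset.mul_sum]
    exact Finset.sum_congr rfl fun l _ => by ring
  rw [this]
  refine mul_le_of_le_one_right (mul_nonneg (hf.fnn _) (hf.fnn _)) ?_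
  exact mul_le_one₀ (hf.psum _) (Finset.sum_nonneg fun i _ => hf.pnn i _) (hf.psum _)

lemma pp_nonneg (hf : TestF f p τ B) (s : ℝ) (k l : Fin n) :
    0 ≤ ∫ z, (f z.1 * p l z.1) * (f (cos s • z.1 + sin s • z.2) * p k (cos s • z.1 + sin s • z.2)) ∂(μ.prod μ) :=
  integral_nonneg fun _ => mul_nonneg (mul_nonneg (hf.fnn _) (hf.pnn _ _)) (mul_nonneg (hf.fnn _) (hf.pnn _ _))

lemma var_one (h : SGV μ) (hf : TestF f p τ B) :
    ∫ x, f x ^ 2 ∂μ - (∫ x, f x ∂μ)^2 ≤ τ^2 * 1 * ∫ x, f x ^ 2 ∂μ := by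
  have := h.var_of_bound hf (k1 := 1) (k2 := 0) (w := 1) (by norm_num) (by norm_num) (by norm_num)
    (fun s _ => by
      refine le_trans ?_ (le_trans (h.sum_pp_le hf s) (by simp))
      refine Finset.sum_le_sum fun k _ => Finset.sum_le_sum fun l _ => ?_
      exact mul_le_of_le_one_left (pp_nonneg hf s k l) (h.corr_le_one k l))
  simpa using this

lemma diag_le (h : SGV μ) (hf : TestF f p τ B) {v η : ℝ} (hv : 0 < v) (hη : 0 ≤ η)
    (hp : ∀ i x, x i < v → p i x ≤ η) {s : ℝ} (hs : 0 ≤ cos s) :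
    ∑ k, ∫ z, (f z.1 * p k z.1) * (f (cos s • z.1 + sin s • z.2) * p k (cos s • z.1 + sin s • z.2)) ∂(μ.prod μ)
      ≤ (n * η + exp (-(1 - cos s) * (v^2/4))) * ∫ x, f x ^ 2 ∂μ := by
  have := h.gauss
  have h1 := hf.good.continuous
  have h2 := hf.pcont
  have hB : 0 ≤ B := (abs_nonneg _).trans (hf.good.bound 0)
  have hp1 : ∀ i x, p i x ≤ 1 := fun i x =>
    (Finset.single_le_sum (fun j _ => hf.pnn j x) (Finset.mem_univ i)).trans (hf.psum x)
  let g : Fin n → (Fin n → ℝ) → ℝ := fun k => Set.indicator {x | v ≤ x k} (fun x => f x * p k x)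
  have hset : ∀ k : Fin n, MeasurableSet {x : Fin n → ℝ | v ≤ x k} := fun k =>
    measurableSet_le measurable_const (measurable_pi_apply k)
  have hgm : ∀ k, Measurable (g k) := fun k =>
    Measurable.indicator (Continuous.measurable (by fun_prop)) (hset k)
  have hgb : ∀ k x, |g k x| ≤ B := by
    intro k x
    simp only [g, Set.indicator]
    split_ifs
    · rw [abs_mul, abs_of_nonneg (hf.pnn k x)]
      exact (mul_le_of_le_one_right (abs_nonneg _) (hp1 k x)).trans (hf.good.bound x)
    · simpa using hB
  have hgi : ∀ k, Integrable (fun x => g k x ^ 2) μ := by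
    intro k
    refine Integrable.of_bound (C := B^2) ((hgm k).pow_const 2).aestronglyMeasurable (ae_of_all _ fun x => ?_)
    rw [norm_pow]; exact pow_le_pow_left₀ (norm_nonneg _) (hgb k x) 2
  have hggi : ∀ k, Integrable (fun z : (Fin n → ℝ) × (Fin n → ℝ) => g k z.1 * g k (cos s • z.1 + sin s • z.2)) (μ.prod μ) := by
    intro k
    have := hgm k
    refine Integrable.of_bound (C := B*B) (Measurable.aestronglyMeasurable (by fun_prop)) (ae_of_all _ fun z => ?_)
    rw [norm_mul]; exact mul_le_mul (hgb _ _) (hgb _ _) (norm_nonneg _) hB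
  have hfi : Integrable (fun x => f x ^ 2) μ := by
    refine Integrable.of_bound (C := B^2) (Continuous.aestronglyMeasurable (by fun_prop)) (ae_of_all _ fun x => ?_)
    rw [norm_pow]; exact pow_le_pow_left₀ (norm_nonneg _) (hf.good.bound x) 2
  have step : ∀ k, ∫ z, (f z.1 * p k z.1) * (f (cos s • z.1 + sin s • z.2) * p k (cos s • z.1 + sin s • z.2)) ∂(μ.prod μ)
      ≤ η * (∫ x, f x ^ 2 ∂μ) + exp (-(1 - cos s) * (v^2/4)) * ∫ x, g k x ^ 2 ∂μ := by
    intro k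
    have s1 := h.schur k (hgm k) (hgb k) hv.le (fun x hx => by simp [g, Set.indicator, not_le.2 hx]) hs
    have s2 := mul_le_mul_of_nonneg_left (h.ff_le hf s) hη
    rw [← integral_const_mul] at s2
    have s3 : ∫ z, (f z.1 * p k z.1) * (f (cos s • z.1 + sin s • z.2) * p k (cos s • z.1 + sin s • z.2)) ∂(μ.prod μ)
      ≤ ∫ z, η * (f z.1 * f (cos s • z.1 + sin s • z.2)) + g k z.1 * g k (cos s • z.1 + sin s • z.2) ∂(μ.prod μ) := by
      refine integral_mono (h.pp_integrable hf s k k) (((h.ff_integrable hf s).const_mul η).add (hggi k)) fun z => ?_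
      simp only
      generalize cos s • z.1 + sin s • z.2 = y
      have e : (f z.1 * p k z.1) * (f y * p k y) = (p k z.1 * p k y) * (f z.1 * f y) := by ring
      have hff : 0 ≤ f z.1 * f y := mul_nonneg (hf.fnn _) (hf.fnn _)
      have hgn : ∀ x, 0 ≤ g k x := fun x => Set.indicator_nonneg (fun x _ => mul_nonneg (hf.fnn _) (hf.pnn _ _)) x
      by_cases hx : z.1 k < v
      · have : p k z.1 * p k y ≤ η := (mul_le_of_le_one_right (hf.pnn _ _) (hp1 _ _)).trans (hp _ _ hx)
        rw [e]
        have := mul_le_mul_of_nonneg_right this hff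
        have := mul_nonneg (hgn z.1) (hgn y)
        linarith
      by_cases hy : y k < v
      · have : p k z.1 * p k y ≤ η := (mul_le_of_le_one_left (hf.pnn _ _) (hp1 _ _)).trans (hp _ _ hy)
        rw [e]
        have := mul_le_mul_of_nonneg_right this hff
        have := mul_nonneg (hgn z.1) (hgn y)
        linarith
      · have e1 : g k z.1 = f z.1 * p k z.1 := by simp [g, not_lt.1 hx]
        have e2 : g k y = f y * p k y := by simp [g, not_lt.1 hy]
        rw [e1, e2]
        have := mul_nonneg hη hff
        linarith
    rw [integral_add ((h.ff_integrable hf s).const_mul η) (hggi k)] at s3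
    linarith
  refine (Finset.sum_le_sum fun k _ => step k).trans ?_
  rw [Finset.sum_add_distrib, ← Finset.mul_sum, ← Finset.mul_sum, ← integral_finsetSum _ fun k _ => hgi k]
  have : ∫ x, ∑ k, g k x ^ 2 ∂μ ≤ ∫ x, f x ^ 2 ∂μ := by
    refine integral_mono (integrable_finsetSum _ fun k _ => hgi k) hfi fun x => ?_
    simp only
    calc ∑ k, g k x ^ 2 ≤ ∑ k, f x ^ 2 * p k x := by
          refine Finset.sum_le_sum fun k _ => ?_
          simp only [g, Set.indicator]
          split_ifs
          · rw [mul_pow]; gcongr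
            have := hf.pnn k x; have := hp1 k x
            nlinarith
          · have := hf.pnn k x; simp; positivity
      _ = f x ^ 2 * ∑ k, p k x := by rw [Finset.mul_sum]
      _ ≤ f x ^ 2 := mul_le_of_le_one_right (sq_nonneg _) (hf.psum x)
  have := mul_le_mul_of_nonneg_left this (exp_pos (-(1 - cos s) * (v^2/4))).le
  simp only [Finset.sum_const, Finset.card_univ, Fintype.card_fin, nsmul_eq_mul]
  linarith

lemma var_two (h : SGV μ) (hf : TestF f p τ B) {v η ε : ℝ} (hv : 0 < v) (hη : 0 ≤ η) (hε : 0 ≤ ε)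
    (hp : ∀ i x, x i < v → p i x ≤ η) (hc : ∀ i j, i ≠ j → ∫ x, x i * x j ∂μ ≤ ε) :
    ∫ x, f x ^ 2 ∂μ - (∫ x, f x ∂μ)^2 ≤ τ^2 * (ε + n * η + 4/v^2) * ∫ x, f x ^ 2 ∂μ := by
  have := h.var_of_bound hf (k1 := ε + n * η) (k2 := 1) (w := v^2/4) (by positivity) (by norm_num) (by positivity)
    (fun s hs => by
      have d1 := h.diag_le hf hv hη hp hs
      have d2 := mul_le_mul_of_nonneg_left (h.sum_pp_le hf s) hε
      rw [Finset.mul_sum] at d2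
      simp_rw [Finset.mul_sum] at d2
      have : ∀ k l, (∫ x, x k * x l ∂μ) *
        (∫ z, (f z.1 * p l z.1) * (f (cos s • z.1 + sin s • z.2) * p k (cos s • z.1 + sin s • z.2)) ∂(μ.prod μ))
         ≤ ε * (∫ z, (f z.1 * p l z.1) * (f (cos s • z.1 + sin s • z.2) * p k (cos s • z.1 + sin s • z.2)) ∂(μ.prod μ)) +
          if k = l then (∫ z, (f z.1 * p k z.1) * (f (cos s • z.1 + sin s • z.2) * p k (cos s • z.1 + sin s • z.2)) ∂(μ.prod μ)) else 0 := by
        intro k l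
        have := pp_nonneg (μ := μ) hf s k l
        split_ifs with hkl
        · subst hkl
          have h3 := mul_le_mul_of_nonneg_right (h.corr_le_one k k) this
          have := mul_nonneg hε this
          linarith
        · rw [add_zero]; exact mul_le_mul_of_nonneg_right (hc k l hkl) this
      refine (Finset.sum_le_sum fun k _ => Finset.sum_le_sum fun l _ => this k l).trans ?_
      simp only [Finset.sum_add_distrib, Finset.sum_ite_eq, Finset.mem_univ, if_true]
      linarith)
  refine this.trans (le_of_eq ?_)
  rw [one_div_div]
end SGV


/-- regularized partition function -/
noncomputable def softS {n : ℕ} (β a : ℝ) (x : Fin n → ℝ) : ℝ := a + ∑ i, exp (β * x i)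
/-- regularized soft maximum -/
noncomputable def softF {n : ℕ} (β a b : ℝ) (x : Fin n → ℝ) : ℝ :=
  β⁻¹ * log (softS β a x / (1 + b * softS β a x))
/-- gradient of the regularized soft maximum -/
noncomputable def softp {n : ℕ} (β a b : ℝ) (i : Fin n) (x : Fin n → ℝ) : ℝ :=
  exp (β * x i) / (softS β a x * (1 + b * softS β a x))

section soft
variable {n : ℕ} {β a b : ℝ}

lemma softS_ge (x : Fin n → ℝ) : a ≤ softS β a x :=
  le_add_of_nonneg_right (Finset.sum_nonneg fun i _ => (exp_pos _).le)

lemma softS_pos (ha : 0 < a) (x : Fin n → ℝ) : 0 < softS β a x := ha.trans_le (softS_ge x)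

lemma softS_cont : Continuous (softS (n := n) β a) := by unfold softS; fun_prop

lemma softF_bdd (hβ : 0 < β) (ha : 0 < a) (hb : 0 < b) :
    ∃ C, 0 ≤ C ∧ ∀ x : Fin n → ℝ, |softF β a b x| ≤ C := by
  refine ⟨β⁻¹ * max (-log (a / (1 + b * a))) (log (1/b)) ⊔ 0, le_max_right _ _, fun x => ?_⟩
  refine le_max_of_le_left ?_
  have hS := softS_pos (β := β) ha x
  have hS1 := softS_ge (β := β) (a := a) x
  unfold softF
  rw [abs_mul, abs_of_pos (inv_pos.2 hβ)]
  gcongr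
  rw [abs_le']
  constructor
  · refine le_max_of_le_right (log_le_log (by positivity) ?_)
    rw [div_le_div_iff₀ (by positivity) hb]; nlinarith
  · refine le_max_of_le_left (neg_le_neg (log_le_log (by positivity) ?_))
    rw [div_le_div_iff₀ (by positivity) (by positivity)]; nlinarith

lemma softF_cont (ha : 0 < a) (hb : 0 < b) : Continuous (softF (n := n) β a b) := by
  unfold softF
  have := softS_cont (n := n) (β := β) (a := a)
  refine continuous_const.mul (Continuous.log (Continuous.div this (by fun_prop) fun x => ?_) fun x => ?_)
  all_goals
    have := softS_pos (β := β) ha x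
    positivity

lemma softp_cont (ha : 0 < a) (hb : 0 < b) (i : Fin n) : Continuous (softp (n := n) β a b i) := by
  unfold softp
  have := softS_cont (n := n) (β := β) (a := a)
  refine Continuous.div (by fun_prop) (by fun_prop) fun x => ?_
  have := softS_pos (β := β) ha x
  positivity

lemma softF_deriv (hβ : 0 < β) (ha : 0 < a) (hb : 0 < b) (x : Fin n → ℝ) :
    HasFDerivAt (softF β a b)
      (∑ i, softp β a b i x • (ContinuousLinearMap.proj i : (Fin n → ℝ) →L[ℝ] ℝ)) x := by
  have hS := softS_pos (β := β) ha x
  have h1 : HasFDerivAt (softS β a)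
      (∑ i, (exp (β * x i) * β) • (ContinuousLinearMap.proj i : (Fin n → ℝ) →L[ℝ] ℝ)) x := by
    unfold softS
    refine HasFDerivAt.const_add _ ?_
    refine HasFDerivAt.fun_sum fun i _ => ?_
    have : HasFDerivAt (fun x : Fin n → ℝ => β * x i)
      (β • (ContinuousLinearMap.proj i : (Fin n → ℝ) →L[ℝ] ℝ)) x :=
      (ContinuousLinearMap.proj (R := ℝ) (φ := fun _ : Fin n => ℝ) i).hasFDerivAt.const_mul β
    refine this.exp.congr_fderiv ?_
    rw [smul_smul]
  have h2 : HasDerivAt (fun S => β⁻¹ * log (S / (1 + b * S)))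
      (β⁻¹ * (1 / (softS β a x * (1 + b * softS β a x)))) (softS β a x) := by
    generalize softS β a x = S at hS
    have h3 : HasDerivAt (fun S => 1 + b * S) b S := by
      simpa using ((hasDerivAt_id S).const_mul b).const_add 1
    have h4 := (((hasDerivAt_id S).div h3 (by positivity)).log (by
      simp only [Pi.div_apply, id]; positivity)).const_mul β⁻¹
    refine h4.congr_deriv ?_
    simp only [Pi.div_apply, id]
    field_simp
    ring
  have := h2.comp_hasFDerivAt x h1
  refine this.congr_fderiv ?_
  ext v
  simp only [softp, Finset.smul_sum, smul_smul]
  simp only [ContinuousLinearMap.sum_apply, ContinuousLinearMap.smul_apply]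
  refine Finset.sum_congr rfl fun i _ => ?_
  congr 1
  field_simp

lemma softp_nonneg (ha : 0 < a) (hb : 0 < b) (i : Fin n) (x : Fin n → ℝ) : 0 ≤ softp β a b i x := by
  have hS := softS_pos (β := β) ha x
  unfold softp; positivity

lemma softp_sum (ha : 0 < a) (hb : 0 < b) (x : Fin n → ℝ) : ∑ i, softp β a b i x ≤ 1 := by
  have hS := softS_pos (β := β) ha x
  unfold softp
  rw [← Finset.sum_div, div_le_one (by positivity)]
  have : ∑ i, exp (β * x i) ≤ softS β a x := by unfold softS; linarith
  have : 0 ≤ softS β a x * (b * softS β a x) := by positivity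
  linarith

lemma softp_le (ha : 0 < a) (hb : 0 < b) (i : Fin n) (x : Fin n → ℝ) :
    softp β a b i x ≤ exp (β * x i) / a := by
  have hS := softS_pos (β := β) ha x
  unfold softp
  gcongr
  have : 0 ≤ softS β a x * (b * softS β a x) := by positivity
  have := softS_ge (β := β) (a := a) x
  linarith

lemma soft_testF (hβ : 0 < β) (ha : 0 < a) (hb : 0 < b) (τ : ℝ) :
    ∃ B, TestF (n := n) (fun x => exp (τ * softF β a b x)) (softp β a b) τ B := by
  obtain ⟨C, hC0, hC⟩ := softF_bdd (n := n) hβ ha hb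
  have hfb : ∀ x : Fin n → ℝ, exp (τ * softF β a b x) ≤ exp (|τ| * C) := by
    intro x
    refine exp_le_exp.2 ?_
    calc τ * softF β a b x ≤ |τ * softF β a b x| := le_abs_self _
      _ = |τ| * |softF β a b x| := abs_mul _ _
      _ ≤ _ := by gcongr; exact hC x
  refine ⟨(1 + |τ|) * exp (|τ| * C), ⟨⟨fun x => ?_, fun i => ?_, fun x => ?_, fun i x => ?_⟩,
    softp_cont ha hb, fun x => (exp_pos _).le, softp_nonneg ha hb, softp_sum ha hb⟩⟩
  · have := ((softF_deriv hβ ha hb x).const_mul τ).exp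
    refine this.congr_fderiv ?_
    rw [Finset.smul_sum, Finset.smul_sum]
    refine Finset.sum_congr rfl fun i _ => ?_
    rw [smul_smul, smul_smul]; congr 1; ring
  · have := softF_cont (n := n) (β := β) ha hb
    have := softp_cont (n := n) (β := β) ha hb i
    fun_prop
  · rw [abs_of_pos (exp_pos _)]
    exact (hfb x).trans (le_mul_of_one_le_left (exp_pos _).le (by linarith [abs_nonneg τ]))
  · have hp0 := softp_nonneg (β := β) ha hb i x
    have hp1 : softp β a b i x ≤ 1 :=
      (Finset.single_le_sum (fun j _ => softp_nonneg ha hb j x) (Finset.mem_univ i)).trans (softp_sum ha hb x)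
    rw [abs_mul, abs_mul, abs_of_pos (exp_pos _), abs_of_nonneg hp0]
    have : exp (τ * softF β a b x) * softp β a b i x ≤ exp (|τ| * C) * 1 := by
      exact mul_le_mul (hfb x) hp1 hp0 (exp_pos _).le
    have h3 := mul_le_mul_of_nonneg_left this (abs_nonneg τ)
    have := exp_pos (|τ| * C)
    linarith
end soft

lemma iterate_bound {φ : ℝ → ℝ} {κ A : ℝ} (hκ : 0 ≤ κ) (hA : 0 ≤ A) (h0 : ∀ t, 0 ≤ φ t)
    (hstep : ∀ θ, φ θ * (1 - κ * θ^2/4) ≤ φ (θ/2)^2)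
    (hsmall : ∀ t, |t| * A ≤ 1 → φ t ≤ 1 + A^2 * t^2) {θ : ℝ} (hθ : κ * θ^2 ≤ 1) :
    φ θ ≤ exp (κ * θ^2) := by
  let L : ℝ → ℝ := fun t => φ t * exp (-(κ * t^2))
  have hL0 : ∀ t, 0 ≤ L t := fun t => mul_nonneg (h0 t) (exp_pos _).le
  have hLs : ∀ t, κ * t^2 ≤ 1 → L t ≤ L (t/2)^2 := by
    intro t ht
    have hq : 0 ≤ κ * t^2 := by positivity
    have h1 : 1 ≤ exp (κ*t^2/2) * (1 - κ * t^2/4) := by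
      have := add_one_le_exp (κ*t^2/2)
      nlinarith
    have h2 : φ t ≤ exp (κ*t^2/2) * φ (t/2)^2 := by
      calc φ t ≤ φ t * (exp (κ*t^2/2) * (1 - κ * t^2/4)) := le_mul_of_one_le_right (h0 t) h1
        _ = exp (κ*t^2/2) * (φ t * (1 - κ * t^2/4)) := by ring
        _ ≤ _ := by gcongr; exact hstep t
    calc L t ≤ (exp (κ*t^2/2) * φ (t/2)^2) * exp (-(κ * t^2)) := by
          exact mul_le_mul_of_nonneg_right h2 (exp_pos _).le
      _ = L (t/2)^2 := by
          simp only [L]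
          rw [mul_pow, ← exp_nat_mul, mul_comm (exp _), mul_assoc, ← exp_add]
          congr 2; push_cast; ring
  have hLk : ∀ k : ℕ, L θ ≤ L (θ/2^k)^(2^k) := by
    intro k
    induction k with
    | zero => simp
    | succ k ih =>
      refine ih.trans ?_
      have : κ * (θ/2^k)^2 ≤ 1 := by
        refine le_trans ?_ hθ
        gcongr 1
        rw [div_pow]
        exact div_le_self (sq_nonneg _) (one_le_pow₀ (one_le_pow₀ (by norm_num)))
      calc L (θ/2^k)^(2^k) ≤ (L (θ/2^k/2)^2)^(2^k) := pow_le_pow_left₀ (hL0 _) (hLs _ this) _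
        _ = _ := by rw [← pow_mul, div_div, ← pow_succ, mul_comm 2, ← pow_succ]
  have hev : ∀ᶠ k : ℕ in Filter.atTop, L θ ≤ exp (A^2*θ^2 * (1/2)^k) := by
    have ht : Filter.Tendsto (fun k : ℕ => |θ| * A * (1/2:ℝ)^k) Filter.atTop (nhds (|θ| * A * 0)) :=
      (tendsto_pow_atTop_nhds_zero_of_lt_one (by norm_num) (by norm_num)).const_mul _
    rw [mul_zero] at ht
    filter_upwards [ht.eventually (ge_mem_nhds (show (0:ℝ) < 1 by norm_num))] with k hk
    refine (hLk k).trans ?_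
    have h2 : (0:ℝ) < 2^k := by positivity
    have hs := hsmall (θ/2^k) (by
      rw [abs_div, abs_of_pos h2]
      rw [one_div, inv_pow] at hk
      calc |θ|/2^k * A = |θ| * A * (2^k)⁻¹ := by ring
        _ ≤ 1 := hk)
    have h3 : L (θ/2^k) ≤ exp (A^2 * (θ/2^k)^2) := by
      calc L (θ/2^k) ≤ φ (θ/2^k) := mul_le_of_le_one_right (h0 _) (exp_le_one_iff.2 (by
            have : 0 ≤ κ * (θ/2^k)^2 := by positivity
            linarith))
        _ ≤ 1 + A^2 * (θ/2^k)^2 := hs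
        _ ≤ _ := by linarith [add_one_le_exp (A^2 * (θ/2^k)^2)]
    calc L (θ/2^k)^(2^k) ≤ exp (A^2 * (θ/2^k)^2)^(2^k) := pow_le_pow_left₀ (hL0 _) h3 _
      _ = _ := by
        rw [← exp_nat_mul]; congr 1; push_cast; rw [one_div, inv_pow]; field_simp
  have hlim : Filter.Tendsto (fun k : ℕ => exp (A^2*θ^2 * (1/2)^k)) Filter.atTop (nhds (exp (A^2*θ^2*0))) :=
    (continuous_exp.tendsto _).comp
      ((tendsto_pow_atTop_nhds_zero_of_lt_one (by norm_num) (by norm_num)).const_mul _)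
  have := ge_of_tendsto hlim hev
  simp only [mul_zero, exp_zero, L] at this
  calc φ θ = (φ θ * exp (-(κ * θ^2))) * exp (κ * θ^2) := by
        rw [mul_assoc, ← exp_add]; simp
    _ ≤ 1 * exp (κ * θ^2) := by gcongr
    _ = _ := one_mul _

lemma exp_bound_of_var {E : Type*} [MeasurableSpace E] {μ : Measure E} [IsProbabilityMeasure μ]
    {F : E → ℝ} {C κ : ℝ} (hF : Measurable F) (hC0 : 0 ≤ C) (hC : ∀ x, |F x| ≤ C) (hκ : 0 ≤ κ)
    (hvar : ∀ τ : ℝ, ∫ x, exp (τ * F x) ^ 2 ∂μ - (∫ x, exp (τ * F x) ∂μ)^2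
      ≤ τ^2 * κ * ∫ x, exp (τ * F x) ^ 2 ∂μ) {θ : ℝ} (hθ : κ * θ^2 ≤ 1) :
    ∫ x, exp (θ * (F x - ∫ y, F y ∂μ)) ∂μ ≤ exp 1 := by
  set m := ∫ y, F y ∂μ with hm
  have hFi : Integrable F μ := Integrable.of_bound (C := C) (by fun_prop) (ae_of_all _ hC)
  have hm' : |m| ≤ C := by
    have := norm_integral_le_of_norm_le_const (μ := μ) (f := F) (ae_of_all _ hC)
    simpa using this
  have hY : ∀ x, |F x - m| ≤ 2*C := fun x => by
    have := abs_sub (F x) m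
    linarith [hC x]
  refine le_trans (iterate_bound (φ := fun θ => ∫ x, exp (θ * (F x - m)) ∂μ) (A := 2*C) hκ (by positivity)
    (fun t => integral_nonneg fun x => (exp_pos _).le) ?_ ?_ hθ) (exp_le_exp.2 hθ)
  · intro θ
    have := hvar (θ/2)
    have e1 : ∫ x, exp (θ/2 * F x) ^ 2 ∂μ = exp (θ*m) * ∫ x, exp (θ * (F x - m)) ∂μ := by
      rw [← integral_const_mul]; congr 1; ext x; rw [← exp_nat_mul, ← exp_add]; congr 1; push_cast; ring
    have e2 : ∫ x, exp (θ/2 * F x) ∂μ = exp (θ*m/2) * ∫ x, exp (θ/2 * (F x - m)) ∂μ := by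
      rw [← integral_const_mul]; congr 1; ext x; rw [← exp_add]; congr 1; ring
    rw [e1, e2, mul_pow, ← exp_nat_mul] at this
    have e3 : ((2:ℕ):ℝ) * (θ*m/2) = θ * m := by push_cast; ring
    rw [e3] at this
    have hpos := exp_pos (θ*m)
    refine le_of_mul_le_mul_left ?_ hpos
    linarith
  · intro t ht
    have hi : Integrable (fun x => 1 + (t * (F x - m)) + (2*C)^2*t^2) μ := by
      have := (hFi.sub (integrable_const m)).const_mul t
      exact ((integrable_const 1).add this).add (integrable_const _)
    have hle : ∀ x, exp (t * (F x - m)) ≤ 1 + (t * (F x - m)) + (2*C)^2*t^2 := by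
      intro x
      have h1 : |t * (F x - m)| ≤ |t| * (2*C) := by rw [abs_mul]; gcongr; exact hY x
      have h2 := (abs_le.1 (Real.abs_exp_sub_one_sub_id_le (h1.trans ht))).2
      have h3 : (t * (F x - m))^2 ≤ (|t| * (2*C))^2 := sq_le_sq' (by linarith [abs_le.1 h1]) (abs_le.1 h1).2
      rw [mul_pow |t|, sq_abs] at h3
      linarith
    have h4 := integral_mono_of_nonneg (μ := μ) (ae_of_all _ fun x => (exp_pos (t * (F x - m))).le) hi (ae_of_all _ hle)
    refine h4.trans (le_of_eq ?_)
    have h5 : Integrable (fun x => t * (F x - m)) μ := (hFi.sub (integrable_const m)).const_mul t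
    rw [integral_add (f := fun x => 1 + t * (F x - m)) ((integrable_const 1).add h5) (integrable_const _),
      integral_add (integrable_const 1) h5, integral_const_mul, integral_sub hFi (integrable_const m)]
    simp [← hm]


lemma fatou_real {E : Type*} [MeasurableSpace E] {μ : Measure E} {g : ℕ → E → ℝ} {G : E → ℝ} {C : ℝ}
    (hgm : ∀ N, Measurable (g N)) (hg0 : ∀ N x, 0 ≤ g N x)
    (hint : ∀ᶠ N in Filter.atTop, Integrable (g N) μ ∧ ∫ x, g N x ∂μ ≤ C) (hGm : Measurable G)
    (hlim : ∀ x, Filter.Tendsto (fun N => g N x) Filter.atTop (nhds (G x))) :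
    Integrable G μ ∧ ∫ x, G x ∂μ ≤ C := by
  have hG0 : ∀ x, 0 ≤ G x := fun x => ge_of_tendsto' (hlim x) fun N => hg0 N x
  have hC : 0 ≤ C := by
    obtain ⟨N, hN⟩ := hint.exists
    exact (integral_nonneg (hg0 N)).trans hN.2
  have key : ∫⁻ x, ENNReal.ofReal (G x) ∂μ ≤ ENNReal.ofReal C := by
    calc ∫⁻ x, ENNReal.ofReal (G x) ∂μ
        = ∫⁻ x, Filter.liminf (fun N => ENNReal.ofReal (g N x)) Filter.atTop ∂μ := by
          refine lintegral_congr fun x => ?_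
          exact ((ENNReal.tendsto_ofReal (hlim x)).liminf_eq).symm
      _ ≤ Filter.liminf (fun N => ∫⁻ x, ENNReal.ofReal (g N x) ∂μ) Filter.atTop :=
          lintegral_liminf_le fun N => (hgm N).ennreal_ofReal
      _ ≤ ENNReal.ofReal C := by
          refine Filter.liminf_le_of_frequently_le' (Filter.Eventually.frequently ?_)
          filter_upwards [hint] with N hN
          rw [← ofReal_integral_eq_lintegral_ofReal hN.1 (ae_of_all _ (hg0 N))]
          exact ENNReal.ofReal_le_ofReal hN.2
  have hi : Integrable G μ := by
    refine ⟨hGm.aestronglyMeasurable, ?_⟩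
    rw [hasFiniteIntegral_iff_ofReal (ae_of_all _ hG0)]
    exact key.trans_lt ENNReal.ofReal_lt_top
  refine ⟨hi, ?_⟩
  rw [← ofReal_integral_eq_lintegral_ofReal hi (ae_of_all _ hG0)] at key
  exact (ENNReal.ofReal_le_ofReal_iff hC).1 key

/-- truncated maximum -/
noncomputable def tmax {n : ℕ} (u : ℝ) (x : Fin n → ℝ) : ℝ := max (⨆ i, x i) u

section
variable {n : ℕ} 

lemma le_vmax (x : Fin n → ℝ) (i : Fin n) : x i ≤ ⨆ i, x i :=
  le_ciSup (Set.finite_range x).bddAbove i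

lemma vmax_measurable : Measurable (fun x : Fin n → ℝ => ⨆ i, x i) :=
  Measurable.iSup fun i => measurable_pi_apply i

lemma tmax_measurable (u : ℝ) : Measurable (tmax (n := n) u) :=
  vmax_measurable.max measurable_const

lemma vmax_abs_le [NeZero n] (x : Fin n → ℝ) : |⨆ i, x i| ≤ ∑ i, |x i| := by
  obtain ⟨i, hi⟩ := exists_eq_ciSup_of_finite (f := x)
  rw [← hi]
  exact Finset.single_le_sum (f := fun i => |x i|) (fun j _ => abs_nonneg _) (Finset.mem_univ i)

lemma SGV.vmax_integrable [NeZero n] {μ : Measure (Fin n → ℝ)} (h : SGV μ) :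
    Integrable (fun x : Fin n → ℝ => ⨆ i, x i) μ :=
  (integrable_finsetSum Finset.univ fun i _ => (h.integrable_eval i).abs).mono'
    vmax_measurable.aestronglyMeasurable (ae_of_all _ vmax_abs_le)

lemma SGV.tmax_integrable [NeZero n] {μ : Measure (Fin n → ℝ)} (h : SGV μ) (u : ℝ) :
    Integrable (tmax (n := n) u) μ := by
  have := h.gauss
  exact h.vmax_integrable.sup (integrable_const u)

lemma soft_close [NeZero n] {u β : ℝ} (hu : 0 ≤ u) (hβ : 1 ≤ β) (x : Fin n → ℝ) :
    |softF β (exp (β*u)) (exp (-β^2)) x - tmax u x| ≤ β⁻¹ * log (n+2) + max (tmax u x - β) 0 := by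
  have hβ0 : 0 < β := by linarith
  set T := tmax u x with hT
  have hTu : u ≤ T := le_max_right _ _
  have hTx : ∀ i, x i ≤ T := fun i => (le_vmax x i).trans (le_max_left _ _)
  have hS := softS_pos (β := β) (exp_pos (β*u)) x
  have hb := exp_pos (-β^2)
  set S := softS β (exp (β*u)) x with hSd
  have hS1 : exp (β*T) ≤ S := by
    rcases le_total (⨆ i, x i) u with hle | hle
    · have : T = u := max_eq_right hle
      rw [this]; exact softS_ge x
    · have h1 : T = ⨆ i, x i := max_eq_left hle
      obtain ⟨i, hi⟩ := exists_eq_ciSup_of_finite (f := x)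
      rw [h1, ← hi, hSd, softS]
      have := Finset.single_le_sum (f := fun i => exp (β * x i)) (fun j _ => (exp_pos _).le) (Finset.mem_univ i)
      linarith [exp_pos (β*u)]
  have hS2 : S ≤ (n+1) * exp (β*T) := by
    rw [hSd, softS]
    have h1 : exp (β*u) ≤ exp (β*T) := by gcongr
    have h2 : ∑ i, exp (β * x i) ≤ ∑ i : Fin n, exp (β * T) := by
      refine Finset.sum_le_sum fun i _ => ?_
      have := hTx i
      gcongr
    simp only [Finset.sum_const, Finset.card_univ, Fintype.card_fin, nsmul_eq_mul] at h2
    linarith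
  have l1 : β * T ≤ log S := by rw [le_log_iff_exp_le hS]; exact hS1
  have l2 : log S ≤ log (n+2) + β * T := by
    have : log S ≤ log ((n+2) * exp (β*T)) := by
      refine log_le_log hS (hS2.trans ?_); gcongr; norm_num
    rwa [log_mul (by positivity) (exp_pos _).ne', log_exp] at this
  have hm : 0 ≤ max (T - β) 0 := le_max_right _ _
  have l3 : log (1 + exp (-β^2) * S) ≤ log (n+2) + β * max (T-β) 0 := by
    have h1 : exp (-β^2) * S ≤ (n+1) * exp (β * max (T-β) 0) := by
      calc exp (-β^2) * S ≤ exp (-β^2) * ((n+1) * exp (β*T)) := by gcongr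
        _ = (n+1) * exp (β * (T-β)) := by
          rw [mul_left_comm, ← exp_add]; congr 2; ring
        _ ≤ _ := by gcongr; exact le_max_left _ _
    have h2 : 1 ≤ exp (β * max (T-β) 0) := one_le_exp (by positivity)
    have : log (1 + exp (-β^2) * S) ≤ log ((n+2) * exp (β*max (T-β) 0)) :=
      log_le_log (by positivity) (by linarith)
    rwa [log_mul (by positivity) (exp_pos _).ne', log_exp] at this
  have l4 : 0 ≤ log (1 + exp (-β^2) * S) := log_nonneg (by have := mul_pos hb hS; linarith)
  have hF : softF β (exp (β*u)) (exp (-β^2)) x = β⁻¹ * (log S - log (1 + exp (-β^2) * S)) := by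
    rw [softF, log_div hS.ne' (by positivity)]
  have hib : 0 < β⁻¹ := inv_pos.2 hβ0
  have hbb : β⁻¹ * β = 1 := inv_mul_cancel₀ hβ0.ne'
  rw [hF]
  have e : β⁻¹ * (log S - log (1 + exp (-β^2) * S)) - T = β⁻¹ * (log S - log (1 + exp (-β^2) * S) - β * T) := by
    rw [mul_sub β⁻¹ _ (β*T), ← mul_assoc, hbb, one_mul]
  have e' : β⁻¹ * log (n+2) + max (T - β) 0 = β⁻¹ * (log (n+2) + β * max (T - β) 0) := by
    rw [mul_add, ← mul_assoc, hbb, one_mul]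
  rw [e, e', abs_mul, abs_of_pos hib]
  gcongr
  have := mul_nonneg hβ0.le hm
  rw [abs_le]; constructor <;> linarith

lemma SGV.exp_tmax [NeZero n] {μ : Measure (Fin n → ℝ)} (h : SGV μ) {u κ : ℝ} (hu : 0 ≤ u) (hκ : 0 ≤ κ)
    (hvar : ∀ᶠ N : ℕ in Filter.atTop, ∀ τ : ℝ,
      ∫ x, exp (τ * softF (N:ℝ) (exp (N*u)) (exp (-(N:ℝ)^2)) x) ^ 2 ∂μ
       - (∫ x, exp (τ * softF (N:ℝ) (exp (N*u)) (exp (-(N:ℝ)^2)) x) ∂μ)^2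
      ≤ τ^2 * κ * ∫ x, exp (τ * softF (N:ℝ) (exp (N*u)) (exp (-(N:ℝ)^2)) x) ^ 2 ∂μ)
    {θ : ℝ} (hθ : κ * θ^2 ≤ 1) :
    Integrable (fun x => exp (θ * (tmax u x - ∫ y, tmax u y ∂μ))) μ ∧
    ∫ x, exp (θ * (tmax u x - ∫ y, tmax u y ∂μ)) ∂μ ≤ exp 1 := by
  have := h.gauss
  let F : ℕ → (Fin n → ℝ) → ℝ := fun N x => softF (N:ℝ) (exp (N*u)) (exp (-(N:ℝ)^2)) x
  have hFc : ∀ N, Continuous (F N) := fun N => softF_cont (exp_pos _) (exp_pos _)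
  have hFm : ∀ N, Measurable (F N) := fun N => (hFc N).measurable
  have hT0 : ∀ x : Fin n → ℝ, 0 ≤ tmax u x := fun x => hu.trans (le_max_right _ _)
  have hlog : (0:ℝ) ≤ log (n+2) := log_nonneg (by have : (0:ℝ) ≤ n := n.cast_nonneg
                                                  linarith)
  have hlim : ∀ x, Filter.Tendsto (fun N => F N x) Filter.atTop (nhds (tmax u x)) := by
    intro x
    rw [tendsto_iff_norm_sub_tendsto_zero]
    have ht : Filter.Tendsto (fun N : ℕ => (N:ℝ)⁻¹ * log (n+2)) Filter.atTop (nhds 0) := by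
      simpa using (tendsto_inv_atTop_nhds_zero_nat (𝕜 := ℝ)).mul_const (log (n+2))
    refine squeeze_zero' (Filter.Eventually.of_forall fun _ => norm_nonneg _) ?_ ht
    filter_upwards [Filter.eventually_ge_atTop 1,
      (tendsto_natCast_atTop_atTop (R := ℝ)).eventually_ge_atTop (tmax u x)] with N h1 h2
    have := soft_close (n := n) hu (β := N) (by exact_mod_cast h1) x
    rwa [max_eq_right (by linarith), add_zero] at this
  have hdom : ∀ᶠ N : ℕ in Filter.atTop, ∀ᵐ x ∂μ, ‖F N x‖ ≤ log (n+2) + 2 * tmax u x := by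
    filter_upwards [Filter.eventually_ge_atTop 1] with N h1
    refine ae_of_all _ fun x => ?_
    have hN : (1:ℝ) ≤ N := by exact_mod_cast h1
    have h3 := soft_close (n := n) hu (β := N) hN x
    have h4 : max (tmax u x - N) 0 ≤ tmax u x := max_le (by linarith) (hT0 x)
    have h5 : (N:ℝ)⁻¹ * log (n+2) ≤ log (n+2) := mul_le_of_le_one_left hlog (inv_le_one_of_one_le₀ hN)
    have h6 := abs_sub_abs_le_abs_sub (F N x) (tmax u x)
    have h7 := abs_of_nonneg (hT0 x)
    rw [norm_eq_abs]
    have : |F N x - tmax u x| ≤ _ := h3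
    linarith
  have hm : Filter.Tendsto (fun N => ∫ x, F N x ∂μ) Filter.atTop (nhds (∫ x, tmax u x ∂μ)) :=
    tendsto_integral_filter_of_dominated_convergence (fun x => log (n+2) + 2 * tmax u x)
      (Filter.Eventually.of_forall fun N => (hFm N).aestronglyMeasurable) hdom
      ((integrable_const _).add ((h.tmax_integrable u).const_mul 2)) (ae_of_all _ hlim)
  refine fatou_real (g := fun N x => exp (θ * (F N x - ∫ y, F N y ∂μ))) (fun N => ?_) (fun N x => (exp_pos _).le) ?_ ?_ ?_
  · have := hFm N; fun_prop
  · filter_upwards [hvar, Filter.eventually_ge_atTop 1] with N hN h1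
    have hN0 : (0:ℝ) < N := by exact_mod_cast h1
    obtain ⟨C, hC0, hC⟩ := softF_bdd (n := n) hN0 (exp_pos (N*u)) (exp_pos (-(N:ℝ)^2))
    refine ⟨?_, exp_bound_of_var (hFm N) hC0 hC hκ hN hθ⟩
    have hm2 := hFm N
    refine Integrable.of_bound (C := exp (|θ| * (C + |∫ y, F N y ∂μ|))) (by fun_prop) (ae_of_all _ fun x => ?_)
    rw [norm_of_nonneg (exp_pos _).le, exp_le_exp]
    refine (le_abs_self _).trans ?_
    rw [abs_mul]
    gcongr
    refine (abs_sub _ _).trans ?_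
    gcongr
    exact hC x
  · have := tmax_measurable (n := n) u; fun_prop
  · intro x
    exact (continuous_exp.tendsto _).comp (((hlim x).sub hm).const_mul θ)

lemma SGV.exp_tmax_one [NeZero n] {μ : Measure (Fin n → ℝ)} (h : SGV μ) {u : ℝ} (hu : 0 ≤ u)
    {θ : ℝ} (hθ : θ^2 ≤ 1) :
    Integrable (fun x => exp (θ * (tmax u x - ∫ y, tmax u y ∂μ))) μ ∧
    ∫ x, exp (θ * (tmax u x - ∫ y, tmax u y ∂μ)) ∂μ ≤ exp 1 := by
  refine h.exp_tmax hu (κ := 1) (by norm_num) ?_ (by linarith)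
  filter_upwards [Filter.eventually_ge_atTop 1] with N h1 τ
  have hN0 : (0:ℝ) < N := by exact_mod_cast h1
  obtain ⟨B, hB⟩ := soft_testF (n := n) hN0 (exp_pos (N*u)) (exp_pos (-(N:ℝ)^2)) τ
  exact h.var_one hB

lemma SGV.exp_tmax_two [NeZero n] {μ : Measure (Fin n → ℝ)} (h : SGV μ) {u ε K : ℝ} (hu : 0 < u)
    (hε : 0 ≤ ε) (hK : 0 < K) (hc : ∀ i j, i ≠ j → ∫ x, x i * x j ∂μ ≤ ε)
    {θ : ℝ} (hθ : (ε + K + 16/u^2) * θ^2 ≤ 1) :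
    Integrable (fun x => exp (θ * (tmax u x - ∫ y, tmax u y ∂μ))) μ ∧
    ∫ x, exp (θ * (tmax u x - ∫ y, tmax u y ∂μ)) ∂μ ≤ exp 1 := by
  refine h.exp_tmax hu.le (κ := ε + K + 16/u^2) (by positivity) ?_ hθ
  have ht : Filter.Tendsto (fun N : ℕ => (n:ℝ) * exp (-((N:ℝ) * (u/2)))) Filter.atTop (nhds (n * 0)) := by
    refine Filter.Tendsto.const_mul _ ?_
    refine tendsto_exp_neg_atTop_nhds_zero.comp ?_
    exact (tendsto_natCast_atTop_atTop (R := ℝ)).atTop_mul_const (by positivity)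
  rw [mul_zero] at ht
  filter_upwards [Filter.eventually_ge_atTop 1, ht.eventually (ge_mem_nhds hK)] with N h1 h2 τ
  have hN0 : (0:ℝ) < N := by exact_mod_cast h1
  obtain ⟨B, hB⟩ := soft_testF (n := n) hN0 (exp_pos (N*u)) (exp_pos (-(N:ℝ)^2)) τ
  have hv := h.var_two hB (v := u/2) (η := exp (-((N:ℝ) * (u/2)))) (by positivity) (exp_pos _).le hε
    (fun i x hx => by
      refine (softp_le (exp_pos _) (exp_pos _) i x).trans ?_
      rw [← exp_sub, exp_le_exp]
      nlinarith) hc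
  refine hv.trans ?_
  have : 4 / (u/2)^2 = 16/u^2 := by field_simp; norm_num
  rw [this]
  refine mul_le_mul_of_nonneg_right ?_ (integral_nonneg fun x => ?_)
  · gcongr
  · exact sq_nonneg (exp _)
end


section
variable {n : ℕ} {μ : Measure (Fin n → ℝ)}

lemma SGV.map_add (h : SGV μ) (i j : Fin n) :
    μ.map (fun x => x i + x j) = gaussianReal 0 (2 + 2 * ∫ x, x i * x j ∂μ).toNNReal := by
  have := h.gauss
  let L : StrongDual ℝ (Fin n → ℝ) := ContinuousLinearMap.proj (R := ℝ) (φ := fun _ => ℝ) i +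
    ContinuousLinearMap.proj (R := ℝ) (φ := fun _ => ℝ) j
  have hL : ⇑L = fun x => x i + x j := by ext; simp [L]
  have h1 := IsGaussian.map_eq_gaussianReal (μ := μ) L
  have h2 : Var[L; μ] = 2 + 2 * ∫ x, x i * x j ∂μ := by
    have hm : MemLp (fun x : Fin n → ℝ => x i + x j) 2 μ := (h.memLp i).add (h.memLp j)
    have i1 : Integrable (fun x : Fin n → ℝ => x i * x j) μ := (h.memLp i).integrable_mul (h.memLp j)
    have i2 := (h.memLp i).integrable_sq
    have i3 := (h.memLp j).integrable_sq
    have i23 : Integrable (fun x : Fin n → ℝ => x i ^ 2 + x j ^ 2) μ := i2.add i3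
    rw [hL, variance_eq_sub hm, integral_add (h.integrable_eval i) (h.integrable_eval j), h.eval_mean, h.eval_mean]
    have e : ∀ x : Fin n → ℝ, ((fun x : Fin n → ℝ => x i + x j) ^ 2) x = (x i ^ 2 + x j ^ 2) + 2 * (x i * x j) := by
      intro x; simp only [Pi.pow_apply]; ring
    simp_rw [e]
    rw [integral_add i23 (i1.const_mul 2), integral_add i2 i3, h.var, h.var, integral_const_mul]
    norm_num
  rw [h2, h.mean, hL] at h1
  exact h1

lemma SGV.exp_add (h : SGV μ) (i j : Fin n) (s : ℝ) :
    Integrable (fun x : Fin n → ℝ => exp (s * x i) * exp (s * x j)) μ ∧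
    ∫ x, exp (s * x i) * exp (s * x j) ∂μ = exp (s^2 * (1 + ∫ x, x i * x j ∂μ)) := by
  have := h.gauss
  have e : ∀ x : Fin n → ℝ, exp (s * x i) * exp (s * x j) = exp (s * (x i + x j)) := by
    intro x; rw [← Real.exp_add]; congr 1; ring
  simp_rw [e]
  have hnn : 0 ≤ 2 + 2 * ∫ x, x i * x j ∂μ := by
    have i1 : Integrable (fun x : Fin n → ℝ => x i * x j) μ := (h.memLp i).integrable_mul (h.memLp j)
    have i2 := (h.memLp i).integrable_sq
    have i3 := (h.memLp j).integrable_sq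
    have i23 : Integrable (fun x : Fin n → ℝ => x i ^ 2 + x j ^ 2) μ := i2.add i3
    have : 0 ≤ ∫ x, (x i ^ 2 + x j ^ 2) + 2 * (x i * x j) ∂μ :=
      integral_nonneg fun x => by
        have := sq_nonneg (x i + x j)
        simp only [Pi.zero_apply]
        linarith
    rw [integral_add i23 (i1.const_mul 2), integral_add i2 i3, h.var, h.var, integral_const_mul] at this
    linarith
  constructor
  · have h1 := integrable_exp_mul_gaussianReal (μ := 0) (v := (2 + 2 * ∫ x, x i * x j ∂μ).toNNReal) s
    rw [← h.map_add i j] at h1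
    exact (integrable_map_measure (f := fun x : Fin n → ℝ => x i + x j) (g := fun y : ℝ => exp (s * y))
      (by fun_prop) ((measurable_pi_apply i).add (measurable_pi_apply j)).aemeasurable).1 h1
  · have h1 := mgf_gaussianReal (p := μ) (X := fun x => x i + x j) (h.map_add i j) s
    rw [Real.coe_toNNReal _ hnn] at h1
    simp only [mgf] at h1
    rw [h1]; congr 1; ring

lemma SGV.mean_lower [NeZero n] (h : SGV μ) {ε s u : ℝ} (hs : 0 < s) (hs6 : 6 ≤ s^2) (hu : 0 ≤ u)
    (hsn : exp (s^2) ≤ n) (hse : s^2 * ε ≤ 1) (hc : ∀ i j, i ≠ j → ∫ x, x i * x j ∂μ ≤ ε) :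
    s/48 ≤ ∫ x, tmax u x ∂μ := by
  have := h.gauss
  let N : (Fin n → ℝ) → ℝ := fun x => ∑ i, exp (s * x i)
  have hn0 : (0:ℝ) < n := (exp_pos _).trans_le hsn
  have hNi : Integrable N μ := integrable_finsetSum _ fun i _ => h.integrable_exp_eval i s
  have hEN : ∫ x, N x ∂μ = n * exp (s^2/2) := by
    simp only [N]
    rw [integral_finsetSum _ fun i _ => h.integrable_exp_eval i s]
    simp [h.mgf_eval]
  have hN2 : ∀ x, N x ^ 2 = ∑ i, ∑ j, exp (s * x i) * exp (s * x j) := by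
    intro x; simp only [N]; rw [sq, Finset.sum_mul_sum]
  have hN2i : Integrable (fun x => N x ^ 2) μ := by
    simp_rw [hN2]
    exact integrable_finsetSum _ fun i _ => integrable_finsetSum _ fun j _ => (h.exp_add i j s).1
  have hEN2 : ∫ x, N x ^ 2 ∂μ ≤ 4 * (n * exp (s^2/2))^2 := by
    simp_rw [hN2]
    rw [integral_finsetSum _ fun i _ => integrable_finsetSum _ fun j _ => (h.exp_add i j s).1]
    have : ∀ i, ∫ x, ∑ j, exp (s * x i) * exp (s * x j) ∂μ ≤ ∑ j, (exp (s^2) * exp 1 + if i = j then exp (s^2) * exp (s^2) else 0) := by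
      intro i
      rw [integral_finsetSum _ fun j _ => (h.exp_add i j s).1]
      refine Finset.sum_le_sum fun j _ => ?_
      rw [(h.exp_add i j s).2, mul_add, Real.exp_add, mul_one]
      split_ifs with hij
      · have := h.corr_le_one i j
        have h1 : exp (s^2 * ∫ x, x i * x j ∂μ) ≤ exp (s^2) := by
          rw [exp_le_exp]; exact mul_le_of_le_one_right (sq_nonneg s) this
        have := mul_le_mul_of_nonneg_left h1 (exp_pos (s^2)).le
        have := mul_pos (exp_pos (s^2)) (exp_pos 1)
        linarith
      · rw [add_zero]; gcongr
        exact (mul_le_mul_of_nonneg_left (hc i j hij) (sq_nonneg s)).trans hse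
    refine (Finset.sum_le_sum fun i _ => this i).trans ?_
    simp only [Finset.sum_add_distrib, Finset.sum_ite_eq, Finset.mem_univ, if_true, Finset.sum_const,
      Finset.card_univ, Fintype.card_fin, nsmul_eq_mul]
    have e1 : (n * exp (s^2/2))^2 = n * (n * exp (s^2)) := by
      rw [mul_pow, ← exp_nat_mul]; push_cast; rw [mul_div_cancel₀ _ (by norm_num)]; ring
    rw [e1]
    have h3 := exp_one_lt_three
    have hp := exp_pos (s^2)
    have h4 : exp (s^2) * exp 1 ≤ exp (s^2) * 3 := by gcongr
    have h5 : exp (s^2) * exp (s^2) ≤ n * exp (s^2) := by gcongr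
    have h6 := mul_le_mul_of_nonneg_left (mul_le_mul_of_nonneg_left h4 hn0.le) hn0.le
    have h7 := mul_le_mul_of_nonneg_left h5 hn0.le
    linarith
  set A := n * exp (s^2/2) with hA
  have hA0 : 0 < A := by positivity
  have hpt : ∀ x, N x ≤ A/2 + (1/(16*A)) * N x ^ 2 + 4 * A * (3/s) * tmax u x := by
    intro x
    have hT0 : 0 ≤ tmax u x := hu.trans (le_max_right _ _)
    have hT1 : 0 ≤ 4 * A * (3/s) * tmax u x := by positivity
    have hN0 : 0 ≤ (1/(16*A)) * N x ^ 2 := by positivity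
    rcases le_total (N x) (A/2) with hle | hle
    · linarith
    have h1 : N x ≤ n * exp (s * tmax u x) := by
      have : N x ≤ ∑ i : Fin n, exp (s * tmax u x) := by
        refine Finset.sum_le_sum fun i _ => ?_
        have : x i ≤ tmax u x := (le_vmax x i).trans (le_max_left _ _)
        gcongr
      simpa using this
    have h2 : exp (s^2/2) ≤ 2 * exp (s * tmax u x) := by
      have : n * exp (s^2/2) ≤ n * (2 * exp (s * tmax u x)) := by linarith
      exact le_of_mul_le_mul_left this hn0
    have h3 : s^2/2 ≤ 1 + s * tmax u x := by
      have h2e : (2:ℝ) ≤ exp 1 := by linarith [add_one_le_exp (1:ℝ)]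
      rw [← exp_le_exp, Real.exp_add]
      exact h2.trans (by gcongr)
    have h4 : s/3 ≤ tmax u x := by
      have : s * (s/3) ≤ s * tmax u x := by nlinarith
      exact le_of_mul_le_mul_left this hs
    have h5 : 4 * A ≤ 4 * A * (3/s) * tmax u x := by
      have : 4 * A * (3/s) * (s/3) ≤ 4 * A * (3/s) * tmax u x := by gcongr
      have e : 4 * A * (3/s) * (s/3) = 4 * A := by field_simp
      linarith
    have h6 : N x ≤ (1/(16*A)) * N x ^ 2 + 4 * A := by
      have : (1/(16*A)) * N x ^ 2 + 4 * A - N x = (1/(16*A)) * (N x - 8 * A)^2 := by field_simp; ring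
      have : 0 ≤ (1/(16*A)) * (N x - 8 * A)^2 := by positivity
      linarith
    linarith
  have hTi := h.tmax_integrable u
  have hfin := integral_mono hNi (((integrable_const (A/2)).add (hN2i.const_mul (1/(16*A)))).add (hTi.const_mul (4 * A * (3/s)))) hpt
  rw [hEN, integral_add' ((integrable_const (A/2)).add (hN2i.const_mul (1/(16*A)))) (hTi.const_mul (4 * A * (3/s))),
    integral_add' (integrable_const (A/2)) (hN2i.const_mul (1/(16*A))), integral_const_mul, integral_const_mul] at hfin
  simp only [integral_const, probReal_univ, one_smul] at hfin
  have h8 : (1/(16*A)) * ∫ x, N x ^ 2 ∂μ ≤ (1/(16*A)) * (4 * A^2) := by gcongr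
  have e8 : (1/(16*A)) * (4 * A^2) = A/4 := by field_simp; norm_num
  rw [e8] at h8
  set m := ∫ x, tmax u x ∂μ
  have h9 : A * (1/4) ≤ A * (12/s * m) := by
    have : A * (12/s * m) = 4 * A * (3/s) * m := by ring
    rw [this]; linarith
  have h10 := le_of_mul_le_mul_left h9 hA0
  rw [div_mul_eq_mul_div, le_div_iff₀ hs] at h10
  linarith
end


section
variable {n : ℕ} {μ : Measure (Fin n → ℝ)}

lemma SGV.exp_abs_le [NeZero n] (h : SGV μ) {u m l0 l : ℝ} (hm : ∫ x, tmax u x ∂μ = m) (hum : 2 * u ≤ m)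
    (hl : 0 < l) (hl8 : l ≤ l0/8) (hl2 : 2 * l^2 ≤ 1 + l0 * m / 8) (hm0 : 0 ≤ m)
    (hexp : ∀ θ, |θ| ≤ l0 → Integrable (fun x => exp (θ * (tmax u x - m))) μ ∧
      ∫ x, exp (θ * (tmax u x - m)) ∂μ ≤ exp 1) :
    Integrable (fun x : Fin n → ℝ => exp (l * |(⨆ i, x i) - m|)) μ ∧
    ∫ x, exp (l * |(⨆ i, x i) - m|) ∂μ ≤ 9 := by
  have := h.gauss
  have hl0 : 0 < l0 := by linarith
  let i0 : Fin n := 0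
  obtain ⟨ia, ha⟩ := hexp l (by rw [abs_of_pos hl]; linarith)
  obtain ⟨ib, hb⟩ := hexp (-l) (by rw [abs_neg, abs_of_pos hl]; linarith)
  obtain ⟨ic, hc⟩ := hexp (-l0) (by rw [abs_neg, abs_of_pos hl0])
  have idd := h.integrable_exp_eval i0 (-(2*l))
  have hd := h.mgf_eval i0 (-(2*l))
  set c1 := exp (l*m) * exp (-(l0*m/4)) / 2 with hc1
  have hpt : ∀ x : Fin n → ℝ, exp (l * |(⨆ i, x i) - m|) ≤
      (exp (l * (tmax u x - m)) + exp (-l * (tmax u x - m))) +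
      (c1 * exp (-(2*l) * x i0) + c1 * exp (-l0 * (tmax u x - m))) := by
    intro x
    have hM : (⨆ i, x i) ≤ tmax u x := le_max_left _ _
    have p1 := exp_pos (l * (tmax u x - m))
    have p2 := exp_pos (-l * (tmax u x - m))
    have p3 : 0 < c1 * exp (-(2*l) * x i0) := by positivity
    have p4 : 0 < c1 * exp (-l0 * (tmax u x - m)) := by positivity
    rcases le_total m (⨆ i, x i) with hle | hle
    · have : exp (l * |(⨆ i, x i) - m|) ≤ exp (l * (tmax u x - m)) := by
        rw [abs_of_nonneg (by linarith)]; gcongr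
      linarith
    rw [abs_of_nonpos (by linarith)]
    rcases le_total u (⨆ i, x i) with hle2 | hle2
    · have : tmax u x = ⨆ i, x i := max_eq_left hle2
      rw [this] at p1 p2 p4 ⊢
      have e : l * -((⨆ i, x i) - m) = -l * ((⨆ i, x i) - m) := by ring
      rw [e]; linarith
    · have hT : tmax u x = u := max_eq_right hle2
      have h1 : exp (l * -((⨆ i, x i) - m)) ≤ exp (l * m) * exp (-l * x i0) := by
        rw [← Real.exp_add, exp_le_exp]
        have := mul_le_mul_of_nonneg_left (le_vmax x i0) hl.le
        linarith
      have h2 : exp (-l * x i0) ≤ exp (-(l0*m/4)) / 2 * exp (-(2*l) * x i0) + exp (-(l0*m/4)) / 2 * exp (-l0 * (u - m)) := by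
        have e1 : exp (-(2*l) * x i0) = exp (-l * x i0)^2 := by rw [← exp_nat_mul]; congr 1; push_cast; ring
        have e2 : exp (-(l0*m/4)) = exp (-(l0*m/8))^2 := by rw [← exp_nat_mul]; congr 1; push_cast; ring
        have e3 : exp (l0*m/8)^2 ≤ exp (-(l0*m/4)) * exp (-l0 * (u - m)) := by
          rw [← exp_nat_mul, ← Real.exp_add, exp_le_exp]; push_cast
          nlinarith
        have e4 : exp (-(l0*m/8)) * exp (l0*m/8) = 1 := by rw [← Real.exp_add]; simp
        have e5 : exp (-l * x i0) = (exp (-(l0*m/8)) * exp (-l * x i0)) * exp (l0*m/8) := by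
          rw [mul_right_comm, e4, one_mul]
        have := sq_nonneg (exp (-(l0*m/8)) * exp (-l * x i0) - exp (l0*m/8))
        rw [e1]
        have e6 : exp (-(l0*m/4)) / 2 * exp (-l * x i0)^2 = (exp (-(l0*m/8)) * exp (-l * x i0))^2 / 2 := by
          rw [e2]; ring
        rw [e6]
        nlinarith
      rw [hT] at p1 p2 p4 ⊢
      have h3 := mul_le_mul_of_nonneg_left h2 (exp_pos (l*m)).le
      have h4 : exp (l * m) * (exp (-(l0*m/4)) / 2 * exp (-(2*l) * x i0) + exp (-(l0*m/4)) / 2 * exp (-l0 * (u - m)))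
        = c1 * exp (-(2*l) * x i0) + c1 * exp (-l0 * (u - m)) := by rw [hc1]; ring
      linarith
  have iab : Integrable (fun x : Fin n → ℝ => exp (l * (tmax u x - m)) + exp (-l * (tmax u x - m))) μ := ia.add ib
  have icd : Integrable (fun x : Fin n → ℝ => c1 * exp (-(2*l) * x i0) + c1 * exp (-l0 * (tmax u x - m))) μ :=
    (idd.const_mul c1).add (ic.const_mul c1)
  have hint : Integrable (fun x : Fin n → ℝ => exp (l * |(⨆ i, x i) - m|)) μ := by
    have := vmax_measurable (n := n)
    refine (iab.add icd).mono' (Measurable.aestronglyMeasurable (by fun_prop)) (ae_of_all _ fun x => ?_)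
    rw [norm_of_nonneg (exp_pos _).le]
    exact hpt x
  refine ⟨hint, ?_⟩
  have hfin := integral_mono hint (iab.add icd) hpt
  rw [integral_add' iab icd, integral_add ia ib, integral_add (idd.const_mul c1) (ic.const_mul c1),
    integral_const_mul, integral_const_mul, hd] at hfin
  have he := exp_one_lt_three
  have q1 : c1 * exp ((-(2*l))^2/2) ≤ exp 1 / 2 := by
    rw [hc1, div_mul_eq_mul_div, ← Real.exp_add, ← Real.exp_add]
    gcongr
    nlinarith
  have q2 : c1 * ∫ x, exp (-l0 * (tmax u x - m)) ∂μ ≤ (1/2) * exp 1 := by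
    have : c1 ≤ 1/2 := by
      rw [hc1, ← Real.exp_add]
      gcongr
      rw [exp_le_one_iff]
      nlinarith
    have hc10 : 0 ≤ c1 := by positivity
    exact mul_le_mul this hc (integral_nonneg fun x => (exp_pos _).le) (by norm_num)
  linarith

lemma tail_of_exp {E : Type*} [MeasurableSpace E] {μ : Measure E} [IsProbabilityMeasure μ] {M : E → ℝ} {m l : ℝ}
    (hM : Integrable M μ) (hl : 0 < l) 
    (hi : Integrable (fun x => exp (l * |M x - m|)) μ) (hb : ∫ x, exp (l * |M x - m|) ∂μ ≤ 9) (t : ℝ) :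
    μ.real {x | t ≤ |M x - ∫ y, M y ∂μ|} ≤ 6 * exp (-(l * t / 15)) := by
  have hZi : Integrable (fun x => M x - m) μ := hM.sub (integrable_const m)
  have h1 : l * |(∫ y, M y ∂μ) - m| ≤ 8 := by
    have e : (∫ y, M y ∂μ) - m = ∫ y, (M y - m) ∂μ := by
      rw [integral_sub hM (integrable_const m)]; simp
    rw [e]
    have h2 : |∫ y, (M y - m) ∂μ| ≤ ∫ y, |M y - m| ∂μ := abs_integral_le_integral_abs
    have h3 : ∫ y, l * |M y - m| + 1 ∂μ ≤ ∫ x, exp (l * |M x - m|) ∂μ :=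
      integral_mono ((hZi.abs.const_mul l).add (integrable_const 1)) hi fun x => add_one_le_exp _
    rw [integral_add (hZi.abs.const_mul l) (integrable_const 1), integral_const_mul] at h3
    simp only [integral_const, probReal_univ, one_smul] at h3
    have := mul_le_mul_of_nonneg_left h2 hl.le
    linarith
  have h4 : ∀ x, exp (l * |M x - ∫ y, M y ∂μ|) ≤ exp 8 * exp (l * |M x - m|) := by
    intro x
    rw [← Real.exp_add, exp_le_exp]
    have h5 := abs_sub_le (M x) m (∫ y, M y ∂μ)
    rw [abs_sub_comm m] at h5
    have := mul_le_mul_of_nonneg_left h5 hl.le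
    linarith
  have h6 : μ.real {x | t ≤ |M x - ∫ y, M y ∂μ|} * exp (l * t) ≤ exp 8 * 9 := by
    have hi2 : Integrable (fun x => exp 8 * exp (l * |M x - m|)) μ := hi.const_mul _
    have mk := mul_meas_ge_le_integral_of_nonneg (μ := μ) (f := fun x => exp 8 * exp (l * |M x - m|))
      (ae_of_all _ fun x => by positivity) hi2 (exp (l * t))
    rw [integral_const_mul] at mk
    have h7 : μ.real {x | t ≤ |M x - ∫ y, M y ∂μ|} ≤ μ.real {x | exp (l*t) ≤ exp 8 * exp (l * |M x - m|)} := by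
      refine measureReal_mono fun x hx => ?_
      refine le_trans ?_ (h4 x)
      rw [exp_le_exp]
      exact mul_le_mul_of_nonneg_left hx hl.le
    have h8 := mul_le_mul_of_nonneg_right h7 (exp_pos (l*t)).le
    have h9 := mul_le_mul_of_nonneg_left hb (exp_pos 8).le
    linarith
  have he2 : (2.7:ℝ) ≤ exp 1 := by have := exp_one_gt_d9; linarith
  have he3 := exp_one_lt_three
  rcases le_total (l*t) 15 with hle | hle
  · have : μ.real {x | t ≤ |M x - ∫ y, M y ∂μ|} ≤ 1 := measureReal_le_one
    refine this.trans ?_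
    have h10 : exp (-1) ≤ exp (-(l*t/15)) := by rw [exp_le_exp]; linarith
    have h11 : exp (-1) * exp 1 = 1 := by rw [← Real.exp_add]; simp
    nlinarith [exp_pos (-1)]
  · have h12 : exp 8 * 9 ≤ exp 11 := by
      have : exp 11 = exp 8 * (exp 1 * exp 1 * exp 1) := by
        rw [← Real.exp_add, ← Real.exp_add, ← Real.exp_add]; norm_num
      rw [this]; gcongr
      nlinarith
    have h13 : μ.real {x | t ≤ |M x - ∫ y, M y ∂μ|} ≤ exp (11 - l*t) := by
      rw [Real.exp_sub, le_div_iff₀ (exp_pos _)]; linarith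
    have h14 : exp (11 - l*t) ≤ exp (-(l*t/15)) := by rw [exp_le_exp]; linarith
    have := exp_pos (-(l*t/15))
    linarith

lemma SGV.main (h : SGV μ) (hn : 2 ≤ n) {ε : ℝ} (hε : 0 < ε)
    (hc : ∀ i j, i ≠ j → ∫ x, x i * x j ∂μ ≤ ε) {t : ℝ} (ht : 0 ≤ t) :
    μ.real {x | t ≤ |(⨆ i, x i) - ∫ y, (⨆ i, y i) ∂μ|} ≤
      6 * exp (-(1/48000) * t / √(max ε (1 / log n))) := by
  have := h.gauss
  haveI : NeZero n := ⟨by omega⟩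
  have hn2 : (2:ℝ) ≤ n := by exact_mod_cast hn
  have hlog : 0 < log n := log_pos (by linarith)
  set K := max ε (1 / log n) with hK
  have hK0 : 0 < K := hε.trans_le (le_max_left _ _)
  have hsq : 0 < √K := sqrt_pos.2 hK0
  set s := 1/√K with hs
  have hs0 : 0 < s := by positivity
  have hs2 : s^2 * K = 1 := by rw [hs, div_pow, sq_sqrt hK0.le]; field_simp
  have hse : s^2 * ε ≤ 1 := by
    rw [← hs2]; gcongr; exact le_max_left _ _
  have hsn : exp (s^2) ≤ n := by
    have h1 : s^2 * (1/log n) ≤ s^2 * K := mul_le_mul_of_nonneg_left (le_max_right _ _) (sq_nonneg s)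
    rw [hs2] at h1
    rw [mul_one_div, div_le_one hlog] at h1
    rw [← exp_log (show (0:ℝ) < n by linarith), exp_le_exp]; exact h1
  suffices H : ∃ l m, s/3200 ≤ l ∧ Integrable (fun x : Fin n → ℝ => exp (l * |(⨆ i, x i) - m|)) μ ∧
      ∫ x, exp (l * |(⨆ i, x i) - m|) ∂μ ≤ 9 by
    obtain ⟨l, m, hl, hi, hb⟩ := H
    refine (tail_of_exp h.vmax_integrable (by linarith) hi hb t).trans ?_
    gcongr
    have e : -(1/48000) * t / √K = -(s/3200 * t / 15) := by rw [hs]; ring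
    rw [e]
    gcongr
  rcases le_total 6 (s^2) with h6 | h6
  · set m := ∫ x, tmax (s/96) x ∂μ with hm
    have hlow : s/48 ≤ m := h.mean_lower hs0 h6 (by positivity) hsn hse hc
    refine ⟨s/3200, m, le_rfl, h.exp_abs_le (u := s/96) (l0 := s/400) hm.symm (by linarith) (by positivity)
      (by linarith) ?_ (by linarith) ?_⟩
    · nlinarith
    · intro θ hθ
      refine h.exp_tmax_two (ε := ε) (K := K) (by positivity) hε.le hK0 hc ?_
      have h1 : θ^2 ≤ (s/400)^2 := sq_le_sq' (by linarith [abs_le.1 hθ]) (abs_le.1 hθ).2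
      have h2 : 16 / (s/96)^2 = 147456 * K := by
        field_simp; linear_combination (-147456) * hs2
      rw [h2]
      have h3 : ε ≤ K := le_max_left _ _
      calc (ε + K + 147456 * K) * θ^2 ≤ (K + K + 147456 * K) * (s/400)^2 := by gcongr
        _ = 147458/160000 * (s^2 * K) := by ring
        _ ≤ 1 := by rw [hs2]; norm_num
  · set m := ∫ x, tmax 0 x ∂μ with hm
    have hm0 : 0 ≤ m := integral_nonneg fun x => le_max_right _ _
    refine ⟨1/8, m, by nlinarith, h.exp_abs_le (u := 0) (l0 := 1) hm.symm (by linarith) (by positivity)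
      (by linarith) (by linarith) hm0 ?_⟩
    intro θ hθ
    exact h.exp_tmax_one le_rfl (by rw [← sq_abs]; nlinarith [abs_nonneg θ])
end

lemma sgv_of_marginals {Ω : Type} [MeasurableSpace Ω] {P : Measure Ω} [IsProbabilityMeasure P] {n : ℕ}
    {X : Fin n → Ω → ℝ} (hX : ∀ i, Measurable (X i))
    (hg : ∀ a : Fin n → ℝ, ∃ v : NNReal, P.map (fun ω => ∑ i, a i * X i ω) = gaussianReal 0 v)
    (hv : ∀ i, ∫ ω, X i ω ^ 2 ∂P = 1) : SGV (P.map (fun ω i => X i ω)) := by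
  have hm : Measurable (fun ω i => X i ω) := measurable_pi_lambda _ hX
  have key : ∀ L : StrongDual ℝ (Fin n → ℝ), ∃ v : NNReal, (P.map (fun ω i => X i ω)).map L = gaussianReal 0 v := by
    intro L
    obtain ⟨v, hv⟩ := hg (fun i => L (Pi.single i 1))
    refine ⟨v, ?_⟩
    rw [Measure.map_map L.continuous.measurable hm, ← hv]
    congr 1
    ext ω
    have := (L : (Fin n → ℝ) →ₗ[ℝ] ℝ).pi_apply_eq_sum_univ (fun i => X i ω)
    simp only [ContinuousLinearMap.coe_coe, smul_eq_mul] at this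
    simp only [Function.comp]
    rw [this]
    refine Finset.sum_congr rfl fun i _ => ?_
    rw [mul_comm]; congr 2; ext j; simp [Pi.single_apply, eq_comm]
  have hmean : ∀ L : StrongDual ℝ (Fin n → ℝ), ∫ x, L x ∂(P.map (fun ω i => X i ω)) = 0 := by
    intro L
    obtain ⟨v, hv⟩ := key L
    have h1 : ∫ y, y ∂((P.map (fun ω i => X i ω)).map L) = 0 := by rw [hv]; exact integral_id_gaussianReal
    rwa [integral_map L.continuous.measurable.aemeasurable (by fun_prop)] at h1
  refine ⟨?_, hmean, fun i => ?_⟩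
  · refine isGaussian_of_map_eq_gaussianReal fun L => ?_
    obtain ⟨v, hv⟩ := key L
    exact ⟨0, v, hv⟩
  · rw [integral_map hm.aemeasurable (Measurable.aestronglyMeasurable (by fun_prop))]
    exact hv i

theorem small_correlation_gaussian_superconcentration :
    ∃ c : ℝ, 0 < c ∧
      ∀ (Ω : Type) (_ : MeasurableSpace Ω) (P : Measure Ω), IsProbabilityMeasure P →
      ∀ (n : ℕ), 2 ≤ n →
      ∀ (X : Fin n → Ω → ℝ), (∀ i, Measurable (X i)) →
      -- `X` is a centered Gaussian vector: every linear combination is centered Gaussian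
      (∀ a : Fin n → ℝ, ∃ v : NNReal,
        P.map (fun ω => ∑ i, a i * X i ω) = gaussianReal 0 v) →
      -- unit variances
      (∀ i, ∫ ω, X i ω ^ 2 ∂P = 1) →
      ∀ (ε : ℝ), 0 < ε →
      -- small correlations
      (∀ i j, i ≠ j → ∫ ω, X i ω * X j ω ∂P ≤ ε) →
      ∀ t : ℝ, 0 ≤ t →
        (P {ω | t ≤ |(⨆ i, X i ω) - ∫ ω', (⨆ i, X i ω') ∂P|}).toReal ≤
          6 * Real.exp (-c * t / Real.sqrt (max ε (1 / Real.log n))) := by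
  refine ⟨1/48000, by norm_num, ?_⟩
  intro Ω _ P hP n hn X hX hg hv ε hε hc t ht
  have hm : Measurable (fun ω i => X i ω) := measurable_pi_lambda _ hX
  have h := sgv_of_marginals hX hg hv
  have hmain := h.main hn hε (fun i j hij => by
    rw [integral_map hm.aemeasurable (Measurable.aestronglyMeasurable (by fun_prop))]
    exact hc i j hij) ht
  have hvm := vmax_measurable (n := n)
  have e1 : ∫ y, (⨆ i, y i) ∂(P.map (fun ω i => X i ω)) = ∫ ω', (⨆ i, X i ω') ∂P :=
    integral_map hm.aemeasurable hvm.aestronglyMeasurable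
  rw [e1, measureReal_def, Measure.map_apply hm (measurableSet_le measurable_const (by fun_prop))] at hmain
  exact hmain
end

section
/- Let B be an invertible n×n real matrix, Z a standard Gaussian vector on ℝ^n, X = BZ, and let μ denote the law of X. For t ≥ 0 and bounded measurable f : ℝ^n → ℝ define Q_t f(x) = E[f(e^{−t} x + √(1 − e^{−2t}) X)]. Then for all 1 < p ≤ q < ∞ and t ≥ 0 with e^{2t} ≥ (q−1)/(p−1), one has ‖Q_t f‖_{L^q(μ)} ≤ ‖f‖_{L^p(μ)}, i.e. E[|Q_t f(X)|^q]^{1/q} ≤ E[|f(X)|^p]^{1/p}. -/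
open MeasureTheory ProbabilityTheory Real

set_option linter.unusedSectionVars false

lemma hc_bernoulli_neg {a w : ℝ} (ha : a ≤ 0) (hw : -1 < w) :
    1 + a * w ≤ (1 + w) ^ a := by
  have h0 : 0 < 1 + w := by linarith
  have h1 := one_add_mul_self_le_rpow_one_add (s := -w / (1 + w)) (p := 1 - a) (by
    rw [le_div_iff₀ h0]; linarith) (by linarith)
  have h2 : 1 + -w / (1 + w) = (1 + w)⁻¹ := by field_simp; ring
  rw [h2, Real.inv_rpow h0.le, ← Real.rpow_neg h0.le,
    show -(1 - a) = a - 1 by ring, Real.rpow_sub_one h0.ne'] at h1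
  rw [le_div_iff₀ h0] at h1
  have h3 : (1 + (1 - a) * (-w / (1 + w))) * (1 + w) = 1 + a * w := by field_simp; ring
  linarith

lemma hc_hasDeriv {a w : ℝ} (hw : -1 < w) :
    HasDerivAt (fun x : ℝ => (1 + x) ^ a) (a * (1 + w) ^ (a - 1)) w := by
  have h0 : (1 + w) ≠ 0 := by linarith
  have := ((hasDerivAt_id w).const_add 1).rpow_const (p := a) (Or.inl h0)
  simpa using this

lemma hc_taylor {a w : ℝ} (ha : 0 ≤ a) (ha1 : a ≤ 1) (hw : -1 < w) :
    (1 + w) ^ a ≤ 1 + a * w - a * (1 - a) / 2 * w ^ 2 + a * (1 - a) * (2 - a) / 6 * w ^ 3 := by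
  set q : ℝ → ℝ := fun x => 1 - (1 - a) * x + (1 - a) * (2 - a) / 2 * x ^ 2 - (1 + x) ^ (a - 1)
    with hq
  have hqd : ∀ x, -1 < x → HasDerivAt q
      (- (1 - a) + (1 - a) * (2 - a) * x - (a - 1) * (1 + x) ^ (a - 1 - 1)) x := by
    intro x hx
    have h1 := (((hasDerivAt_const x (1:ℝ)).sub ((hasDerivAt_id x).const_mul (1 - a))).add
      (((hasDerivAt_id x).pow 2).const_mul ((1 - a) * (2 - a) / 2))).sub
      (hc_hasDeriv (a := a - 1) hx)
    refine HasDerivAt.congr_deriv (f := q) h1 ?_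
    simp; ring
  have hqm : MonotoneOn q (Set.Ioi (-1)) := by
    apply monotoneOn_of_deriv_nonneg (convex_Ioi _)
    · intro x hx; exact (hqd x hx).continuousAt.continuousWithinAt
    · intro x hx; rw [interior_Ioi] at hx
      exact (hqd x hx).differentiableAt.differentiableWithinAt
    · intro x hx; rw [interior_Ioi] at hx
      rw [(hqd x hx).deriv]
      have := hc_bernoulli_neg (a := a - 1 - 1) (by linarith) hx
      nlinarith [mul_le_mul_of_nonneg_left this (by linarith : 0 ≤ 1 - a)]
  have hq0 : q 0 = 0 := by simp [hq]
  set g : ℝ → ℝ := fun x => 1 + a * x - a * (1 - a) / 2 * x ^ 2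
    + a * (1 - a) * (2 - a) / 6 * x ^ 3 - (1 + x) ^ a with hg
  have hgd : ∀ x, -1 < x → HasDerivAt g (a * q x) x := by
    intro x hx
    have h1 := ((((hasDerivAt_const x (1:ℝ)).add ((hasDerivAt_id x).const_mul a)).sub
      (((hasDerivAt_id x).pow 2).const_mul (a * (1 - a) / 2))).add
      (((hasDerivAt_id x).pow 3).const_mul (a * (1 - a) * (2 - a) / 6))).sub
      (hc_hasDeriv (a := a) hx)
    refine HasDerivAt.congr_deriv (f := g) h1 ?_
    simp [hq]; ring
  have hg0 : g 0 = 0 := by simp [hg]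
  suffices 0 ≤ g w by simp only [hg] at this; linarith
  rcases le_total 0 w with h | h
  · have : MonotoneOn g (Set.Ici 0) := by
      apply monotoneOn_of_deriv_nonneg (convex_Ici _)
      · intro x hx
        exact (hgd x (by linarith [Set.mem_Ici.1 hx])).continuousAt.continuousWithinAt
      · intro x hx; rw [interior_Ici] at hx
        exact (hgd x (by linarith [Set.mem_Ioi.1 hx])).differentiableAt.differentiableWithinAt
      · intro x hx; rw [interior_Ici] at hx
        have hx' := Set.mem_Ioi.1 hx
        rw [(hgd x (by linarith)).deriv]
        have := hqm (a := 0) (b := x) (by simp) (by simp; linarith) hx'.le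
        rw [hq0] at this; positivity
    have := this (a := 0) (b := w) (by simp) (by simpa using h) h
    linarith
  · have : AntitoneOn g (Set.Ioc (-1) 0) := by
      apply antitoneOn_of_deriv_nonpos (convex_Ioc _ _)
      · intro x hx
        exact (hgd x hx.1).continuousAt.continuousWithinAt
      · intro x hx; rw [interior_Ioc] at hx
        exact (hgd x hx.1).differentiableAt.differentiableWithinAt
      · intro x hx; rw [interior_Ioc] at hx
        rw [(hgd x hx.1).deriv]
        have := hqm (a := x) (b := 0) (by simpa using hx.1) (by simp) hx.2.le
        rw [hq0] at this; exact mul_nonpos_of_nonneg_of_nonpos ha this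
    have := this (a := w) (b := 0) ⟨hw, h⟩ (by simp) h
    linarith

lemma hc_mono_bound {k s w z : ℝ} (hk : |k| ≤ 1) (i j : ℕ) (hw : |w| ≤ s) (hz : |z| ≤ s) :
    k * (w ^ i * z ^ j) ≤ s ^ (i + j) := by
  have hs : 0 ≤ s := (abs_nonneg _).trans hw
  calc k * (w ^ i * z ^ j) ≤ |k * (w ^ i * z ^ j)| := le_abs_self _
    _ = |k| * (|w| ^ i * |z| ^ j) := by rw [abs_mul, abs_mul, abs_pow, abs_pow]
    _ ≤ 1 * (s ^ i * s ^ j) := by gcongr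
    _ = _ := by rw [one_mul, pow_add]

lemma hc_alg {a b w z α β κ τ : ℝ} (ha : 0 ≤ a) (ha1 : a ≤ 1) (hb : 0 ≤ b) (hb1 : b ≤ 1)
    (hκ : 0 ≤ κ) (hτ : 0 ≤ τ)
    (hw : |w| ≤ κ * τ) (hz : |z| ≤ κ * τ) (hα : |α| ≤ κ * τ) (hβ : |β| ≤ κ * τ)
    (hwα : |w - α| ≤ κ * τ ^ 2) (hzβ : |z - β| ≤ κ * τ ^ 2) :
    (1 + a * w - a * (1 - a) / 2 * w ^ 2 + a * (1 - a) * (2 - a) / 6 * w ^ 3) *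
    (1 + b * z - b * (1 - b) / 2 * z ^ 2 + b * (1 - b) * (2 - b) / 6 * z ^ 3) ≤
    1 + a * w + b * z + (-(a * (1 - a)) * α ^ 2 + 2 * a * b * (α * β) - b * (1 - b) * β ^ 2) / 2
      + (10 * (κ * τ) ^ 3 * (1 + κ * τ) ^ 3 + 6 * κ ^ 2 * τ ^ 3) := by
  set s := κ * τ with hs
  have hs0 : 0 ≤ s := by positivity
  set a2 := a * (1 - a) / 2 with ha2
  set b2 := b * (1 - b) / 2 with hb2
  set a3 := a * (1 - a) * (2 - a) / 6 with ha3
  set b3 := b * (1 - b) * (2 - b) / 6 with hb3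
  have A : |a| ≤ 1 := abs_le.2 ⟨by linarith, ha1⟩
  have B : |b| ≤ 1 := abs_le.2 ⟨by linarith, hb1⟩
  have A2 : |a2| ≤ 1 := abs_le.2 ⟨by nlinarith, by nlinarith⟩
  have B2 : |b2| ≤ 1 := abs_le.2 ⟨by nlinarith, by nlinarith⟩
  have e3 : ∀ x : ℝ, 0 ≤ x → x ≤ 1 → |x * (1 - x) * (2 - x) / 6| ≤ 1 := by
    intro x h0 h1
    have h2 : 0 ≤ x * (1 - x) := mul_nonneg h0 (by linarith)
    have h3 : x * (1 - x) ≤ 1 := by nlinarith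
    exact abs_le.2 ⟨by nlinarith, by nlinarith⟩
  have A3 : |a3| ≤ 1 := e3 a ha ha1
  have B3 : |b3| ≤ 1 := e3 b hb hb1
  have mm : ∀ {x y : ℝ}, |x| ≤ 1 → |y| ≤ 1 → |x * y| ≤ 1 := by
    intro x y hx hy; rw [abs_mul]; exact mul_le_one₀ hx (abs_nonneg _) hy
  have nn : ∀ {x : ℝ}, |x| ≤ 1 → |-x| ≤ 1 := by intro x hx; rwa [abs_neg]
  have t1 := hc_mono_bound A3 3 0 hw hz
  have t2 := hc_mono_bound B3 0 3 hw hz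
  have t3 := hc_mono_bound (nn (mm A B2)) 1 2 hw hz
  have t4 := hc_mono_bound (nn (mm A2 B)) 2 1 hw hz
  have t5 := hc_mono_bound (mm A B3) 1 3 hw hz
  have t6 := hc_mono_bound (mm A3 B) 3 1 hw hz
  have t7 := hc_mono_bound (mm A2 B2) 2 2 hw hz
  have t8 := hc_mono_bound (nn (mm A2 B3)) 2 3 hw hz
  have t9 := hc_mono_bound (nn (mm A3 B2)) 3 2 hw hz
  have t10 := hc_mono_bound (mm A3 B3) 3 3 hw hz
  have d1 : |w ^ 2 - α ^ 2| ≤ (κ * τ ^ 2) * (2 * s) := by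
    rw [show w ^ 2 - α ^ 2 = (w - α) * (w + α) by ring, abs_mul]
    gcongr; exact (abs_add_le _ _).trans (by linarith)
  have d2 : |z ^ 2 - β ^ 2| ≤ (κ * τ ^ 2) * (2 * s) := by
    rw [show z ^ 2 - β ^ 2 = (z - β) * (z + β) by ring, abs_mul]
    gcongr; exact (abs_add_le _ _).trans (by linarith)
  have d3 : |w * z - α * β| ≤ (κ * τ ^ 2) * (2 * s) := by
    rw [show w * z - α * β = (w - α) * z + (z - β) * α by ring]
    refine (abs_add_le _ _).trans ?_
    rw [abs_mul, abs_mul]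
    have := mul_le_mul hwα hz (abs_nonneg _) (by positivity)
    have := mul_le_mul hzβ hα (abs_nonneg _) (by positivity)
    linarith
  have f : ∀ {k x r : ℝ}, |k| ≤ 1 → |x| ≤ r → k * x ≤ r := by
    intro k x r hk hx
    calc k * x ≤ |k * x| := le_abs_self _
      _ = |k| * |x| := abs_mul _ _
      _ ≤ 1 * r := by gcongr
      _ = r := one_mul r
  have f1 := f (nn A2) d1
  have f2 := f (nn B2) d2
  have f3 := f (mm A B) d3
  have e : (κ * τ ^ 2) * (2 * s) = 2 * κ ^ 2 * τ ^ 3 := by rw [hs]; ring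
  rw [e] at f1 f2 f3
  have h3 : s ^ 3 * (1 + s) ^ 3 = s ^ 3 + 3 * s ^ 4 + 3 * s ^ 5 + s ^ 6 := by ring
  have p3 : 0 ≤ s ^ 3 := by positivity
  have p4 : 0 ≤ s ^ 4 := by positivity
  have p5 : 0 ≤ s ^ 5 := by positivity
  have p6 : 0 ≤ s ^ 6 := by positivity
  have i1 : a * (1 - a) = 2 * a2 := by rw [ha2]; ring
  have i2 : b * (1 - b) = 2 * b2 := by rw [hb2]; ring
  rw [i1, i2]
  norm_num at t1 t2 t3 t4 t5 t6 t7 t8 t9 t10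
  rw [show 10 * s ^ 3 * (1 + s) ^ 3 = 10 * (s ^ 3 * (1 + s) ^ 3) by ring, h3]
  clear_value a2 b2 a3 b3 s
  linarith


structure HcNice {E : Type*} [NormedAddCommGroup E] [NormedSpace ℝ E] [MeasurableSpace E]
    (c C L M : ℝ) (F : E → ℝ) (D : E → E →L[ℝ] ℝ) : Prop where
  smF : StronglyMeasurable F
  smD : StronglyMeasurable D
  lb : ∀ x, c ≤ F x
  ub : ∀ x, F x ≤ C
  Dle : ∀ x, ‖D x‖ ≤ L
  tay : ∀ x h, |F (x + h) - F x - D x h| ≤ M * ‖h‖ ^ 2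

section
variable {E : Type*} [NormedAddCommGroup E] [NormedSpace ℝ E] [SecondCountableTopology E]
  [MeasurableSpace E] [BorelSpace E]

lemma HcNice.intF {c C L M : ℝ} {F : E → ℝ} {D : E → E →L[ℝ] ℝ} (h : HcNice c C L M F D)
    {Ω : Type*} [MeasurableSpace Ω] (m : Measure Ω) [IsFiniteMeasure m] {φ : Ω → E}
    (hφ : Measurable φ) : Integrable (fun ω => F (φ ω)) m := by
  refine Integrable.of_bound (C := max |c| |C|) (h.smF.comp_measurable hφ).aestronglyMeasurable ?_
  exact Filter.Eventually.of_forall fun ω => abs_le_max_abs_abs (h.lb _) (h.ub _)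

lemma HcNice.intD {c C L M : ℝ} {F : E → ℝ} {D : E → E →L[ℝ] ℝ} (h : HcNice c C L M F D)
    {Ω : Type*} [MeasurableSpace Ω] (m : Measure Ω) [IsFiniteMeasure m] {φ : Ω → E}
    (hφ : Measurable φ) : Integrable (fun ω => D (φ ω)) m := by
  refine Integrable.of_bound (C := L) (h.smD.comp_measurable hφ).aestronglyMeasurable ?_
  exact Filter.Eventually.of_forall fun ω => h.Dle _

lemma HcNice.avg {c C L M : ℝ} {F : E → ℝ} {D : E → E →L[ℝ] ℝ} (h : HcNice c C L M F D)
    (γ : Measure E) [IsProbabilityMeasure γ] (s : ℝ) :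
    HcNice c C L M (fun x => ∫ g, F (x + s • g) ∂γ) (fun x => ∫ g, D (x + s • g) ∂γ) where
  smF := by
    apply StronglyMeasurable.integral_prod_right
    exact h.smF.comp_measurable (by fun_prop)
  smD := by
    apply StronglyMeasurable.integral_prod_right
    exact h.smD.comp_measurable (by fun_prop)
  lb x := by
    have := integral_mono (integrable_const c) (h.intF γ (φ := fun g => x + s • g) (by fun_prop))
      (fun g => h.lb _)
    simpa using this
  ub x := by
    have := integral_mono (h.intF γ (φ := fun g => x + s • g) (by fun_prop)) (integrable_const C)
      (fun g => h.ub _)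
    simpa using this
  Dle x := by
    have := norm_integral_le_of_norm_le_const (μ := γ) (C := L) (f := fun g => D (x + s • g))
      (Filter.Eventually.of_forall fun g => h.Dle _)
    simpa using this
  tay x k := by
    have i1 := h.intF γ (φ := fun g => x + k + s • g) (by fun_prop)
    have i2 := h.intF γ (φ := fun g => x + s • g) (by fun_prop)
    have i3 := h.intD γ (φ := fun g => x + s • g) (by fun_prop)
    have i4 : Integrable (fun g => D (x + s • g) k) γ := i3.apply_continuousLinearMap k
    have i12 : Integrable (fun g => F (x + k + s • g) - F (x + s • g)) γ := i1.sub i2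
    rw [ContinuousLinearMap.integral_apply i3, ← integral_sub i1 i2, ← integral_sub i12 i4]
    have := norm_integral_le_of_norm_le_const (μ := γ) (C := M * ‖k‖ ^ 2)
      (f := fun g => F (x + k + s • g) - F (x + s • g) - D (x + s • g) k)
      (Filter.Eventually.of_forall fun g => by
        have := h.tay (x + s • g) k
        rw [Real.norm_eq_abs]
        rwa [show x + s • g + k = x + k + s • g by abel] at this)
    simpa using this

/-- remainder estimates -/
lemma HcNice.rem {c C L M : ℝ} {F : E → ℝ} {D : E → E →L[ℝ] ℝ} (h : HcNice c C L M F D)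
    (hc : 0 < c) (hM : 0 ≤ M) (hL : 0 ≤ L)
    (γ : Measure E) [IsProbabilityMeasure γ]
    (hcen : ∀ ℓ : E →L[ℝ] ℝ, ∫ g, ℓ g ∂γ = 0)
    (hint : ∀ ℓ : E →L[ℝ] ℝ, Integrable (fun g => ℓ g) γ)
    (hint2 : Integrable (fun g => ‖g‖ ^ 2) γ)
    {m2 : ℝ} (hm2 : m2 = ∫ g, ‖g‖ ^ 2 ∂γ)
    {δ : ℝ} (hδ : 0 ≤ δ) (hδ1 : δ ≤ 1) (x g : E) {ξ : ℝ} (hξ : 1 + ‖g‖ + m2 ≤ ξ)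
    {u₀ : ℝ} (hu₀ : u₀ = ∫ g, F (x + δ • g) ∂γ) :
    |(F (x + δ • g) - u₀) / u₀ - δ / u₀ * D x g| ≤ (L + M) / c * (δ * ξ ^ 2) ^ 2 ∧
    |δ / u₀ * D x g| ≤ (L + M) / c * (δ * ξ ^ 2) ∧
    |(F (x + δ • g) - u₀) / u₀| ≤ (L + M) / c * (δ * ξ ^ 2) := by
  have hm0 : 0 ≤ m2 := by rw [hm2]; positivity
  have hu : c ≤ u₀ := by rw [hu₀]; exact (h.avg γ δ).lb x
  have hup : 0 < u₀ := hc.trans_le hu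
  have hg0 := norm_nonneg g
  have hξ1 : 1 ≤ ξ := by linarith
  have hξ2 : ξ ≤ ξ ^ 2 := by nlinarith
  have r1 : |u₀ - F x| ≤ M * δ ^ 2 * m2 := by
    have i1 := h.intF γ (φ := fun g => x + δ • g) (by fun_prop)
    have e : u₀ - F x = ∫ g, (F (x + δ • g) - F x - δ * D x g) ∂γ := by
      have i2 : Integrable (fun g => F (x + δ • g) - F x) γ := i1.sub (integrable_const _)
      have i3 : Integrable (fun g => δ * D x g) γ := (hint _).const_mul _
      rw [integral_sub i2 i3,
        integral_sub i1 (integrable_const _), integral_const_mul, hcen, hu₀]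
      simp
    have := norm_integral_le_of_norm_le (μ := γ) (g := fun g => M * δ ^ 2 * ‖g‖ ^ 2)
      (f := fun g => F (x + δ • g) - F x - δ * D x g) (hint2.const_mul _)
      (Filter.Eventually.of_forall fun g => by
        have := h.tay x (δ • g)
        rw [map_smul, smul_eq_mul, norm_smul, Real.norm_eq_abs, abs_of_nonneg hδ] at this
        rw [Real.norm_eq_abs]
        exact this.trans_eq (by ring))
    rw [integral_const_mul, ← hm2] at this
    rw [e]; exact this
  have r2 : |F (x + δ • g) - F x - δ * D x g| ≤ M * δ ^ 2 * ‖g‖ ^ 2 := by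
    have := h.tay x (δ • g)
    rw [map_smul, smul_eq_mul, norm_smul, Real.norm_eq_abs, abs_of_nonneg hδ] at this
    exact this.trans_eq (by ring)
  have hR : |F (x + δ • g) - u₀ - δ * D x g| ≤ M * δ ^ 2 * ξ ^ 2 := by
    have e : F (x + δ • g) - u₀ - δ * D x g
        = (F (x + δ • g) - F x - δ * D x g) - (u₀ - F x) := by ring
    rw [e]
    refine (abs_sub _ _).trans ?_
    have : ‖g‖ ^ 2 + m2 ≤ ξ ^ 2 := by nlinarith
    have := mul_le_mul_of_nonneg_left this (by positivity : 0 ≤ M * δ ^ 2)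
    linarith
  have hDg : |δ * D x g| ≤ L * δ * ξ := by
    rw [abs_mul, abs_of_nonneg hδ]
    have : |D x g| ≤ L * ξ := by
      have h1 := (D x).le_opNorm g
      rw [Real.norm_eq_abs] at h1
      exact h1.trans (mul_le_mul (h.Dle x) (by linarith) hg0 hL)
    nlinarith
  have hU : |F (x + δ • g) - u₀| ≤ (L + M) * (δ * ξ ^ 2) := by
    have e : F (x + δ • g) - u₀ = (F (x + δ • g) - u₀ - δ * D x g) + δ * D x g := by ring
    rw [e]
    refine (abs_add_le _ _).trans ?_
    have h1 : M * δ ^ 2 * ξ ^ 2 ≤ M * δ * ξ ^ 2 := by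
      gcongr; nlinarith
    have h2 : L * δ * ξ ≤ L * δ * ξ ^ 2 := by gcongr
    linarith
  have key : ∀ y K : ℝ, |y| ≤ K → |y / u₀| ≤ K / c := by
    intro y K hy
    rw [abs_div, abs_of_pos hup]
    exact div_le_div₀ ((abs_nonneg _).trans hy) hy hc hu
  refine ⟨?_, ?_, ?_⟩
  · have := key _ _ hR
    rw [show (F (x + δ • g) - u₀) / u₀ - δ / u₀ * D x g
      = (F (x + δ • g) - u₀ - δ * D x g) / u₀ by ring]
    refine this.trans ?_
    rw [div_mul_eq_mul_div]
    refine div_le_div_of_nonneg_right ?_ hc.le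
    have : ξ ^ 2 ≤ ξ ^ 4 := by nlinarith [sq_nonneg ξ, sq_nonneg (ξ^2)]
    calc M * δ ^ 2 * ξ ^ 2 ≤ (L + M) * δ ^ 2 * ξ ^ 4 := by gcongr; linarith
      _ = _ := by ring
  · have := key _ _ hDg
    rw [show δ / u₀ * D x g = (δ * D x g) / u₀ by ring]
    refine this.trans ?_
    rw [div_mul_eq_mul_div]
    refine div_le_div_of_nonneg_right ?_ hc.le
    calc L * δ * ξ ≤ (L + M) * δ * ξ ^ 2 := by gcongr; linarith
      _ = _ := by ring
  · refine (key _ _ hU).trans_eq ?_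
    ring
end


structure HcPair {E : Type*} [NormedAddCommGroup E] [NormedSpace ℝ E] [MeasurableSpace E]
    (γ : Measure E) (ν : Measure (E × E)) (a b : ℝ) : Prop where
  cen : ∀ ℓ : E →L[ℝ] ℝ, ∫ g, ℓ g ∂γ = 0
  fst : ν.map Prod.fst = γ
  snd : ν.map Prod.snd = γ
  mom : ∀ k : ℕ, Integrable (fun w => ‖w‖ ^ k) ν
  quad : ∀ ℓ m : E →L[ℝ] ℝ, ∫ w, (-(a * (1 - a)) * (ℓ w.1) ^ 2 + 2 * a * b * (ℓ w.1 * m w.2)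
    - b * (1 - b) * (m w.2) ^ 2) ∂ν ≤ 0
  rot : ∀ s s' : ℝ, (ν.prod ν).map (fun p => s • p.1 + s' • p.2)
    = ν.map (fun w => √(s ^ 2 + s' ^ 2) • w)
  rotγ : ∀ s s' : ℝ, (γ.prod γ).map (fun p => s • p.1 + s' • p.2)
    = γ.map (fun w => √(s ^ 2 + s' ^ 2) • w)

section
variable {E : Type*} [NormedAddCommGroup E] [NormedSpace ℝ E] [SecondCountableTopology E]
  [MeasurableSpace E] [BorelSpace E]

lemma hc_err {κ δ ξ : ℝ} (hκ0 : 0 ≤ κ) (hδ : 0 ≤ δ) (hδ1 : δ ≤ 1) (hξ1 : 1 ≤ ξ) :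
    10 * (κ * (δ * ξ ^ 2)) ^ 3 * (1 + κ * (δ * ξ ^ 2)) ^ 3
        + 6 * κ ^ 2 * (δ * ξ ^ 2) ^ 3
    ≤ (10 * κ ^ 3 * (1 + κ) ^ 3 + 6 * κ ^ 2) * δ ^ 3 * ξ ^ 12 := by
  have hξ0 : 0 ≤ ξ := by linarith
  have e1 : 1 + κ * (δ * ξ ^ 2) ≤ (1 + κ) * ξ ^ 2 := by
    have h1 : 1 ≤ ξ ^ 2 := by nlinarith
    have h2 : κ * (δ * ξ ^ 2) ≤ κ * (1 * ξ ^ 2) := by gcongr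
    linarith
  have e2 : ξ ^ 6 ≤ ξ ^ 12 := pow_le_pow_right₀ hξ1 (by norm_num)
  calc _ ≤ 10 * (κ * (δ * ξ ^ 2)) ^ 3 * ((1 + κ) * ξ ^ 2) ^ 3
    + 6 * κ ^ 2 * (δ * ξ ^ 2) ^ 3 := by gcongr
    _ = 10 * κ ^ 3 * (1 + κ) ^ 3 * δ ^ 3 * ξ ^ 12 + 6 * κ ^ 2 * δ ^ 3 * ξ ^ 6 := by ring
    _ ≤ 10 * κ ^ 3 * (1 + κ) ^ 3 * δ ^ 3 * ξ ^ 12 + 6 * κ ^ 2 * δ ^ 3 * ξ ^ 12 := by gcongr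
    _ = _ := by ring

lemma hc_pw {a b u v f g α β κ δ ξ : ℝ} (ha : 0 ≤ a) (ha1 : a ≤ 1) (hb : 0 ≤ b) (hb1 : b ≤ 1)
    (hu : 0 < u) (hv : 0 < v) (hf : 0 < f) (hg : 0 < g) (hκ0 : 0 ≤ κ) (hδ : 0 ≤ δ) (hδ1 : δ ≤ 1)
    (hξ1 : 1 ≤ ξ)
    (r1 : |(f - u) / u - α| ≤ κ * (δ * ξ ^ 2) ^ 2) (r2 : |α| ≤ κ * (δ * ξ ^ 2))
    (r3 : |(f - u) / u| ≤ κ * (δ * ξ ^ 2))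
    (s1 : |(g - v) / v - β| ≤ κ * (δ * ξ ^ 2) ^ 2) (s2 : |β| ≤ κ * (δ * ξ ^ 2))
    (s3 : |(g - v) / v| ≤ κ * (δ * ξ ^ 2)) :
    f ^ a * g ^ b ≤ u ^ a * v ^ b * (1 + a * ((f - u) / u) + b * ((g - v) / v)
      + (-(a * (1 - a)) * α ^ 2 + 2 * a * b * (α * β) - b * (1 - b) * β ^ 2) / 2
      + (10 * κ ^ 3 * (1 + κ) ^ 3 + 6 * κ ^ 2) * δ ^ 3 * ξ ^ 12) := by
  have alg := hc_alg ha ha1 hb hb1 hκ0 (by positivity : 0 ≤ δ * ξ ^ 2) r3 s3 r2 s2 r1 s1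
  have err := hc_err hκ0 hδ hδ1 hξ1
  have eF : f = u * (1 + (f - u) / u) := by field_simp; ring
  have eG : g = v * (1 + (g - v) / v) := by field_simp; ring
  generalize (f - u) / u = W at *
  generalize (g - v) / v = Z at *
  have hW1 : 0 < 1 + W := by rw [eF] at hf; exact pos_of_mul_pos_right hf hu.le
  have hZ1 : 0 < 1 + Z := by rw [eG] at hg; exact pos_of_mul_pos_right hg hv.le
  rw [eF, eG, Real.mul_rpow hu.le hW1.le, Real.mul_rpow hv.le hZ1.le]
  have tW := hc_taylor ha ha1 (w := W) (by linarith)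
  have tZ := hc_taylor hb hb1 (w := Z) (by linarith)
  have tWZ := mul_le_mul tW tZ (by positivity) ((by positivity : 0 ≤ (1 + W) ^ a).trans tW)
  calc _ = u ^ a * v ^ b * ((1 + W) ^ a * (1 + Z) ^ b) := by ring
    _ ≤ _ := by
      refine mul_le_mul_of_nonneg_left ?_ (by positivity)
      refine tWZ.trans (alg.trans ?_)
      linarith

lemma HcNice.rpow_int {c C L M c' C' L' M' : ℝ} {F G : E → ℝ} {D D' : E → E →L[ℝ] ℝ}
    (hF : HcNice c C L M F D) (hG : HcNice c' C' L' M' G D') (hc : 0 < c) (hc' : 0 < c')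
    {a b : ℝ} (ha : 0 ≤ a) (hb : 0 ≤ b)
    {Ω : Type*} [MeasurableSpace Ω] (m : Measure Ω) [IsFiniteMeasure m] {φ ψ : Ω → E}
    (hφ : Measurable φ) (hψ : Measurable ψ) :
    Integrable (fun ω => F (φ ω) ^ a * G (ψ ω) ^ b) m := by
  refine Integrable.of_bound (C := C ^ a * C' ^ b) ?_ ?_
  · exact (((hF.smF.measurable.comp hφ).pow_const a).mul
      ((hG.smF.measurable.comp hψ).pow_const b)).aestronglyMeasurable
  · refine Filter.Eventually.of_forall fun ω => ?_
    have h1 := hc.le.trans (hF.lb (φ ω))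
    have h2 := hc'.le.trans (hG.lb (ψ ω))
    rw [Real.norm_eq_abs, abs_of_nonneg (by positivity)]
    have := h1.trans (hF.ub (φ ω))
    have := h2.trans (hG.ub (ψ ω))
    gcongr
    · exact hF.ub _
    · exact hG.ub _

set_option maxHeartbeats 1000000 in
lemma hc_onestep {γ : Measure E} {ν : Measure (E × E)} [IsProbabilityMeasure γ]
    [IsProbabilityMeasure ν] {a b : ℝ}
    (h : HcPair γ ν a b) (ha : 0 ≤ a) (ha1 : a ≤ 1) (hb : 0 ≤ b) (hb1 : b ≤ 1)
    {c C L M : ℝ} (hc : 0 < c) (hcC : c ≤ C) (hL : 0 ≤ L) (hM : 0 ≤ M) :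
    ∃ K : ℝ, 0 ≤ K ∧ ∀ (F G : E → ℝ) (D D' : E → E →L[ℝ] ℝ), HcNice c C L M F D →
      HcNice c C L M G D' → ∀ δ : ℝ, 0 ≤ δ → δ ≤ 1 → ∀ x y : E,
      ∫ w, F (x + δ • w.1) ^ a * G (y + δ • w.2) ^ b ∂ν ≤
      (∫ g, F (x + δ • g) ∂γ) ^ a * (∫ g, G (y + δ • g) ∂γ) ^ b + K * δ ^ 3 := by
  set m2 := ∫ g, ‖g‖ ^ 2 ∂γ with hm2
  have hm0 : 0 ≤ m2 := by rw [hm2]; positivity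
  set κ := (L + M) / c with hκ
  have hκ0 : 0 ≤ κ := by positivity
  set K1 := 10 * κ ^ 3 * (1 + κ) ^ 3 + 6 * κ ^ 2 with hK1
  have hK10 : 0 ≤ K1 := by positivity
  set ξ : E × E → ℝ := fun w => 1 + ‖w‖ + m2 with hξ
  have mpf : MeasurePreserving (Prod.fst : E × E → E) ν γ := ⟨measurable_fst, h.fst⟩
  have mps : MeasurePreserving (Prod.snd : E × E → E) ν γ := ⟨measurable_snd, h.snd⟩
  have hξi : Integrable (fun w => ξ w ^ 12) ν := by
    have : Integrable (fun w : E × E => (2:ℝ) ^ 11 * ((1 + m2) ^ 12 + ‖w‖ ^ 12)) ν :=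
      ((integrable_const _).add (h.mom 12)).const_mul _
    refine this.mono' (by simp only [hξ]; fun_prop) (Filter.Eventually.of_forall fun w => ?_)
    have hw := norm_nonneg w
    rw [Real.norm_eq_abs, abs_of_nonneg (by positivity)]
    have := add_pow_le (a := 1 + m2) (b := ‖w‖) (by positivity) hw 12
    simp only [hξ]
    rw [show 1 + ‖w‖ + m2 = 1 + m2 + ‖w‖ by ring]
    exact this
  have n1 : Integrable (fun w : E × E => ‖w‖ ^ 2) ν := h.mom 2
  have hint2 : Integrable (fun g => ‖g‖ ^ 2) γ := by
    rw [← mpf.integrable_comp (by fun_prop)]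
    refine n1.mono' (by fun_prop) (Filter.Eventually.of_forall fun w => ?_)
    simp only [Function.comp, norm_pow, norm_norm]
    gcongr; exact norm_fst_le w
  have hint1 : Integrable (fun g => ‖g‖) γ := by
    refine ((integrable_const (1:ℝ)).add hint2).mono' (by fun_prop)
      (Filter.Eventually.of_forall fun w => ?_)
    simp only [norm_norm, Pi.add_apply]
    nlinarith [sq_nonneg (‖w‖ - 1)]
  have hint : ∀ ℓ : E →L[ℝ] ℝ, Integrable (fun g => ℓ g) γ := by
    intro ℓ
    exact (hint1.const_mul ‖ℓ‖).mono' (by fun_prop)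
      (Filter.Eventually.of_forall fun w => ℓ.le_opNorm w)
  refine ⟨C ^ a * C ^ b * (K1 * ∫ w, ξ w ^ 12 ∂ν), ?_, ?_⟩
  · have : 0 ≤ C := hc.le.trans hcC
    have : 0 ≤ ∫ w, ξ w ^ 12 ∂ν := integral_nonneg fun w => by positivity
    positivity
  intro F G D D' hF hG δ hδ hδ1 x y
  set u₀ := ∫ g, F (x + δ • g) ∂γ with hu₀
  set v₀ := ∫ g, G (y + δ • g) ∂γ with hv₀
  have hu : c ≤ u₀ := (hF.avg γ δ).lb x
  have hv : c ≤ v₀ := (hG.avg γ δ).lb y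
  have huC : u₀ ≤ C := (hF.avg γ δ).ub x
  have hvC : v₀ ≤ C := (hG.avg γ δ).ub y
  have hup : 0 < u₀ := hc.trans_le hu
  have hvp : 0 < v₀ := hc.trans_le hv
  set W : E × E → ℝ := fun w => (F (x + δ • w.1) - u₀) / u₀ with hW
  set Z : E × E → ℝ := fun w => (G (y + δ • w.2) - v₀) / v₀ with hZ
  set ℓ : E →L[ℝ] ℝ := (δ / u₀) • D x with hℓ
  set m : E →L[ℝ] ℝ := (δ / v₀) • D' y with hm
  set Q : E × E → ℝ := fun w => -(a * (1 - a)) * (ℓ w.1) ^ 2 + 2 * a * b * (ℓ w.1 * m w.2)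
    - b * (1 - b) * (m w.2) ^ 2 with hQ
  have pw : ∀ w, F (x + δ • w.1) ^ a * G (y + δ • w.2) ^ b ≤
      u₀ ^ a * v₀ ^ b * (1 + a * W w + b * Z w + Q w / 2 + K1 * δ ^ 3 * ξ w ^ 12) := by
    intro w
    have hw1 := norm_fst_le w
    have hw2 := norm_snd_le w
    have hw0 := norm_nonneg w
    obtain ⟨r1, r2, r3⟩ := hF.rem hc hM hL γ h.cen hint hint2 hm2 hδ hδ1 x w.1 (ξ := ξ w)
      (by simp only [hξ]; linarith) hu₀
    obtain ⟨s1, s2, s3⟩ := hG.rem hc hM hL γ h.cen hint hint2 hm2 hδ hδ1 y w.2 (ξ := ξ w)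
      (by simp only [hξ]; linarith) hv₀
    exact hc_pw ha ha1 hb hb1 hup hvp (hc.trans_le (hF.lb _)) (hc.trans_le (hG.lb _)) hκ0 hδ hδ1
      (by simp only [hξ]; linarith) r1 r2 r3 s1 s2 s3
  have iW : Integrable W ν :=
    ((hF.intF ν (φ := fun w : E × E => x + δ • w.1) (by fun_prop)).sub (integrable_const _)).div_const _
  have iZ : Integrable Z ν :=
    ((hG.intF ν (φ := fun w : E × E => y + δ • w.2) (by fun_prop)).sub (integrable_const _)).div_const _
  have iQ : Integrable Q ν := by
    have bd : ∀ (l k : E →L[ℝ] ℝ) (w : E × E) (g g' : E), ‖g‖ ≤ ‖w‖ → ‖g'‖ ≤ ‖w‖ →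
        ‖l g * k g'‖ ≤ ‖l‖ * ‖k‖ * ‖w‖ ^ 2 := by
      intro l k w g g' h1 h2
      rw [norm_mul]
      calc ‖l g‖ * ‖k g'‖ ≤ (‖l‖ * ‖w‖) * (‖k‖ * ‖w‖) := by
            gcongr
            · exact l.le_opNorm_of_le h1
            · exact k.le_opNorm_of_le h2
        _ = _ := by ring
    have q1 : Integrable (fun w : E × E => ℓ w.1 * ℓ w.1) ν :=
      (n1.const_mul (‖ℓ‖ * ‖ℓ‖)).mono' (by fun_prop) (Filter.Eventually.of_forall fun w =>
        bd _ _ w _ _ (norm_fst_le w) (norm_fst_le w))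
    have q2 : Integrable (fun w : E × E => ℓ w.1 * m w.2) ν :=
      (n1.const_mul (‖ℓ‖ * ‖m‖)).mono' (by fun_prop) (Filter.Eventually.of_forall fun w =>
        bd _ _ w _ _ (norm_fst_le w) (norm_snd_le w))
    have q3 : Integrable (fun w : E × E => m w.2 * m w.2) ν :=
      (n1.const_mul (‖m‖ * ‖m‖)).mono' (by fun_prop) (Filter.Eventually.of_forall fun w =>
        bd _ _ w _ _ (norm_snd_le w) (norm_snd_le w))
    simp only [hQ, pow_two]
    exact ((q1.const_mul _).add (q2.const_mul _)).sub (q3.const_mul _)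
  have eW : ∫ w, W w ∂ν = 0 := by
    have e1 : ∫ w, F (x + δ • w.1) ∂ν = u₀ := by
      rw [hu₀, ← h.fst, integral_map (by fun_prop)]
      exact (hF.smF.comp_measurable (by fun_prop)).aestronglyMeasurable
    simp only [hW]
    rw [integral_div, integral_sub (hF.intF ν (φ := fun w : E × E => x + δ • w.1) (by fun_prop))
      (integrable_const _), e1]
    simp
  have eZ : ∫ w, Z w ∂ν = 0 := by
    have e1 : ∫ w, G (y + δ • w.2) ∂ν = v₀ := by
      rw [hv₀, ← h.snd, integral_map (by fun_prop)]
      exact (hG.smF.comp_measurable (by fun_prop)).aestronglyMeasurable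
    simp only [hZ]
    rw [integral_div, integral_sub (hG.intF ν (φ := fun w : E × E => y + δ • w.2) (by fun_prop))
      (integrable_const _), e1]
    simp
  have eQ : ∫ w, Q w ∂ν ≤ 0 := h.quad ℓ m
  have j1 : Integrable (fun w => 1 + a * W w) ν := (integrable_const _).add (iW.const_mul _)
  have j2 : Integrable (fun w => 1 + a * W w + b * Z w) ν := j1.add (iZ.const_mul _)
  have j3 : Integrable (fun w => 1 + a * W w + b * Z w + Q w / 2) ν := j2.add (iQ.div_const _)
  have j4 : Integrable (fun w => K1 * δ ^ 3 * ξ w ^ 12) ν := hξi.const_mul _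
  have I := integral_mono (hF.rpow_int hG hc hc ha hb ν (φ := fun w : E × E => x + δ • w.1)
    (ψ := fun w : E × E => y + δ • w.2) (by fun_prop) (by fun_prop)) ((j3.add j4).const_mul _) pw
  refine I.trans ?_
  clear_value W Z Q ξ K1 u₀ v₀
  simp only [Pi.add_apply]
  rw [integral_const_mul, integral_add j3 j4, integral_add j2 (iQ.div_const _),
    integral_add j1 (iZ.const_mul _), integral_add (integrable_const _) (iW.const_mul _),
    integral_const_mul, integral_const_mul, integral_const_mul, eW, eZ, integral_div]
  simp only [integral_const, probReal_univ, smul_eq_mul]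
  have hI : 0 ≤ ∫ w, ξ w ^ 12 ∂ν := integral_nonneg fun w => by positivity
  have hC0 : 0 ≤ C := hc.le.trans hcC
  have hP : u₀ ^ a * v₀ ^ b ≤ C ^ a * C ^ b := by gcongr
  have hP0 : 0 ≤ u₀ ^ a * v₀ ^ b := by positivity
  have e1 : u₀ ^ a * v₀ ^ b * ((∫ w, Q w ∂ν) / 2) ≤ 0 :=
    mul_nonpos_of_nonneg_of_nonpos hP0 (by linarith)
  have e2 := mul_le_mul_of_nonneg_right hP
    (by positivity : 0 ≤ K1 * δ ^ 3 * ∫ w, ξ w ^ 12 ∂ν)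
  linarith
end

section
variable {E : Type*} [NormedAddCommGroup E] [NormedSpace ℝ E] [SecondCountableTopology E]
  [MeasurableSpace E] [BorelSpace E]

lemma hc_rot_integral {W : Type*} [NormedAddCommGroup W] [NormedSpace ℝ W]
    [SecondCountableTopology W] [MeasurableSpace W] [BorelSpace W] {ν : Measure W}
    [IsProbabilityMeasure ν]
    (rot : ∀ s s' : ℝ, (ν.prod ν).map (fun p => s • p.1 + s' • p.2)
      = ν.map (fun w => √(s ^ 2 + s' ^ 2) • w)) (s s' : ℝ) (H : W → ℝ) (hH : Measurable H)
    (B : ℝ) (hB : ∀ x, |H x| ≤ B) :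
    ∫ w, H (√(s ^ 2 + s' ^ 2) • w) ∂ν = ∫ w, ∫ w', H (s • w + s' • w') ∂ν ∂ν := by
  have h1 : ∫ w, H (√(s ^ 2 + s' ^ 2) • w) ∂ν
      = ∫ w, H w ∂(ν.map (fun w => √(s ^ 2 + s' ^ 2) • w)) := by
    rw [integral_map (by fun_prop) hH.aestronglyMeasurable]
  rw [h1, ← rot, integral_map (by fun_prop) hH.aestronglyMeasurable, integral_prod]
  refine Integrable.of_bound (C := B) (hH.comp (by fun_prop)).aestronglyMeasurable ?_
  exact Filter.Eventually.of_forall fun p => hB _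

lemma hc_iter {γ : Measure E} {ν : Measure (E × E)} [IsProbabilityMeasure γ]
    [IsProbabilityMeasure ν] {a b : ℝ}
    (h : HcPair γ ν a b) (ha : 0 ≤ a) (hb : 0 ≤ b)
    {c C L M : ℝ} (hc : 0 < c) {K δ : ℝ} (hδ : 0 ≤ δ)
    (step : ∀ (F G : E → ℝ) (D D' : E → E →L[ℝ] ℝ), HcNice c C L M F D →
      HcNice c C L M G D' → ∀ x y : E,
      ∫ w, F (x + δ • w.1) ^ a * G (y + δ • w.2) ^ b ∂ν ≤
      (∫ g, F (x + δ • g) ∂γ) ^ a * (∫ g, G (y + δ • g) ∂γ) ^ b + K) (k : ℕ) :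
    ∀ (F G : E → ℝ) (D D' : E → E →L[ℝ] ℝ), HcNice c C L M F D →
      HcNice c C L M G D' → ∀ x y : E,
      ∫ w, F (x + (√k * δ) • w.1) ^ a * G (y + (√k * δ) • w.2) ^ b ∂ν ≤
      (∫ g, F (x + (√k * δ) • g) ∂γ) ^ a * (∫ g, G (y + (√k * δ) • g) ∂γ) ^ b + k * K := by
  induction k with
  | zero => intro F G D D' hF hG x y; simp
  | succ k ih =>
    intro F G D D' hF hG x y
    have e : √((k + 1 : ℕ) : ℝ) * δ = √((√k * δ) ^ 2 + δ ^ 2) := by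
      rw [mul_pow, Real.sq_sqrt (by positivity), ← add_one_mul, Real.sqrt_mul (by positivity),
        Real.sqrt_sq hδ]
      push_cast; rfl
    rw [e]
    have sF : ∀ {F : E → ℝ} {D : E → E →L[ℝ] ℝ}, HcNice c C L M F D → ∀ x : E,
        ∫ g, F (x + √((√k * δ) ^ 2 + δ ^ 2) • g) ∂γ
        = ∫ g, ∫ g', F (x + (√k * δ) • g + δ • g') ∂γ ∂γ := by
      intro F D hF x
      have := hc_rot_integral h.rotγ (√k * δ) δ (fun g => F (x + g))
        (hF.smF.measurable.comp (by fun_prop)) (max |c| |C|)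
        (fun g => abs_le_max_abs_abs (hF.lb _) (hF.ub _))
      simpa only [add_assoc] using this
    rw [sF hF, sF hG]
    have mH : Measurable (fun w : E × E => F (x + w.1) ^ a * G (y + w.2) ^ b) :=
      ((hF.smF.measurable.comp (by fun_prop)).pow_const a).mul
      ((hG.smF.measurable.comp (by fun_prop)).pow_const b)
    have bH : ∀ w : E × E, |F (x + w.1) ^ a * G (y + w.2) ^ b| ≤ C ^ a * C ^ b := by
      intro w
      have h1 := hc.le.trans (hF.lb (x + w.1))
      have h2 := hc.le.trans (hG.lb (y + w.2))
      rw [abs_of_nonneg (by positivity)]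
      have := h1.trans (hF.ub (x + w.1))
      have := h2.trans (hG.ub (y + w.2))
      gcongr
      · exact hF.ub _
      · exact hG.ub _
    have sH := hc_rot_integral h.rot (√k * δ) δ _ mH _ bH
    simp only [Prod.fst_add, Prod.snd_add, Prod.smul_fst, Prod.smul_snd, ← add_assoc] at sH
    rw [sH]
    have fa := hF.avg γ δ
    have ga := hG.avg γ δ
    have I := ih _ _ _ _ fa ga x y
    have i1 : Integrable (fun w : E × E => (∫ g, F (x + (√k * δ) • w.1 + δ • g) ∂γ) ^ a
        * (∫ g, G (y + (√k * δ) • w.2 + δ • g) ∂γ) ^ b) ν :=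
      fa.rpow_int ga hc hc ha hb ν (φ := fun w : E × E => x + (√k * δ) • w.1)
        (ψ := fun w : E × E => y + (√k * δ) • w.2) (by fun_prop) (by fun_prop)
    have i0 : Integrable (fun w : E × E => ∫ w' : E × E, F (x + (√k * δ) • w.1 + δ • w'.1) ^ a
        * G (y + (√k * δ) • w.2 + δ • w'.2) ^ b ∂ν) ν := by
      have : Integrable (fun p : (E × E) × (E × E) => F (x + (√k * δ) • p.1.1 + δ • p.2.1) ^ a
        * G (y + (√k * δ) • p.1.2 + δ • p.2.2) ^ b) (ν.prod ν) :=
        hF.rpow_int hG hc hc ha hb _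
          (φ := fun p : (E × E) × (E × E) => x + (√k * δ) • p.1.1 + δ • p.2.1)
          (ψ := fun p : (E × E) × (E × E) => y + (√k * δ) • p.1.2 + δ • p.2.2)
          (by fun_prop) (by fun_prop)
      exact this.integral_prod_left
    have J := integral_mono i0 (i1.add (integrable_const K))
      (fun w => step F G D D' hF hG (x + (√k * δ) • w.1) (y + (√k * δ) • w.2))
    simp only [Pi.add_apply] at J
    rw [integral_add i1 (integrable_const K)] at J
    simp only [integral_const, probReal_univ, smul_eq_mul, one_mul] at J
    push_cast
    linarith

lemma hc_nice {γ : Measure E} {ν : Measure (E × E)} [IsProbabilityMeasure γ]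
    [IsProbabilityMeasure ν] {a b : ℝ}
    (h : HcPair γ ν a b) (ha : 0 ≤ a) (ha1 : a ≤ 1) (hb : 0 ≤ b) (hb1 : b ≤ 1)
    {c C L M : ℝ} (hc : 0 < c) (hcC : c ≤ C) (hL : 0 ≤ L) (hM : 0 ≤ M)
    {F G : E → ℝ} {D D' : E → E →L[ℝ] ℝ} (hF : HcNice c C L M F D) (hG : HcNice c C L M G D') :
    ∫ w, F w.1 ^ a * G w.2 ^ b ∂ν ≤ (∫ g, F g ∂γ) ^ a * (∫ g, G g ∂γ) ^ b := by
  obtain ⟨K, hK, step⟩ := hc_onestep h ha ha1 hb hb1 hc hcC hL hM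
  have main : ∀ k : ℕ, ∫ w, F w.1 ^ a * G w.2 ^ b ∂ν ≤
      (∫ g, F g ∂γ) ^ a * (∫ g, G g ∂γ) ^ b + K * (√((k:ℝ) + 1))⁻¹ := by
    intro k
    have hp : 0 < √((k:ℝ) + 1) := by positivity
    have h1 : 1 ≤ √((k:ℝ) + 1) := by rw [Real.one_le_sqrt]; linarith [k.cast_nonneg (α := ℝ)]
    have := hc_iter h ha hb hc (K := K * ((√((k:ℝ) + 1))⁻¹) ^ 3) (δ := (√((k:ℝ) + 1))⁻¹)
      (by positivity)
      (fun F G D D' hF hG x y => step F G D D' hF hG _ (by positivity) (inv_le_one_of_one_le₀ h1) x y)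
      (k + 1) F G D D' hF hG 0 0
    push_cast at this
    rw [mul_inv_cancel₀ hp.ne'] at this
    simp only [one_smul, zero_add] at this
    refine this.trans_eq ?_
    congr 1
    have e : (k:ℝ) + 1 = √((k:ℝ) + 1) ^ 2 := (Real.sq_sqrt (by positivity)).symm
    calc ((k:ℝ) + 1) * (K * ((√((k:ℝ) + 1))⁻¹) ^ 3)
        = (√((k:ℝ) + 1) ^ 2) * (K * ((√((k:ℝ) + 1))⁻¹) ^ 3) := by rw [← e]
      _ = _ := by field_simp
  have lim : Filter.Tendsto (fun k : ℕ => (∫ g, F g ∂γ) ^ a * (∫ g, G g ∂γ) ^ b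
      + K * (√((k:ℝ) + 1))⁻¹) Filter.atTop
      (nhds ((∫ g, F g ∂γ) ^ a * (∫ g, G g ∂γ) ^ b + K * 0)) := by
    refine tendsto_const_nhds.add (Filter.Tendsto.const_mul K ?_)
    refine Filter.Tendsto.inv_tendsto_atTop ?_
    exact Real.tendsto_sqrt_atTop.comp
      (Filter.tendsto_atTop_add_const_right _ _ tendsto_natCast_atTop_atTop)
  rw [mul_zero, add_zero] at lim
  exact ge_of_tendsto' lim main
end

section
variable {E : Type*} [NormedAddCommGroup E] [NormedSpace ℝ E] [SecondCountableTopology E]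
  [CompleteSpace E] [MeasurableSpace E] [BorelSpace E]

lemma hc_rot (γ : Measure E) [IsGaussian γ] (h0 : γ[id] = 0) (s s' : ℝ) :
    (γ.prod γ).map (fun p => s • p.1 + s' • p.2) = γ.map (fun w => √(s ^ 2 + s' ^ 2) • w) := by
  set z : ℂ := ⟨s, s'⟩ with hz
  have hr : √(s ^ 2 + s' ^ 2) = ‖z‖ := by
    rw [Complex.norm_def, Complex.normSq_apply]; simp [hz, pow_two]
  have hs : s = ‖z‖ * Real.cos z.arg := by rw [Complex.norm_mul_cos_arg]
  have hs' : s' = ‖z‖ * Real.sin z.arg := by rw [Complex.norm_mul_sin_arg]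
  rw [hr]
  have e : (fun p : E × E => s • p.1 + s' • p.2)
      = (fun w => ‖z‖ • w) ∘ Prod.fst ∘ (ContinuousLinearMap.rotation z.arg : E × E →L[ℝ] E × E) := by
    funext p
    simp only [Function.comp, ContinuousLinearMap.rotation_apply, smul_add, smul_smul]
    rw [← hs, ← hs']
  rw [e, ← Measure.map_map (by fun_prop) (by fun_prop), ← Measure.map_map (by fun_prop) (by fun_prop),
    IsGaussian.map_rotation_eq_self h0]
  rw [Measure.map_fst_prod]; simp

lemma hc_pair (γ : Measure E) [IsGaussian γ] (h0 : γ[id] = 0) {ρ σ a b : ℝ}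
    (hρσ : ρ ^ 2 + σ ^ 2 = 1) (ha : 0 ≤ a) (ha1 : a ≤ 1) (hb : 0 ≤ b) (hb1 : b ≤ 1)
    (hab : ρ ^ 2 * (a * b) ≤ (1 - a) * (1 - b)) :
    HcPair γ ((γ.prod γ).map (fun p => (p.1, ρ • p.1 + σ • p.2))) a b := by
  set T : E × E →L[ℝ] E × E := (ContinuousLinearMap.fst ℝ E E).prod
    (ρ • ContinuousLinearMap.fst ℝ E E + σ • ContinuousLinearMap.snd ℝ E E) with hT
  have eT : (fun p : E × E => (p.1, ρ • p.1 + σ • p.2)) = T := by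
    funext p; simp [hT]
  rw [eT]
  set ν := (γ.prod γ).map T with hν
  have : IsGaussian ν := by rw [hν]; infer_instance
  have c0 : ∀ ℓ : E →L[ℝ] ℝ, ∫ g, ℓ g ∂γ = 0 := by
    intro ℓ
    have := IsGaussian.integral_dual (μ := γ) ℓ
    simp only [id_eq] at h0
    rw [this, h0, map_zero]
  have hfst : ν.map Prod.fst = γ := by
    rw [hν, Measure.map_map (by fun_prop) (by fun_prop)]
    have : Prod.fst ∘ T = Prod.fst := by funext p; simp [hT]
    rw [this, Measure.map_fst_prod]; simp
  have hsnd : ν.map Prod.snd = γ := by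
    rw [hν, Measure.map_map (by fun_prop) (by fun_prop)]
    have : Prod.snd ∘ T = fun p : E × E => ρ • p.1 + σ • p.2 := by funext p; simp [hT]
    rw [this, hc_rot γ h0, hρσ]; simp
  have nu0 : ν[id] = 0 := by
    have i := IsGaussian.integrable_id (μ := ν)
    have e1 : (∫ w, w ∂ν).1 = ∫ w, w.1 ∂ν := fst_integral i
    have e2 : (∫ w, w ∂ν).2 = ∫ w, w.2 ∂ν := snd_integral i
    simp only [id_eq] at h0 ⊢
    have f1 : ∫ w : E × E, w.1 ∂ν = 0 := by
      rw [← h0]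
      have := integral_map (μ := ν) (φ := Prod.fst) (f := fun g : E => g) (by fun_prop) (by fun_prop)
      rw [hfst] at this
      exact this.symm
    have f2 : ∫ w : E × E, w.2 ∂ν = 0 := by
      rw [← h0]
      have := integral_map (μ := ν) (φ := Prod.snd) (f := fun g : E => g) (by fun_prop) (by fun_prop)
      rw [hsnd] at this
      exact this.symm
    exact Prod.ext (e1.trans f1) (e2.trans f2)
  refine ⟨c0, hfst, hsnd, ?_, ?_, hc_rot ν nu0, hc_rot γ h0⟩
  · intro k
    rcases Nat.eq_zero_or_pos k with rfl | hk
    · simp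
    · exact (IsGaussian.memLp_id ν k (by simp)).integrable_norm_pow hk.ne'
  · intro ℓ m
    have L2 : ∀ k : E × E →L[ℝ] ℝ, MemLp k 2 ν := fun k => IsGaussian.memLp_dual ν k 2 (by simp)
    have l2 : ∀ k : E →L[ℝ] ℝ, MemLp k 2 γ := fun k => IsGaussian.memLp_dual γ k 2 (by simp)
    have i1 : Integrable (fun w : E × E => (ℓ w.1) ^ 2) ν := by
      have := (L2 (ℓ.comp (.fst ℝ E E))).integrable_sq
      simpa using this
    have i3 : Integrable (fun w : E × E => (m w.2) ^ 2) ν := by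
      have := (L2 (m.comp (.snd ℝ E E))).integrable_sq
      simpa using this
    have i2 : Integrable (fun w : E × E => ℓ w.1 * m w.2) ν := by
      have := (L2 (ℓ.comp (.fst ℝ E E))).integrable_mul (L2 (m.comp (.snd ℝ E E)))
      exact this
    have j1 : Integrable (fun g => (ℓ g) ^ 2) γ := (l2 ℓ).integrable_sq
    have j3 : Integrable (fun g => (m g) ^ 2) γ := (l2 m).integrable_sq
    have j2 : Integrable (fun g => ℓ g * m g) γ := (l2 ℓ).integrable_mul (l2 m)
    have t1 : ∫ w : E × E, (ℓ w.1) ^ 2 ∂ν = ∫ g, (ℓ g) ^ 2 ∂γ := by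
      have := integral_map (μ := ν) (φ := Prod.fst) (f := fun g => (ℓ g) ^ 2) (by fun_prop) (by fun_prop)
      rw [hfst] at this
      exact this.symm
    have t3 : ∫ w : E × E, (m w.2) ^ 2 ∂ν = ∫ g, (m g) ^ 2 ∂γ := by
      have := integral_map (μ := ν) (φ := Prod.snd) (f := fun g => (m g) ^ 2) (by fun_prop) (by fun_prop)
      rw [hsnd] at this
      exact this.symm
    have t2 : ∫ w : E × E, ℓ w.1 * m w.2 ∂ν = ρ * ∫ g, ℓ g * m g ∂γ := by
      rw [hν, integral_map (by fun_prop) (by fun_prop)]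
      have e : ∀ p : E × E, ℓ (T p).1 * m (T p).2
          = ρ * ((ℓ p.1 * m p.1) * 1) + σ * (ℓ p.1 * m p.2) := by
        intro p; simp [hT]; ring
      simp only [e]
      have k1 : Integrable (fun p : E × E => (ℓ p.1 * m p.1) * 1) (γ.prod γ) :=
        j2.mul_prod (integrable_const (1:ℝ))
      have k2 : Integrable (fun p : E × E => ℓ p.1 * m p.2) (γ.prod γ) :=
        ((l2 ℓ).integrable (by norm_num)).mul_prod ((l2 m).integrable (by norm_num))
      rw [integral_add (k1.const_mul _) (k2.const_mul _), integral_const_mul, integral_const_mul,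
        integral_prod_mul (fun g => ℓ g * m g) (fun _ => (1:ℝ)),
        integral_prod_mul (fun g => ℓ g) (fun g => m g), c0]
      simp
    have q1 : Integrable (fun w : E × E => -(a * (1 - a)) * (ℓ w.1) ^ 2) ν := i1.const_mul _
    have q2 : Integrable (fun w : E × E => 2 * a * b * (ℓ w.1 * m w.2)) ν := i2.const_mul _
    have q3 : Integrable (fun w : E × E => b * (1 - b) * (m w.2) ^ 2) ν := i3.const_mul _
    have q12 : Integrable (fun w : E × E => -(a * (1 - a)) * (ℓ w.1) ^ 2
      + 2 * a * b * (ℓ w.1 * m w.2)) ν := q1.add q2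
    rw [integral_sub q12 q3, integral_add q1 q2, integral_const_mul, integral_const_mul,
      integral_const_mul, t1, t2, t3]
    have p1 : Integrable (fun g => -(a * (1 - a)) * (ℓ g) ^ 2) γ := j1.const_mul _
    have p2 : Integrable (fun g => 2 * a * b * ρ * (ℓ g * m g)) γ := j2.const_mul _
    have p3 : Integrable (fun g => b * (1 - b) * (m g) ^ 2) γ := j3.const_mul _
    have p12 : Integrable (fun g => -(a * (1 - a)) * (ℓ g) ^ 2 + 2 * a * b * ρ * (ℓ g * m g)) γ :=
      p1.add p2
    have R : ∫ g, (-(a * (1 - a)) * (ℓ g) ^ 2 + 2 * a * b * ρ * (ℓ g * m g)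
        - b * (1 - b) * (m g) ^ 2) ∂γ ≤ 0 := by
      refine integral_nonpos fun g => ?_
      simp only [Pi.zero_apply]
      generalize ℓ g = X
      generalize m g = Y
      have hA : 0 ≤ a * (1 - a) := mul_nonneg ha (by linarith)
      have hB : 0 ≤ b * (1 - b) := mul_nonneg hb (by linarith)
      have hd : (a * b * ρ) ^ 2 ≤ (a * (1 - a)) * (b * (1 - b)) := by
        have := mul_le_mul_of_nonneg_left hab (mul_nonneg ha hb)
        nlinarith
      rw [show 2 * a * b * ρ * (X * Y) = 2 * (a * b * ρ) * (X * Y) by ring]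
      generalize a * (1 - a) = A at *
      generalize b * (1 - b) = B at *
      generalize a * b * ρ = R at *
      rcases hA.eq_or_lt with h | h
      · have : R = 0 := by
          rw [← h, zero_mul] at hd; exact pow_eq_zero_iff (two_ne_zero) |>.1 (le_antisymm hd (sq_nonneg _))
        subst this; rw [← h]; nlinarith [mul_nonneg hB (sq_nonneg Y)]
      · have : 0 ≤ A * (A * X ^ 2 - 2 * R * (X * Y) + B * Y ^ 2) := by
          nlinarith [sq_nonneg (A * X - R * Y), mul_nonneg (sub_nonneg.2 hd) (sq_nonneg Y)]
        have := nonneg_of_mul_nonneg_right this h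
        linarith
    rw [integral_sub p12 p3, integral_add p1 p2, integral_const_mul, integral_const_mul,
      integral_const_mul] at R
    linarith
end

section
variable {E : Type*} [NormedAddCommGroup E] [NormedSpace ℝ E] [FiniteDimensional ℝ E]
  [SecondCountableTopology E] [MeasurableSpace E] [BorelSpace E]

lemma HcNice.mono {c C L M c' C' L' M' : ℝ} {F : E → ℝ} {D : E → E →L[ℝ] ℝ}
    (h : HcNice c C L M F D) (hc : c' ≤ c) (hC : C ≤ C') (hL : L ≤ L') (hM : M ≤ M') :
    HcNice c' C' L' M' F D where
  smF := h.smF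
  smD := h.smD
  lb x := hc.trans (h.lb x)
  ub x := (h.ub x).trans hC
  Dle x := (h.Dle x).trans hL
  tay x y := (h.tay x y).trans (by gcongr)

lemma hc_smooth_nice {K : E → ℝ} (hK : ContDiff ℝ 2 K) (hs : HasCompactSupport K)
    (hK0 : ∀ x, 0 ≤ K x) {ε : ℝ} :
    ∃ C L M D, HcNice ε C L M (fun x => K x + ε) D := by
  have hd : ContDiff ℝ 1 (fderiv ℝ K) := hK.fderiv_right (by norm_num)
  have hds : HasCompactSupport (fderiv ℝ K) := hs.fderiv ℝ
  obtain ⟨C, hC⟩ := hs.exists_bound_of_continuous hK.continuous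
  obtain ⟨L, hL⟩ := hds.exists_bound_of_continuous hd.continuous
  obtain ⟨M, hM⟩ := hd.lipschitzWith_of_hasCompactSupport hds (by norm_num)
  refine ⟨C + ε, L, M, fderiv ℝ K, ?_⟩
  refine ⟨(hK.continuous.add continuous_const).stronglyMeasurable, hd.continuous.stronglyMeasurable,
    fun x => by linarith [hK0 x], fun x => by have := (le_abs_self _).trans (hC x); linarith, hL, ?_⟩
  intro x h
  have key := (convex_closedBall x ‖h‖).norm_image_sub_le_of_norm_hasFDerivWithin_le'
    (f := K) (f' := fderiv ℝ K) (φ := fderiv ℝ K x) (C := M * ‖h‖) (x := x) (y := x + h)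
    (fun y _ => (hK.differentiable (by norm_num) y).hasFDerivAt.hasFDerivWithinAt)
    (fun y hy => by
      have := hM.dist_le_mul y x
      rw [dist_eq_norm] at this
      refine this.trans ?_
      have : dist y x ≤ ‖h‖ := hy
      gcongr)
    (by simp) (by simp)
  simp only [add_sub_cancel_left, Real.norm_eq_abs] at key
  calc _ = |K (x + h) - K x - fderiv ℝ K x h| := by congr 1; ring
    _ ≤ M * ‖h‖ * ‖h‖ := key
    _ = _ := by ring

lemma hc_approx (γ : Measure E) [IsProbabilityMeasure γ] {F : E → ℝ} (hF : Measurable F)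
    (hF0 : ∀ x, 0 ≤ F x) {B : ℝ} (hB : ∀ x, F x ≤ B) :
    ∃ u : ℕ → E → ℝ, (∀ k, ∃ c C L M D, 0 < c ∧ HcNice c C L M (u k) D) ∧
      Filter.Tendsto (fun k => ∫ x, u k x ∂γ) Filter.atTop (nhds (∫ x, F x ∂γ)) ∧
      ∀ᵐ x ∂γ, Filter.Tendsto (fun k => u k x) Filter.atTop (nhds (F x)) := by
  have iF : Integrable F γ := Integrable.of_bound (C := B) hF.aestronglyMeasurable
    (Filter.Eventually.of_forall fun x => by rw [Real.norm_eq_abs, abs_of_nonneg (hF0 x)]; exact hB x)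
  have step : ∀ k : ℕ, ∃ u : E → ℝ, (∃ c C L M D, 0 < c ∧ HcNice c C L M u D) ∧
      eLpNorm (u - F) 1 γ ≤ ENNReal.ofReal (1 / ((k : ℝ) + 1)) + ENNReal.ofReal (1 / ((k : ℝ) + 1)) := by
    intro k
    set ε : ℝ := 1 / ((k : ℝ) + 1) with hε
    have ε0 : 0 < ε := by positivity
    obtain ⟨H, Hs, Hc, He⟩ := (memLp_one_iff_integrable.2 iF).exist_eLpNorm_sub_le
      (by simp) le_rfl ε0
    set K : E → ℝ := fun x => √(H x ^ 2 + ε ^ 2) - ε with hKdef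
    have pos : ∀ x, H x ^ 2 + ε ^ 2 ≠ 0 := fun x => by positivity
    have hK : ContDiff ℝ 2 K := by
      have : ContDiff ℝ 2 H := contDiff_infty.1 Hc 2
      exact (((this.pow 2).add contDiff_const).sqrt pos).sub contDiff_const
    have hs : HasCompactSupport K := by
      have : K = (fun y : ℝ => √(y ^ 2 + ε ^ 2) - ε) ∘ H := rfl
      rw [this]
      exact Hs.comp_left (by simp [Real.sqrt_sq ε0.le])
    have hK0 : ∀ x, 0 ≤ K x := fun x => by
      simp only [hKdef, sub_nonneg]
      exact Real.le_sqrt_of_sq_le (by nlinarith [sq_nonneg (H x)])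
    obtain ⟨C, L, M, D, hn⟩ := hc_smooth_nice hK hs hK0 (ε := ε)
    refine ⟨fun x => K x + ε, ⟨ε, C, L, M, D, ε0, hn⟩, ?_⟩
    have e : ∀ x, ‖K x + ε - F x‖ ≤ ‖(fun x => |(F - H) x| + ε) x‖ := by
      intro x
      simp only [hKdef, sub_add_cancel, Pi.sub_apply, Real.norm_eq_abs]
      rw [abs_of_nonneg (by positivity : 0 ≤ |F x - H x| + ε)]
      have h1 : √(H x ^ 2 + ε ^ 2) ≤ |H x| + ε := by
        rw [Real.sqrt_le_iff]
        refine ⟨by positivity, ?_⟩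
        nlinarith [sq_abs (H x), mul_nonneg (abs_nonneg (H x)) ε0.le]
      have h2 : |H x| ≤ √(H x ^ 2 + ε ^ 2) := Real.abs_le_sqrt (by nlinarith)
      have h3 : |H x| - |F x| ≤ |F x - H x| := by
        rw [abs_sub_comm]; exact abs_sub_abs_le_abs_sub _ _
      rw [abs_of_nonneg (hF0 x)] at h3
      have h4 := neg_abs_le (F x - H x)
      have h5 := le_abs_self (F x - H x)
      have h6 := le_abs_self (H x)
      rw [abs_le]; constructor <;> linarith
    calc eLpNorm ((fun x => K x + ε) - F) 1 γ ≤ eLpNorm (fun x => |(F - H) x| + ε) 1 γ :=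
          eLpNorm_mono e
      _ ≤ eLpNorm (fun x => |(F - H) x|) 1 γ + eLpNorm (fun _ => ε) 1 γ := by
          have mH : AEStronglyMeasurable H γ := Hc.continuous.aestronglyMeasurable
          have m : AEStronglyMeasurable (fun x => |(F - H) x|) γ :=
            (hF.aestronglyMeasurable.sub mH).norm
          exact eLpNorm_add_le m aestronglyMeasurable_const le_rfl
      _ ≤ _ := by
          gcongr
          · exact (eLpNorm_norm (F - H)).le.trans He
          · rw [eLpNorm_const _ (by simp) (IsProbabilityMeasure.ne_zero γ)]
            simp [Real.enorm_eq_ofReal ε0.le]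
  choose u hu he using step
  have lim : Filter.Tendsto (fun k => eLpNorm (u k - F) 1 γ) Filter.atTop (nhds 0) := by
    refine tendsto_of_tendsto_of_tendsto_of_le_of_le tendsto_const_nhds ?_ (fun _ => zero_le) he
    have t : Filter.Tendsto (fun k : ℕ => ENNReal.ofReal (1 / ((k : ℝ) + 1))) Filter.atTop (nhds 0) := by
      rw [← ENNReal.ofReal_zero]
      exact ENNReal.tendsto_ofReal tendsto_one_div_add_atTop_nhds_zero_nat
    simpa using t.add t
  have iu : ∀ k, Integrable (u k) γ := fun k => by
    obtain ⟨c, C, L, M, D, _, h⟩ := hu k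
    exact h.intF γ measurable_id
  obtain ⟨ns, hns, hae⟩ := (tendstoInMeasure_of_tendsto_eLpNorm one_ne_zero
    (fun k => (iu k).aestronglyMeasurable) hF.aestronglyMeasurable lim).exists_seq_tendsto_ae
  have ti := tendsto_integral_of_L1' F hF.aestronglyMeasurable (Filter.Eventually.of_forall iu) lim
  exact ⟨fun k => u (ns k), fun k => hu _, ti.comp hns.tendsto_atTop, hae⟩

lemma hc_bdd {γ : Measure E} [IsProbabilityMeasure γ] {ν : Measure (E × E)} [IsProbabilityMeasure ν]
    {a b : ℝ} (h : HcPair γ ν a b) (ha : 0 ≤ a) (ha1 : a ≤ 1) (hb : 0 ≤ b) (hb1 : b ≤ 1)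
    {F G : E → ℝ} (hF : Measurable F) (hF0 : ∀ x, 0 ≤ F x) (hG : Measurable G)
    (hG0 : ∀ x, 0 ≤ G x) {K : ℝ} (hFK : ∀ x, F x ≤ K) (hGK : ∀ x, G x ≤ K) :
    ∫ w, F w.1 ^ a * G w.2 ^ b ∂ν ≤ (∫ g, F g ∂γ) ^ a * (∫ g, G g ∂γ) ^ b := by
  obtain ⟨u, hu, tu, au⟩ := hc_approx γ hF hF0 hFK
  obtain ⟨v, hv, tv, av⟩ := hc_approx γ hG hG0 hGK
  have mu : ∀ k, Measurable (u k) := fun k => by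
    obtain ⟨c, C, L, M, D, _, h⟩ := hu k
    exact h.smF.measurable
  have mv : ∀ k, Measurable (v k) := fun k => by
    obtain ⟨c, C, L, M, D, _, h⟩ := hv k
    exact h.smF.measurable
  have u0 : ∀ k x, 0 ≤ u k x := fun k x => by
    obtain ⟨c, C, L, M, D, hc, h⟩ := hu k
    exact hc.le.trans (h.lb x)
  have v0 : ∀ k x, 0 ≤ v k x := fun k x => by
    obtain ⟨c, C, L, M, D, hc, h⟩ := hv k
    exact hc.le.trans (h.lb x)
  have ineq : ∀ k, ∫⁻ w, ENNReal.ofReal (u k w.1 ^ a * v k w.2 ^ b) ∂ν ≤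
      ENNReal.ofReal ((∫ g, u k g ∂γ) ^ a * (∫ g, v k g ∂γ) ^ b) := by
    intro k
    obtain ⟨c, C, L, M, D, hc, h1⟩ := hu k
    obtain ⟨c', C', L', M', D', hc', h2⟩ := hv k
    have n1 := h1.mono (min_le_left c c') (le_max_left C C')
      (le_max_left L L') (le_max_left M M')
    have n2 := h2.mono (min_le_right c c') (le_max_right C C')
      (le_max_right L L') (le_max_right M M')
    have hcm : 0 < min c c' := lt_min hc hc'
    have n1' := n1.mono le_rfl le_rfl (le_max_left _ 0) (le_max_left _ 0)
    have n2' := n2.mono le_rfl le_rfl (le_max_left _ 0) (le_max_left _ 0)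
    have := hc_nice h ha ha1 hb hb1 hcm ((n1.lb 0).trans (n1.ub 0)) (le_max_right _ _)
      (le_max_right _ _) n1' n2'
    rw [← ofReal_integral_eq_lintegral_ofReal]
    · exact ENNReal.ofReal_le_ofReal this
    · refine Integrable.of_bound (C := C ^ a * C' ^ b) ?_ ?_
      · have := mu k; have := mv k
        exact Measurable.aestronglyMeasurable (by fun_prop)
      · refine Filter.Eventually.of_forall fun w => ?_
        have p1 := u0 k w.1
        have p2 := v0 k w.2
        rw [Real.norm_eq_abs, abs_of_nonneg (by positivity)]
        have q1 := h1.ub w.1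
        have q2 := h2.ub w.2
        have : 0 ≤ C := p1.trans q1
        gcongr
    · refine Filter.Eventually.of_forall fun w => ?_
      have p1 := u0 k w.1
      have p2 := v0 k w.2
      simp only [Pi.zero_apply]
      positivity
  have au' : ∀ᵐ w ∂ν, Filter.Tendsto (fun k => u k w.1) Filter.atTop (nhds (F w.1)) :=
    ae_of_ae_map measurable_fst.aemeasurable (by rw [h.fst]; exact au)
  have av' : ∀ᵐ w ∂ν, Filter.Tendsto (fun k => v k w.2) Filter.atTop (nhds (G w.2)) :=
    ae_of_ae_map measurable_snd.aemeasurable (by rw [h.snd]; exact av)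
  have R : Filter.Tendsto (fun k => ENNReal.ofReal ((∫ g, u k g ∂γ) ^ a * (∫ g, v k g ∂γ) ^ b))
      Filter.atTop (nhds (ENNReal.ofReal ((∫ g, F g ∂γ) ^ a * (∫ g, G g ∂γ) ^ b))) :=
    ENNReal.tendsto_ofReal ((tu.rpow_const (Or.inr ha)).mul (tv.rpow_const (Or.inr hb)))
  have main : ∫⁻ w, ENNReal.ofReal (F w.1 ^ a * G w.2 ^ b) ∂ν ≤
      ENNReal.ofReal ((∫ g, F g ∂γ) ^ a * (∫ g, G g ∂γ) ^ b) := by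
    calc _ = ∫⁻ w, Filter.liminf (fun k => ENNReal.ofReal (u k w.1 ^ a * v k w.2 ^ b))
            Filter.atTop ∂ν := by
          refine lintegral_congr_ae ?_
          filter_upwards [au', av'] with w h1 h2
          exact (ENNReal.tendsto_ofReal ((h1.rpow_const (Or.inr ha)).mul
            (h2.rpow_const (Or.inr hb)))).liminf_eq.symm
      _ ≤ Filter.liminf (fun k => ∫⁻ w, ENNReal.ofReal (u k w.1 ^ a * v k w.2 ^ b) ∂ν)
            Filter.atTop := by
          refine lintegral_liminf_le fun k => ?_
          have := mu k; have := mv k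
          fun_prop
      _ ≤ Filter.liminf (fun k => ENNReal.ofReal ((∫ g, u k g ∂γ) ^ a * (∫ g, v k g ∂γ) ^ b))
            Filter.atTop := Filter.liminf_le_liminf (Filter.Eventually.of_forall ineq)
      _ = _ := R.liminf_eq
  rw [integral_eq_lintegral_of_nonneg_ae]
  · refine ENNReal.toReal_le_of_le_ofReal ?_ main
    have := integral_nonneg (μ := γ) (f := F) hF0
    have := integral_nonneg (μ := γ) (f := G) hG0
    positivity
  · refine Filter.Eventually.of_forall fun w => ?_
    have := hF0 w.1
    have := hG0 w.2
    simp only [Pi.zero_apply]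
    positivity
  · exact Measurable.aestronglyMeasurable (by fun_prop)
end


lemma hc_law {Ω : Type*} [MeasurableSpace Ω] (P : Measure Ω) [IsProbabilityMeasure P]
    (n : ℕ) (B : Matrix (Fin n) (Fin n) ℝ)
    (Z : Ω → (Fin n → ℝ)) (hZ : Measurable Z)
    (hZlaw : P.map Z = Measure.pi fun _ => gaussianReal 0 1)
    (X : Ω → (Fin n → ℝ)) (hX : ∀ ω, X ω = B.mulVec (Z ω)) :
    Measurable X ∧ IsGaussian (P.map X) ∧ (P.map X)[id] = 0 := by
  let M : (Fin n → ℝ) →L[ℝ] (Fin n → ℝ) := LinearMap.toContinuousLinearMap B.mulVecLin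
  have eX : X = M ∘ Z := by funext ω; simp [M, hX]
  let A : EuclideanSpace ℝ (Fin n) →L[ℝ] (Fin n → ℝ) :=
    M.comp (EuclideanSpace.equiv (Fin n) ℝ).toContinuousLinearMap
  have eP : P.map X = (stdGaussian (EuclideanSpace ℝ (Fin n))).map A := by
    rw [← map_pi_eq_stdGaussian, Measure.map_map (by fun_prop) (by fun_prop), eX,
      ← Measure.map_map (by fun_prop) hZ, hZlaw]
    rfl
  refine ⟨by rw [eX]; exact M.continuous.measurable.comp hZ, ?_, ?_⟩
  · rw [eP]; infer_instance
  · rw [eP, integral_map (by fun_prop) (by fun_prop)]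
    simp only [id_eq]
    have i : Integrable (fun x : EuclideanSpace ℝ (Fin n) => x)
        (stdGaussian (EuclideanSpace ℝ (Fin n))) := IsGaussian.integrable_id
    rw [A.integral_comp_comm i, integral_id_stdGaussian, map_zero]

lemma hc_final {n : ℕ} (γ : Measure (Fin n → ℝ)) [IsGaussian γ] (h0 : γ[id] = 0)
    {ρ σ p q : ℝ} (hρσ : ρ ^ 2 + σ ^ 2 = 1) (hp : 1 < p) (hpq : p ≤ q)
    (hh : ρ ^ 2 * (q - 1) ≤ p - 1)
    {f : (Fin n → ℝ) → ℝ} (hf : Measurable f) (hf0 : ∀ x, 0 ≤ f x) {K : ℝ} (hK : ∀ x, f x ≤ K) :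
    (∫ x, (∫ y, f (ρ • x + σ • y) ∂γ) ^ q ∂γ) ^ (1 / q) ≤ (∫ x, f x ^ p ∂γ) ^ (1 / p) := by
  have hK0 : 0 ≤ K := (hf0 0).trans (hK 0)
  have hp0 : 0 < p := by linarith
  have hq0 : 0 < q := by linarith
  have hq1 : 0 < q - 1 := by linarith
  set k : (Fin n → ℝ) → ℝ := fun x => ∫ y, f (ρ • x + σ • y) ∂γ with hk
  have ifx : ∀ x, Integrable (fun y => f (ρ • x + σ • y)) γ := fun x =>
    Integrable.of_bound (C := K) (Measurable.aestronglyMeasurable (by fun_prop))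
      (Filter.Eventually.of_forall fun y => by
        rw [Real.norm_eq_abs, abs_of_nonneg (hf0 _)]; exact hK _)
  have k0 : ∀ x, 0 ≤ k x := fun x => integral_nonneg fun y => hf0 _
  have kK : ∀ x, k x ≤ K := fun x => by
    have := integral_mono (ifx x) (integrable_const K) (fun y => hK _)
    simpa using this
  have km : Measurable k := by
    have : StronglyMeasurable (fun z : (Fin n → ℝ) × (Fin n → ℝ) => f (ρ • z.1 + σ • z.2)) :=
      Measurable.stronglyMeasurable (by fun_prop)
    exact this.integral_prod_right.measurable
  set a : ℝ := 1 - 1 / q with hadef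
  set b : ℝ := 1 / p with hbdef
  have iq : 1 / q < 1 := by rw [div_lt_one hq0]; linarith
  have ip : 1 / p < 1 := by rw [div_lt_one hp0]; linarith
  have iq0 : 0 < 1 / q := by positivity
  have ip0 : 0 < 1 / p := by positivity
  have hab : ρ ^ 2 * (a * b) ≤ (1 - a) * (1 - b) := by
    have e1 : ρ ^ 2 * (a * b) = (ρ ^ 2 * (q - 1)) / (p * q) := by
      simp only [hadef, hbdef]; field_simp
    have e2 : (1 - a) * (1 - b) = (p - 1) / (p * q) := by
      simp only [hadef, hbdef]; field_simp; ring
    rw [e1, e2]; gcongr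
  have pair := hc_pair γ h0 hρσ (by linarith : 0 ≤ a) (by linarith) ip0.le ip.le hab
  have : IsProbabilityMeasure ((γ.prod γ).map
      (fun p : (Fin n → ℝ) × (Fin n → ℝ) => (p.1, ρ • p.1 + σ • p.2))) :=
    Measure.isProbabilityMeasure_map (by fun_prop)
  have key := hc_bdd pair (by linarith : 0 ≤ a) (by linarith) ip0.le ip.le
    (F := fun x => k x ^ q) (G := fun x => f x ^ p) (K := max (K ^ q) (K ^ p))
    (by fun_prop) (fun x => rpow_nonneg (k0 x) _) (by fun_prop) (fun x => rpow_nonneg (hf0 x) _)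
    (fun x => (rpow_le_rpow (k0 x) (kK x) hq0.le).trans (le_max_left _ _))
    (fun x => (rpow_le_rpow (hf0 x) (hK x) hp0.le).trans (le_max_right _ _))
  rw [integral_map (by fun_prop) (Measurable.aestronglyMeasurable (by fun_prop))] at key
  have e : ∀ z : (Fin n → ℝ) × (Fin n → ℝ),
      (k z.1 ^ q) ^ a * (f (ρ • z.1 + σ • z.2) ^ p) ^ b
        = k z.1 ^ (q - 1) * f (ρ • z.1 + σ • z.2) := by
    intro z
    rw [← rpow_mul (k0 _), ← rpow_mul (hf0 _)]
    have : q * a = q - 1 := by simp only [hadef]; field_simp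
    rw [this]
    have : p * b = 1 := by simp only [hbdef]; field_simp
    rw [this, rpow_one]
  rw [← hbdef] at key
  simp only [e] at key
  have S : ∫ z : (Fin n → ℝ) × (Fin n → ℝ), k z.1 ^ (q - 1) * f (ρ • z.1 + σ • z.2) ∂(γ.prod γ)
      = ∫ x, k x ^ q ∂γ := by
    rw [integral_prod]
    · refine integral_congr_ae (Filter.Eventually.of_forall fun x => ?_)
      simp only
      rw [integral_const_mul]
      change k x ^ (q - 1) * k x = _
      rcases (k0 x).eq_or_lt with h | h
      · rw [← h, zero_rpow hq0.ne', mul_zero]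
      · rw [rpow_sub_one h.ne']; field_simp
    · refine Integrable.of_bound (C := K ^ (q - 1) * K)
        (Measurable.aestronglyMeasurable (by fun_prop)) (Filter.Eventually.of_forall fun z => ?_)
      have h1 := k0 z.1
      have h2 := hf0 (ρ • z.1 + σ • z.2)
      rw [Real.norm_eq_abs, abs_of_nonneg (by positivity)]
      have := kK z.1
      have := hK (ρ • z.1 + σ • z.2)
      gcongr
  rw [S] at key
  set s := ∫ x, k x ^ q ∂γ with hs
  have s0 : 0 ≤ s := integral_nonneg fun x => rpow_nonneg (k0 x) _
  have r0 : 0 ≤ ∫ x, f x ^ p ∂γ := integral_nonneg fun x => rpow_nonneg (hf0 x) _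
  rcases s0.eq_or_lt with h | h
  · change s ^ (1 / q) ≤ (∫ x, f x ^ p ∂γ) ^ b
    rw [← h, zero_rpow iq0.ne']; exact rpow_nonneg r0 _
  · have hs' : s = s ^ a * s ^ (1 / q) := by
      rw [← rpow_add h, hadef, sub_add_cancel, rpow_one]
    have pa : 0 < s ^ a := rpow_pos_of_pos h a
    change s ^ (1 / q) ≤ (∫ x, f x ^ p ∂γ) ^ b
    refine le_of_mul_le_mul_left ?_ pa
    rw [← hs']
    exact key


/-- **Hypercontractivity of the semigroup of a correlated Gaussian vector**
(Tanguy, inequality (2.3) / `OU2`). Let `B` be an invertible `n × n` matrix, `Z` a standard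
Gaussian vector on `ℝ^n`, `X = BZ` with law `μ`, and for `t ≥ 0` and bounded measurable `f`
let `Q_t f(x) = E[f(e^{−t} x + √(1 − e^{−2t}) X)]`. Then for all `1 < p ≤ q < ∞` and `t ≥ 0`
with `e^{2t} ≥ (q−1)/(p−1)`, `‖Q_t f‖_{L^q(μ)} ≤ ‖f‖_{L^p(μ)}`, i.e.
`E[|Q_t f(X)|^q]^{1/q} ≤ E[|f(X)|^p]^{1/p}`. -/
theorem correlated_gaussian_semigroup_hypercontractivity
    {Ω : Type*} [MeasurableSpace Ω] (P : Measure Ω) [IsProbabilityMeasure P]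
    (n : ℕ) (B : Matrix (Fin n) (Fin n) ℝ) (hB : IsUnit B.det)
    (Z : Ω → (Fin n → ℝ)) (hZ : Measurable Z)
    (hZlaw : P.map Z = Measure.pi fun _ => gaussianReal 0 1)
    (X : Ω → (Fin n → ℝ)) (hX : ∀ ω, X ω = B.mulVec (Z ω))
    (f : (Fin n → ℝ) → ℝ) (hfm : Measurable f) (Cf : ℝ) (hfb : ∀ x, |f x| ≤ Cf)
    (Qt : ℝ → ((Fin n → ℝ) → ℝ))
    (hQt : ∀ t x, Qt t x =
      ∫ ω, f (Real.exp (-t) • x + Real.sqrt (1 - Real.exp (-2 * t)) • X ω) ∂P)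
    (p q t : ℝ) (hp : 1 < p) (hpq : p ≤ q) (ht : 0 ≤ t)
    (hhc : (q - 1) / (p - 1) ≤ Real.exp (2 * t)) :
    (∫ ω, |Qt t (X ω)| ^ q ∂P) ^ (1 / q) ≤ (∫ ω, |f (X ω)| ^ p ∂P) ^ (1 / p) := by
  obtain ⟨mX, gX, cX⟩ := hc_law P n B Z hZ hZlaw X hX
  have hq1 : 1 < q := lt_of_lt_of_le hp hpq
  have he : (Real.exp (-t)) ^ 2 = Real.exp (-2 * t) := by
    rw [← Real.exp_nat_mul]; congr 1; push_cast; ring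
  have hle : Real.exp (-2 * t) ≤ 1 := Real.exp_le_one_iff.2 (by linarith)
  have hρσ : (Real.exp (-t)) ^ 2 + (Real.sqrt (1 - Real.exp (-2 * t))) ^ 2 = 1 := by
    rw [Real.sq_sqrt (by linarith), he]; ring
  have hh : (Real.exp (-t)) ^ 2 * (q - 1) ≤ p - 1 := by
    rw [div_le_iff₀ (by linarith)] at hhc
    rw [he]
    calc Real.exp (-2 * t) * (q - 1) ≤ Real.exp (-2 * t) * (Real.exp (2 * t) * (p - 1)) := by gcongr
      _ = p - 1 := by
        rw [← mul_assoc, ← Real.exp_add]; simp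
  have main := hc_final (P.map X) cX hρσ hp hpq hh (f := fun x => |f x|) (by fun_prop)
    (fun x => abs_nonneg _) hfb
  set ρ := Real.exp (-t)
  set σ := Real.sqrt (1 - Real.exp (-2 * t))
  have mQ : StronglyMeasurable (fun x => ∫ y, |f (ρ • x + σ • y)| ∂(P.map X)) := by
    have : StronglyMeasurable
        (fun z : (Fin n → ℝ) × (Fin n → ℝ) => |f (ρ • z.1 + σ • z.2)|) :=
      Measurable.stronglyMeasurable (by fun_prop)
    exact this.integral_prod_right
  have mQ' := mQ.measurable
  have mq : AEStronglyMeasurable (fun x => (∫ y, |f (ρ • x + σ • y)| ∂(P.map X)) ^ q) (P.map X) :=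
    Measurable.aestronglyMeasurable (by fun_prop)
  have mp : AEStronglyMeasurable (fun x => |f x| ^ p) (P.map X) :=
    Measurable.aestronglyMeasurable (by fun_prop)
  rw [integral_map mX.aemeasurable mq, integral_map mX.aemeasurable mp] at main
  refine le_trans ?_ main
  have inner : ∀ x, ∫ y, |f (ρ • x + σ • y)| ∂(P.map X) = ∫ ω, |f (ρ • x + σ • X ω)| ∂P :=
    fun x => integral_map mX.aemeasurable (Measurable.aestronglyMeasurable (by fun_prop))
  have le1 : ∀ x, |Qt t x| ≤ ∫ y, |f (ρ • x + σ • y)| ∂(P.map X) := by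
    intro x
    rw [inner, hQt]
    exact abs_integral_le_integral_abs
  have le2 : ∀ x, ∫ y, |f (ρ • x + σ • y)| ∂(P.map X) ≤ Cf := by
    intro x
    rw [inner]
    have := integral_mono (μ := P) (f := fun ω => |f (ρ • x + σ • X ω)|) (g := fun _ => Cf)
      (Integrable.of_bound (C := Cf) (Measurable.aestronglyMeasurable (by fun_prop))
        (Filter.Eventually.of_forall fun ω => by simpa using hfb _))
      (integrable_const Cf) (fun ω => hfb _)
    simpa using this
  have nn : ∀ x, 0 ≤ ∫ y, |f (ρ • x + σ • y)| ∂(P.map X) :=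
    fun x => integral_nonneg fun y => abs_nonneg _
  refine Real.rpow_le_rpow (integral_nonneg fun ω => Real.rpow_nonneg (abs_nonneg _) _) ?_
    (by positivity)
  refine integral_mono_of_nonneg (Filter.Eventually.of_forall fun ω =>
    Real.rpow_nonneg (abs_nonneg _) _) ?_ (Filter.Eventually.of_forall fun ω =>
    Real.rpow_le_rpow (abs_nonneg _) (le1 _) (by linarith))
  refine Integrable.of_bound (C := Cf ^ q) ?_ (Filter.Eventually.of_forall fun ω => ?_)
  · exact Measurable.aestronglyMeasurable ((mQ'.comp mX).pow_const q)
  · rw [Real.norm_eq_abs, abs_of_nonneg (Real.rpow_nonneg (nn _) _)]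
    exact Real.rpow_le_rpow (nn _) (le2 _) (by linarith)
end
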